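/- Let p and q be prime numbers and let r and s be nonnegative integers with p^r q^s > 1. Every semisimple Hopf algebra H over ℂ of dimension p^r q^s contains a nontrivial group-like element, i.e., an element g ∈ H with g ≠ 1, Δ(g) = g ⊗ g and ε(g) = 1. -/

import Mathlib

set_option linter.all false
namespace HB
open TensorProduct

theorem trace_idem_nat {U : Type*} [AddCommGroup U] [Module ℂ U] [FiniteDimensional ℂ U]
    {Q : Module.End ℂ U} (h : Q * Q = Q) : ∃ n : ℕ, LinearMap.trace ℂ U Q = n :=
  ⟨_, (LinearMap.IsIdempotentElem.isProj_range Q h).trace⟩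

theorem fin_decomp {U : Type*} [AddCommGroup U] [Module ℂ U]
    (T Q : Module.End ℂ U) (hQ : Q * Q = Q) (hc : T * Q = Q * T) (m : ℕ) (hm : 0 < m)
    (hT : T ^ m = 1) : ∃ (c : Fin m → ℂ) (P : Fin m → Module.End ℂ U),
      (∀ j, c j ^ m = 1) ∧ (∀ j, P j * P j = P j) ∧ (∑ j, P j = Q) ∧
      (∀ j, T * P j = c j • P j) := by
  have hm0 : (m : ℂ) ≠ 0 := by exact_mod_cast hm.ne'
  have : NeZero m := ⟨hm.ne'⟩
  have hw := Complex.isPrimitiveRoot_exp m hm.ne'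
  set w := Complex.exp (2 * Real.pi * Complex.I / m)
  have hw0 : w ≠ 0 := hw.ne_zero hm.ne'
  let P : Fin m → Module.End ℂ U := fun j =>
    (m : ℂ)⁻¹ • ∑ k ∈ Finset.range m, (w ^ (j : ℕ)) ^ k • (T ^ k * Q)
  have hwj : ∀ j : Fin m, (w ^ (j : ℕ)) ^ m = 1 := fun j => by
    rw [← pow_mul, mul_comm, pow_mul, hw.pow_eq_one, one_pow]
  have hTQ : ∀ k : ℕ, Q * (T ^ k * Q) = T ^ k * Q := fun k => by
    have : Commute Q (T ^ k) := (show Commute T Q from hc).symm.pow_right k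
    rw [← mul_assoc, this.eq, mul_assoc, hQ]
  have hQP : ∀ j, Q * P j = P j := fun j => by
    simp only [P, mul_smul_comm, Finset.mul_sum, hTQ]
  have hTP : ∀ j, T * P j = (w ^ (j : ℕ))⁻¹ • P j := fun j => by
    have hn : w ^ (j : ℕ) ≠ 0 := pow_ne_zero _ hw0
    rw [eq_inv_smul_iff₀ hn]
    simp only [P, mul_smul_comm, Finset.mul_sum, Finset.smul_sum]
    have h1 := Finset.sum_range_succ (fun k => (m:ℂ)⁻¹ • (w ^ (j : ℕ)) ^ k • (T ^ k * Q)) m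
    rw [Finset.sum_range_succ'] at h1
    simp only [hwj, hT, pow_zero, add_left_inj] at h1
    rw [← h1]
    refine Finset.sum_congr rfl fun k _ => ?_
    rw [smul_comm (w ^ (j:ℕ)), ← mul_assoc, ← pow_succ', smul_smul (w ^ (j:ℕ)), ← pow_succ']
  have hTk : ∀ j (k : ℕ), T ^ k * P j = ((w ^ (j : ℕ))⁻¹) ^ k • P j := fun j k => by
    induction k with
    | zero => simp
    | succ k ih => rw [pow_succ', mul_assoc, ih, mul_smul_comm, hTP, smul_smul, pow_succ]
  refine ⟨fun j => (w ^ (j : ℕ))⁻¹, P, fun j => by rw [inv_pow, hwj, inv_one], fun j => ?_, ?_, hTP⟩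
  · have hn : w ^ (j : ℕ) ≠ 0 := pow_ne_zero _ hw0
    have : ∀ k, (w ^ (j:ℕ)) ^ k • (T ^ k * Q) * P j = P j := fun k => by
      rw [smul_mul_assoc, mul_assoc, hQP, hTk, smul_smul, ← mul_pow, mul_inv_cancel₀ hn, one_pow,
        one_smul]
    conv_lhs => enter [1]; simp only [P]
    rw [smul_mul_assoc, Finset.sum_mul, Finset.sum_congr rfl fun k _ => this k, Finset.sum_const,
      Finset.card_range, ← Nat.cast_smul_eq_nsmul ℂ, smul_smul, inv_mul_cancel₀ hm0, one_smul]
  · simp only [P, ← Finset.smul_sum]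
    rw [Finset.sum_comm]
    simp only [← Finset.sum_smul]
    have : ∀ k ∈ Finset.range m, (∑ j : Fin m, (w ^ (j:ℕ)) ^ k) • (T ^ k * Q)
        = if k = 0 then (m : ℂ) • Q else 0 := fun k hk => by
      split_ifs with h
      · subst h; simp
      · have h1 : ∑ j : Fin m, (w ^ (j:ℕ)) ^ k = ∑ j ∈ Finset.range m, (w ^ k) ^ j := by
          rw [Finset.sum_range]; exact Finset.sum_congr rfl fun j _ => by
            rw [← pow_mul, ← pow_mul, mul_comm]
        have h2 : w ^ k ≠ 1 := hw.pow_ne_one_of_pos_of_lt h (Finset.mem_range.1 hk)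
        have h3 : (w ^ k) ^ m = 1 := by rw [← pow_mul, mul_comm, pow_mul, hw.pow_eq_one, one_pow]
        rw [h1, geom_sum_eq h2, h3]; simp
    rw [Finset.sum_congr rfl this]
    simp [hm, hm0, smul_smul]

theorem avg_num {m : ℕ} (hm : 0 < m) {ι : Type*} [Fintype ι] (c : ι → ℂ) (n : ι → ℕ)
    (hc : ∀ j, c j ^ m = 1) (β : ℂ) (hβ : IsIntegral ℤ β) (hβ0 : β ≠ 0)
    (h : ∑ j, (n j : ℂ) * c j = β * ∑ j, (n j : ℂ)) (j : ι) (hj : n j ≠ 0) : c j = β := by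
  classical
  have hn1 : ∀ {z : ℂ}, z ^ m = 1 → ‖z‖ = 1 := fun {z} hz =>
    Complex.norm_eq_one_of_pow_eq_one hz hm.ne'
  have hS : 0 < ∑ j, (n j : ℝ) :=
    Finset.sum_pos' (fun _ _ => Nat.cast_nonneg _) ⟨j, Finset.mem_univ _, by positivity⟩
  have hS0 : (∑ j, (n j : ℂ)) ≠ 0 := by
    have : ((∑ j, (n j : ℝ) : ℝ) : ℂ) ≠ 0 := by exact_mod_cast hS.ne'
    simpa using this
  let F := IntermediateField.adjoin ℚ (Set.range c)
  have hfin : FiniteDimensional ℚ F :=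
    IntermediateField.finiteDimensional_adjoin (by
      rintro _ ⟨i, rfl⟩
      exact IsIntegral.of_pow hm (by rw [hc]; exact isIntegral_one))
  have hcF : ∀ i, c i ∈ F := fun i => IntermediateField.subset_adjoin _ _ ⟨i, rfl⟩
  let cF : ι → F := fun i => ⟨c i, hcF i⟩
  let bF : F := (∑ j, (n j : F) * cF j) / ∑ j, (n j : F)
  have hb : (bF : ℂ) = β := by
    simp only [bF, cF]; push_cast
    rw [h, mul_div_assoc, div_self hS0, mul_one]
  have hbi : IsIntegral ℤ bF := by
    rw [← hb] at hβ
    exact (isIntegral_algebraMap_iff (FaithfulSMul.algebraMap_injective F ℂ)).1 hβ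
  have hle : ∀ φ : F →ₐ[ℚ] ℂ, ‖φ bF‖ ≤ 1 := fun φ => by
    simp only [bF, map_div₀, map_sum, map_mul, map_natCast, norm_div]
    have e1 : ‖∑ j, (n j : ℂ)‖ = ∑ j, (n j : ℝ) := by
      have : (∑ j, (n j : ℂ)) = ((∑ j, (n j : ℝ) : ℝ) : ℂ) := by push_cast; rfl
      rw [this, Complex.norm_real, Real.norm_of_nonneg hS.le]
    rw [e1, div_le_one hS]
    refine (norm_sum_le _ _).trans (Finset.sum_le_sum fun i _ => ?_)
    have : ‖φ (cF i)‖ = 1 := hn1 (by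
      rw [← map_pow, show cF i ^ m = 1 from Subtype.ext (by simpa [cF] using hc i), map_one])
    rw [norm_mul, this, mul_one]; simp
  have hnorm : (1:ℝ) ≤ ‖(algebraMap ℚ ℂ (Algebra.norm ℚ bF))‖ := by
    have h1 : IsIntegral ℤ (Algebra.norm ℚ bF) := Algebra.isIntegral_norm ℚ hbi
    obtain ⟨z, hz⟩ := IsIntegrallyClosed.isIntegral_iff.1 h1
    have h2 : Algebra.norm ℚ bF ≠ 0 := by
      rw [Algebra.norm_ne_zero_iff]
      intro h0; rw [h0] at hb; exact hβ0 hb.symm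
    rw [← hz] at h2 ⊢
    have h3 : z ≠ 0 := by rintro rfl; simp at h2
    simpa using (show (1:ℝ) ≤ |(z:ℝ)| by exact_mod_cast Int.one_le_abs h3)
  rw [Algebra.norm_eq_prod_embeddings ℚ ℂ, norm_prod] at hnorm
  have hβ1 : ‖β‖ = 1 := by
    have h1 := Finset.prod_erase_mul Finset.univ (fun φ : F →ₐ[ℚ] ℂ => ‖φ bF‖)
      (Finset.mem_univ F.val)
    have h2 : ∏ φ ∈ Finset.univ.erase F.val, ‖φ bF‖ ≤ 1 :=
      Finset.prod_le_one (fun _ _ => norm_nonneg _) (fun φ _ => hle φ)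
    have h3 : ‖F.val bF‖ = ‖β‖ := by rw [← hb]; rfl
    have h4 : ‖β‖ ≤ 1 := h3 ▸ hle F.val
    refine le_antisymm h4 ?_
    have h1' : (∏ φ ∈ Finset.univ.erase F.val, ‖φ bF‖) * ‖β‖ = ∏ φ : F →ₐ[ℚ] ℂ, ‖φ bF‖ := by
      rw [← h3]; exact h1
    have h6 := hnorm.trans_eq h1'.symm
    nlinarith [norm_nonneg β]
  -- now equality case
  have hre : ∑ i, (n i : ℝ) * (1 - (c i * (starRingEnd ℂ) β).re) = 0 := by
    have h1 : ∑ i, (n i : ℂ) * (c i * (starRingEnd ℂ) β) = ∑ i, (n i : ℂ) := by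
      simp only [← mul_assoc]
      rw [← Finset.sum_mul, h, mul_right_comm, Complex.mul_conj, Complex.normSq_eq_norm_sq, hβ1]
      simp
    have h2 := congrArg Complex.re h1
    simp only [Complex.re_sum, Complex.natCast_re] at h2
    simp only [mul_sub, mul_one, Finset.sum_sub_distrib]
    rw [← h2, sub_eq_zero]
    refine Finset.sum_congr rfl fun i _ => ?_
    rw [← Complex.ofReal_natCast, Complex.re_ofReal_mul]
  have hn : ∀ i, ‖c i * (starRingEnd ℂ) β‖ = 1 := fun i => by
    rw [norm_mul, hn1 (hc i), RCLike.norm_conj, hβ1, one_mul]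
  have hz := (Finset.sum_eq_zero_iff_of_nonneg (fun i _ => mul_nonneg (Nat.cast_nonneg _)
    (sub_nonneg.2 ((Complex.re_le_norm _).trans (hn i).le)))).1 hre j (Finset.mem_univ _)
  have hr : (c j * (starRingEnd ℂ) β).re = 1 := by
    rcases mul_eq_zero.1 hz with h | h
    · exact absurd (by exact_mod_cast h) hj
    · linarith
  have h1 : c j * (starRingEnd ℂ) β = 1 := by
    have hsq := Complex.sq_norm (c j * (starRingEnd ℂ) β)
    rw [hn, Complex.normSq_apply, hr] at hsq
    apply Complex.ext
    · exact hr
    · rw [Complex.one_im]; nlinarith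
  have h2 : β * (starRingEnd ℂ) β = 1 := by
    rw [Complex.mul_conj, Complex.normSq_eq_norm_sq, hβ1]; simp
  calc c j = c j * (β * (starRingEnd ℂ) β) := by rw [h2, mul_one]
    _ = β * (c j * (starRingEnd ℂ) β) := by ring
    _ = β := by rw [h1, mul_one]

theorem avg {U : Type*} [AddCommGroup U] [Module ℂ U] [FiniteDimensional ℂ U]
    (T Q : Module.End ℂ U) (hQ : Q * Q = Q) (hc : T * Q = Q * T) (m : ℕ) (hm : 0 < m)
    (hT : T ^ m = 1) (β : ℂ) (hβ : IsIntegral ℤ β) (hβ0 : β ≠ 0)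
    (h : LinearMap.trace ℂ U (T * Q) = β * LinearMap.trace ℂ U Q) : T * Q = β • Q := by
  obtain ⟨c, P, h1, h2, h3, h4⟩ := fin_decomp T Q hQ hc m hm hT
  choose n hn using fun j => trace_idem_nat (h2 j)
  have h5 : T * Q = ∑ j, c j • P j := by rw [← h3, Finset.mul_sum]; simp [h4]
  have h6 : ∑ j, (n j : ℂ) * c j = β * ∑ j, (n j : ℂ) := by
    rw [h5, ← h3] at h
    simpa [hn, mul_comm] using h
  rw [h5, ← h3, Finset.smul_sum]
  refine Finset.sum_congr rfl fun j _ => ?_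
  by_cases hj : n j = 0
  · have : P j = 0 := LinearMap.IsIdempotentElem.eq_zero_of_trace_eq_zero (h2 j) (by simp [hn, hj])
    simp [this]
  · rw [avg_num hm c n h1 β hβ hβ0 h6 j hj]

/-- trace of finite order operator times commuting idempotent is integral -/
theorem trace_fin_integral {U : Type*} [AddCommGroup U] [Module ℂ U] [FiniteDimensional ℂ U]
    (T Q : Module.End ℂ U) (hQ : Q * Q = Q) (hc : T * Q = Q * T) (m : ℕ) (hm : 0 < m)
    (hT : T ^ m = 1) : IsIntegral ℤ (LinearMap.trace ℂ U (T * Q)) := by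
  obtain ⟨c, P, h1, h2, h3, h4⟩ := fin_decomp T Q hQ hc m hm hT
  choose n hn using fun j => trace_idem_nat (h2 j)
  rw [← h3, Finset.mul_sum]
  simp only [h4, map_sum, map_smul, hn, smul_eq_mul]
  refine IsIntegral.sum _ fun j _ => IsIntegral.mul ?_ ?_
  · exact IsIntegral.of_pow hm (by rw [h1]; exact isIntegral_one)
  · exact_mod_cast isIntegral_algebraMap (R := ℤ) (A := ℂ) (x := (n j : ℤ))

theorem trace_inv_conj {U : Type*} [AddCommGroup U] [Module ℂ U] [FiniteDimensional ℂ U]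
    (T T' : Module.End ℂ U) (m : ℕ) (hm : 0 < m) (hT : T ^ m = 1) (hT' : T' * T = 1) :
    LinearMap.trace ℂ U T' = (starRingEnd ℂ) (LinearMap.trace ℂ U T) := by
  obtain ⟨c, P, h1, h2, h3, h4⟩ := fin_decomp T 1 (one_mul 1) (by simp) m hm hT
  choose n hn using fun j => trace_idem_nat (h2 j)
  have hcc : ∀ j, (starRingEnd ℂ) (c j) * c j = 1 := fun j => by
    rw [mul_comm, Complex.mul_conj, Complex.normSq_eq_norm_sq,
      Complex.norm_eq_one_of_pow_eq_one (h1 j) hm.ne']; simp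
  have h5 : ∀ j, T' * P j = (starRingEnd ℂ) (c j) • P j := fun j => by
    have : T' * (T * P j) = P j := by rw [← mul_assoc, hT', one_mul]
    rw [h4, mul_smul_comm] at this
    conv_rhs => rw [← this]
    rw [smul_smul, hcc, one_smul]
  rw [← mul_one T, ← mul_one T', ← h3, Finset.mul_sum, Finset.mul_sum]
  simp [h4, h5, hn]

theorem eig_int {ι : Type*} [Fintype ι] (N : ι → ι → ℤ) (v : ι → ℂ) (i₀ : ι)
    (hv : v i₀ ≠ 0) (w : ℂ) (h : ∀ i, ∑ j, (N i j : ℂ) * v j = w * v i) : IsIntegral ℤ w := by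
  classical
  let M : Matrix ι ι ℤ := Matrix.of N
  refine ⟨M.charpoly, M.charpoly_monic, ?_⟩
  have h1 : (algebraMap ℤ ℂ) = Int.castRingHom ℂ := rfl
  rw [← Polynomial.eval_map, ← Matrix.charpoly_map, Matrix.eval_charpoly]
  apply Matrix.exists_mulVec_eq_zero_iff.1
  refine ⟨v, fun h0 => hv (congrFun h0 i₀), ?_⟩
  ext i
  rw [Matrix.sub_mulVec, Matrix.scalar_apply]
  simp only [Pi.sub_apply, Matrix.mulVec_diagonal, Pi.zero_apply, sub_eq_zero]
  rw [← h i]; rfl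

theorem ss_of_trace {B : Type*} [Ring B] [Algebra ℂ B] [FiniteDimensional ℂ B]
    (h : ∀ x : B, (∀ y, LinearMap.trace ℂ B (LinearMap.mulLeft ℂ (x * y)) = 0) → x = 0) :
    IsSemisimpleRing B := by
  have : IsArtinianRing B := IsArtinianRing.of_finite ℂ B
  rw [IsArtinianRing.isSemisimpleRing_iff_jacobson, eq_bot_iff]
  intro x hx
  obtain ⟨n, hn⟩ := (IsSemiprimaryRing.isNilpotent (R := B))
  refine (Submodule.mem_bot _).2 (h x fun y => ?_)
  have hxy : x * y ∈ Ring.jacobson B := Ideal.mul_mem_right _ _ hx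
  have : (x * y) ^ n = 0 := by
    have := Ideal.pow_mem_pow hxy n
    rw [hn] at this; simpa using this
  refine (LinearMap.isNilpotent_trace_of_isNilpotent ?_).eq_zero
  exact ⟨n, by rw [LinearMap.pow_mulLeft, this]; simp⟩

end HB
set_option linter.all false
namespace HB
open TensorProduct Coalgebra WithConv HopfAlgebra

abbrev W (C T : Type*) [AddCommGroup C] [Module ℂ C] [Ring T] [Algebra ℂ T] := WithConv (C →ₗ[ℂ] T)

/-- the dual algebra -/
def Du (A : Type*) [Ring A] [HopfAlgebra ℂ A] := WithConv (A →ₗ[ℂ] ℂ)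

section dual
variable {A : Type*} [Ring A] [HopfAlgebra ℂ A]

noncomputable instance : Ring (Du A) := inferInstanceAs (Ring (WithConv (A →ₗ[ℂ] ℂ)))
noncomputable instance : Algebra ℂ (Du A) := inferInstanceAs (Algebra ℂ (WithConv (A →ₗ[ℂ] ℂ)))

/-- evaluation -/
noncomputable def ev : A →ₗ[ℂ] Du A →ₗ[ℂ] ℂ :=
  LinearMap.mk₂ ℂ (fun a (f : Du A) => (WithConv.ofConv f) a) (fun _ _ f => map_add (WithConv.ofConv f) _ _)
    (fun _ _ f => map_smul (WithConv.ofConv f) _ _) (fun _ _ _ => rfl) (fun _ _ _ => rfl)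

noncomputable instance : FunLike (Du A) A ℂ where
  coe f a := ev a f
  coe_injective f g h := WithConv.ext (LinearMap.ext fun a => congrFun h a)
instance : LinearMapClass (Du A) ℂ A ℂ where
  map_add f a b := map_add (WithConv.ofConv f) a b
  map_smulₛₗ f c a := map_smul (WithConv.ofConv f) c a

/-- the functional -/
noncomputable def Du.lin : Du A →ₗ[ℂ] (A →ₗ[ℂ] ℂ) where
  toFun f := WithConv.ofConv f
  map_add' _ _ := rfl
  map_smul' _ _ := rfl
/-- from a functional -/
noncomputable def Du.of : (A →ₗ[ℂ] ℂ) →ₗ[ℂ] Du A where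
  toFun f := toConv f
  map_add' _ _ := rfl
  map_smul' _ _ := rfl
@[simp] theorem Du.lin_apply (f : Du A) (a : A) : Du.lin f a = f a := rfl
@[simp] theorem Du.of_apply (f : A →ₗ[ℂ] ℂ) (a : A) : Du.of f a = f a := rfl
@[simp] theorem ev_apply (a : A) (f : Du A) : ev a f = f a := rfl
@[simp] theorem Du.add_apply (f g : Du A) (a : A) : (f + g) a = f a + g a := rfl
@[simp] theorem Du.sub_apply (f g : Du A) (a : A) : (f - g) a = f a - g a := rfl
@[simp] theorem Du.zero_apply (a : A) : (0 : Du A) a = 0 := rfl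
@[simp] theorem Du.smul_apply (c : ℂ) (f : Du A) (a : A) : (c • f) a = c * f a := rfl
@[simp] theorem Du.sum_apply {ι : Type*} (s : Finset ι) (f : ι → Du A) (a : A) :
    (∑ i ∈ s, f i) a = ∑ i ∈ s, f i a := map_sum (ev a) f s
@[ext] theorem Du.ext {f g : Du A} (h : ∀ a, f a = g a) : f = g := DFunLike.ext f g h
@[simp] theorem Du.one_apply (a : A) : (1 : Du A) a = counit (R := ℂ) a := rfl
theorem Du.mul_apply (f g : Du A) (a : A) : (f * g) a =
    LinearMap.mul' ℂ ℂ (TensorProduct.map (Du.lin f) (Du.lin g) (comul (R := ℂ) a)) := rfl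
theorem Du.mul_repr (f g : Du A) {a : A} {ι : Type*} (r : Coalgebra.Repr ℂ a ι) :
    (f * g) a = ∑ i ∈ r.index, f (r.left i) * g (r.right i) := r.convMul_apply _ _

variable [FiniteDimensional ℂ A]
instance : FiniteDimensional ℂ (Du A) :=
  Module.Finite.equiv (LinearEquiv.ofLinear (Du.lin (A := A)) Du.of rfl rfl).symm
theorem finrank_Du : Module.finrank ℂ (Du A) = Module.finrank ℂ A := by
  rw [(LinearEquiv.ofLinear (Du.lin (A := A)) Du.of rfl rfl).finrank_eq]; exact Subspace.dual_finrank_eq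
variable (A) in
noncomputable def bs : Module.Basis (Fin (Module.finrank ℂ A)) ℂ A := Module.finBasis ℂ A
variable (A) in
noncomputable def cb (i : Fin (Module.finrank ℂ A)) : Du A := Du.of ((bs A).coord i)
theorem exA (a : A) : ∑ i, (cb A i) a • bs A i = a := (bs A).sum_repr a
theorem exK {U : Type*} [AddCommGroup U] [Module ℂ U] (f : A →ₗ[ℂ] U) (a : A) :
    ∑ i, (cb A i) a • f (bs A i) = f a := by
  conv_rhs => rw [← exA a]
  simp
theorem exD (f : Du A) : ∑ i, f (bs A i) • cb A i = f := by
  ext a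
  have := exK (Du.lin f) a
  simpa [mul_comm] using this
noncomputable def p2 (a b : A) : Du A ⊗[ℂ] Du A →ₗ[ℂ] ℂ :=
  LinearMap.mul' ℂ ℂ ∘ₗ TensorProduct.map (ev a) (ev b)
@[simp] theorem p2_tmul (a b : A) (f g : Du A) : p2 a b (f ⊗ₜ g) = f a * g b := rfl
theorem p2_exp (x : Du A ⊗[ℂ] Du A) :
    ∑ i, ∑ j, p2 (bs A i) (bs A j) x • (cb A i ⊗ₜ[ℂ] cb A j) = x := by
  induction x with
  | zero => simp
  | add x y hx hy => simp only [map_add, add_smul, Finset.sum_add_distrib, hx, hy]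
  | tmul f g =>
    conv_rhs => rw [← exD f, ← exD g, TensorProduct.sum_tmul]
    simp only [TensorProduct.tmul_sum, TensorProduct.smul_tmul_smul, p2_tmul]
theorem p2_ext {x y : Du A ⊗[ℂ] Du A} (h : ∀ a b, p2 a b x = p2 a b y) : x = y := by
  rw [← p2_exp x, ← p2_exp y]; simp [h]
theorem p3_ext {x y : Du A ⊗[ℂ] (Du A ⊗[ℂ] Du A)}
    (h : ∀ a b c, LinearMap.mul' ℂ ℂ (TensorProduct.map (ev a) (p2 b c) x)
      = LinearMap.mul' ℂ ℂ (TensorProduct.map (ev a) (p2 b c) y)) : x = y := by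
  have key : ∀ x : Du A ⊗[ℂ] (Du A ⊗[ℂ] Du A), ∑ i, ∑ j, ∑ k, (LinearMap.mul' ℂ ℂ
      (TensorProduct.map (ev (bs A i)) (p2 (bs A j) (bs A k)) x)) • (cb A i ⊗ₜ[ℂ]
        (cb A j ⊗ₜ[ℂ] cb A k)) = x := fun x => by
    induction x with
    | zero => simp
    | add x y hx hy => simp only [map_add, add_smul, Finset.sum_add_distrib, hx, hy]
    | tmul f g =>
      conv_rhs => rw [← exD f, ← p2_exp g, TensorProduct.sum_tmul]
      simp only [TensorProduct.tmul_sum, TensorProduct.smul_tmul_smul]; rfl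
  rw [← key x, ← key y]; simp only [h]

/-- f(b ·) -/
noncomputable def lmul (b : A) : Du A →ₗ[ℂ] Du A where
  toFun f := Du.of (Du.lin f ∘ₗ LinearMap.mulLeft ℂ b)
  map_add' _ _ := rfl
  map_smul' _ _ := rfl
@[simp] theorem lmul_apply (b a : A) (f : Du A) : (lmul b f) a = f (b * a) := rfl
/-- f(· b) -/
noncomputable def rmul (b : A) : Du A →ₗ[ℂ] Du A where
  toFun f := Du.of (Du.lin f ∘ₗ LinearMap.mulRight ℂ b)
  map_add' _ _ := rfl
  map_smul' _ _ := rfl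
@[simp] theorem rmul_apply (b a : A) (f : Du A) : (rmul b f) a = f (a * b) := rfl
/-- f ∘ S -/
noncomputable def sdu : Du A →ₗ[ℂ] Du A where
  toFun f := Du.of (Du.lin f ∘ₗ antipode ℂ)
  map_add' _ _ := rfl
  map_smul' _ _ := rfl
@[simp] theorem sdu_apply (a : A) (f : Du A) : (sdu f) a = f (antipode ℂ a) := rfl

noncomputable def dcomul : Du A →ₗ[ℂ] Du A ⊗[ℂ] Du A :=
  ∑ i, TensorProduct.mk ℂ _ _ (cb A i) ∘ₗ lmul (bs A i)
theorem dcomul_eq (f : Du A) : dcomul f = ∑ i, cb A i ⊗ₜ[ℂ] lmul (bs A i) f := by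
  simp [dcomul]

@[simp] theorem p2_dcomul (a b : A) (f : Du A) : p2 a b (dcomul f) = f (a * b) := by
  have := exK (Du.lin f ∘ₗ LinearMap.mulRight ℂ b) a
  simpa [dcomul_eq] using this

noncomputable instance : CoalgebraStruct ℂ (Du A) where
  comul := dcomul
  counit := ev 1

theorem du_counit (f : Du A) : counit (R := ℂ) f = f 1 := rfl
theorem du_comul (f : Du A) : comul (R := ℂ) f = dcomul f := rfl

noncomputable instance : Coalgebra ℂ (Du A) where
  coassoc := by
    ext1 f
    apply p3_ext
    intro a b c
    have h1 : ∀ x : Du A ⊗[ℂ] Du A, LinearMap.mul' ℂ ℂ (TensorProduct.map (ev a) (p2 b c)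
        (TensorProduct.assoc ℂ _ _ _ (LinearMap.rTensor _ comul x))) = p2 (a * b) c x := fun x => by
      induction x with
      | zero => simp
      | add x y hx hy => simp only [map_add, hx, hy]
      | tmul f g =>
        simp only [LinearMap.rTensor_tmul, du_comul, p2_tmul]
        rw [← p2_dcomul]
        induction dcomul f with
        | zero => simp
        | add x y hx hy => simp only [map_add, hx, hy, TensorProduct.add_tmul, add_mul]
        | tmul f g => simp [mul_assoc]
    have h2 : ∀ x : Du A ⊗[ℂ] Du A, LinearMap.mul' ℂ ℂ (TensorProduct.map (ev a) (p2 b c)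
        (LinearMap.lTensor _ comul x)) = p2 a (b * c) x := fun x => by
      induction x with
      | zero => simp
      | add x y hx hy => simp only [map_add, hx, hy]
      | tmul f g => simp [du_comul]
    simp only [LinearMap.comp_apply, LinearEquiv.coe_coe]
    rw [h1, h2]; simp [du_comul, mul_assoc]
  rTensor_counit_comp_comul := by
    ext1 f
    have := exD f
    simp only [LinearMap.comp_apply, du_comul, dcomul_eq, map_sum, LinearMap.rTensor_tmul, du_counit,
      TensorProduct.mk_apply]
    have h1 : ∀ i, (cb A i) 1 ⊗ₜ[ℂ] lmul (bs A i) f = 1 ⊗ₜ[ℂ] ((cb A i) 1 • lmul (bs A i) f) := fun i => by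
      rw [← TensorProduct.smul_tmul, smul_eq_mul, mul_one]
    rw [Finset.sum_congr rfl fun i _ => h1 i, ← TensorProduct.tmul_sum]
    congr 1
    ext a
    have := exK (Du.lin f ∘ₗ LinearMap.mulRight ℂ a) 1
    simpa using this
  lTensor_counit_comp_comul := by
    ext1 f
    simp only [LinearMap.comp_apply, du_comul, dcomul_eq, map_sum, LinearMap.lTensor_tmul, du_counit,
      lmul_apply, mul_one, LinearMap.flip_apply, TensorProduct.mk_apply]
    have h1 : ∀ i, (cb A i) ⊗ₜ[ℂ] (f (bs A i)) = (f (bs A i) • cb A i) ⊗ₜ[ℂ] (1:ℂ) := fun i => by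
      rw [TensorProduct.smul_tmul, smul_eq_mul, mul_one]
    rw [Finset.sum_congr rfl fun i _ => h1 i, ← TensorProduct.sum_tmul, exD]

theorem p2_mul (a b : A) (x y : Du A ⊗[ℂ] Du A) : p2 a b (x * y) = ∑ i ∈ (ℛ ℂ a).index,
    ∑ j ∈ (ℛ ℂ b).index, p2 ((ℛ ℂ a).left i) ((ℛ ℂ b).left j) x *
      p2 ((ℛ ℂ a).right i) ((ℛ ℂ b).right j) y := by
  induction x with
  | zero => simp
  | add x y hx hy => simp only [map_add, hx, hy, add_mul, Finset.sum_add_distrib]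
  | tmul f g =>
    induction y with
    | zero => simp
    | add x y hx hy => simp only [map_add, hx, hy, mul_add, Finset.sum_add_distrib]
    | tmul f' g' =>
      rw [Algebra.TensorProduct.tmul_mul_tmul, p2_tmul, Du.mul_repr _ _ (ℛ ℂ a),
        Du.mul_repr _ _ (ℛ ℂ b), Finset.sum_mul_sum]
      simp only [p2_tmul]
      exact Finset.sum_congr rfl fun i _ => Finset.sum_congr rfl fun j _ => by ring

theorem conv_mul_apply {T : Type*} [Ring T] [Algebra ℂ T] (f g : W A T) (a b : A) :
    (f * g) (a * b) = ∑ i ∈ (ℛ ℂ a).index, ∑ j ∈ (ℛ ℂ b).index,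
      f ((ℛ ℂ a).left i * (ℛ ℂ b).left j) * g ((ℛ ℂ a).right i * (ℛ ℂ b).right j) := by
  rw [LinearMap.convMul_apply, Bialgebra.comul_mul]
  conv_lhs => rw [← (ℛ ℂ a).eq, ← (ℛ ℂ b).eq, Finset.sum_mul_sum]
  simp

noncomputable instance : Bialgebra ℂ (Du A) :=
  Bialgebra.mk' ℂ (Du A) (by simp [du_counit]) (by intro f g; simp [du_counit, Du.mul_apply, Algebra.TensorProduct.one_def])
    (by apply p2_ext; intro a b; rw [du_comul, p2_dcomul, Algebra.TensorProduct.one_def]; simp)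
    (by intro f g
        apply p2_ext; intro a b
        rw [p2_mul, du_comul, p2_dcomul]
        refine (conv_mul_apply _ _ _ _).trans ?_
        simp only [du_comul, p2_dcomul]; rfl)

noncomputable instance : HopfAlgebra ℂ (Du A) where
  antipode := sdu
  mul_antipode_rTensor_comul := by
    ext1 f
    ext a
    have h1 : ∀ x : Du A ⊗[ℂ] Du A, (LinearMap.mul' ℂ (Du A) (LinearMap.rTensor _ sdu x)) a =
        ∑ i ∈ (ℛ ℂ a).index, p2 (antipode ℂ ((ℛ ℂ a).left i)) ((ℛ ℂ a).right i) x := fun x => by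
      induction x with
      | zero => simp
      | add x y hx hy => simp [map_add, hx, hy, Finset.sum_add_distrib]
      | tmul f g => simp only [LinearMap.rTensor_tmul, LinearMap.mul'_apply, Du.mul_repr _ _ (ℛ ℂ a)]; rfl
    simp only [LinearMap.comp_apply]
    rw [h1]
    simp only [du_comul, p2_dcomul]
    rw [← map_sum, sum_antipode_mul_eq_algebraMap_counit]
    simp [du_counit, Algebra.algebraMap_eq_smul_one, mul_comm]
  mul_antipode_lTensor_comul := by
    ext1 f
    ext a
    have h1 : ∀ x : Du A ⊗[ℂ] Du A, (LinearMap.mul' ℂ (Du A) (LinearMap.lTensor _ sdu x)) a =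
        ∑ i ∈ (ℛ ℂ a).index, p2 ((ℛ ℂ a).left i) (antipode ℂ ((ℛ ℂ a).right i)) x := fun x => by
      induction x with
      | zero => simp
      | add x y hx hy => simp [map_add, hx, hy, Finset.sum_add_distrib]
      | tmul f g => simp only [LinearMap.lTensor_tmul, LinearMap.mul'_apply, Du.mul_repr _ _ (ℛ ℂ a)]; rfl
    simp only [LinearMap.comp_apply]
    rw [h1]
    simp only [du_comul, p2_dcomul]
    rw [← map_sum, sum_mul_antipode_eq_algebraMap_counit]
    simp [du_counit, Algebra.algebraMap_eq_smul_one, mul_comm]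

theorem du_antipode (f : Du A) : antipode ℂ f = sdu f := rfl
end dual
end HB
set_option linter.all false
namespace HB
open TensorProduct Coalgebra WithConv HopfAlgebra

/-! Wedderburn data -/
structure Wd (B : Type*) [Ring B] [Algebra ℂ B] where
  n : ℕ
  d : Fin n → ℕ
  hd : ∀ i, NeZero (d i)
  e : B ≃ₐ[ℂ] (Π i, Matrix (Fin (d i)) (Fin (d i)) ℂ)

theorem wd_exists (B : Type*) [Ring B] [Algebra ℂ B] [FiniteDimensional ℂ B] [IsSemisimpleRing B] :
    Nonempty (Wd B) := by
  obtain ⟨n, d, h, ⟨e⟩⟩ := IsSemisimpleRing.exists_algEquiv_pi_matrix_of_isAlgClosed ℂ B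
  exact ⟨⟨n, d, h, e⟩⟩

namespace Wd
variable {B : Type*} [Ring B] [Algebra ℂ B] (w : Wd B)
instance (i : Fin w.n) : NeZero (w.d i) := w.hd i
/-- matrix rep -/
noncomputable def mt (i : Fin w.n) : B →ₐ[ℂ] Matrix (Fin (w.d i)) (Fin (w.d i)) ℂ :=
  (Pi.evalAlgHom ℂ _ i).comp w.e.toAlgHom
/-- irreducible representation -/
noncomputable def rp (i : Fin w.n) : B →ₐ[ℂ] Module.End ℂ (Fin (w.d i) → ℂ) :=
  (Matrix.toLinAlgEquiv' (R := ℂ)).toAlgHom.comp (w.mt i)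
/-- irreducible character -/
noncomputable def ch (i : Fin w.n) : B →ₗ[ℂ] ℂ :=
  Matrix.traceLinearMap _ ℂ ℂ ∘ₗ (w.mt i).toLinearMap
/-- matrix unit -/
noncomputable def mu (i : Fin w.n) (k l : Fin (w.d i)) : B :=
  w.e.symm (Pi.single i (Matrix.single k l 1))
/-- primitive idempotent -/
noncomputable def pid (i : Fin w.n) : B := w.mu i 0 0

theorem ch_apply (i) (b : B) : w.ch i b = (w.mt i b).trace := rfl
theorem ch_mt (i) (b : B) : w.ch i b = (w.mt i b).trace := rfl
theorem ch_rp (i) (b : B) : w.ch i b = LinearMap.trace ℂ _ (w.rp i b) := by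
  rw [ch_mt]; exact (Matrix.trace_toLin'_eq _).symm
theorem ch_comm (i) (x y : B) : w.ch i (x * y) = w.ch i (y * x) := by
  rw [ch_mt, ch_mt, map_mul, map_mul, Matrix.trace_mul_comm]
theorem ch_one (i) : w.ch i 1 = w.d i := by simp [ch_mt]
theorem mt_mu (i k l) : w.mt i (w.mu i k l) = Matrix.single k l 1 := by simp [mt, mu]
theorem mt_mu_ne (i j k l) (h : j ≠ i) : w.mt j (w.mu i k l) = 0 := by
  simp [mt, mu, Pi.single_eq_of_ne h]
theorem ext_mt {x y : B} (h : ∀ i, w.mt i x = w.mt i y) : x = y :=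
  w.e.injective (funext h)
theorem ext_rp {x y : B} (h : ∀ i, w.rp i x = w.rp i y) : x = y :=
  w.ext_mt fun i => (Matrix.toLinAlgEquiv' (R := ℂ)).injective (h i)
theorem rp_surj (i) : Function.Surjective (w.rp i) := fun T => by
  obtain ⟨m, rfl⟩ := (Matrix.toLinAlgEquiv' (R := ℂ)).surjective T
  obtain ⟨b, hb⟩ := w.e.surjective (Pi.single i m)
  exact ⟨b, by simp [rp, mt, hb]⟩
theorem mu_mul (i) (k l k' l' : Fin (w.d i)) :
    w.mu i k l * w.mu i k' l' = if l = k' then w.mu i k l' else 0 := by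
  apply w.ext_mt; intro j
  by_cases h : j = i
  · subst h
    split_ifs with h
    · subst h; simp [mt_mu]
    · simp [mt_mu, Matrix.single_mul_single_of_ne _ _ _ _ h]
  · split_ifs <;> simp [mt_mu_ne _ _ _ _ _ h]
theorem mu_mul_ne (i j) (hij : i ≠ j) (k l k' l') :
    w.mu i k l * w.mu j k' l' = 0 := by
  apply w.ext_mt; intro t
  by_cases h : t = i
  · subst h; simp [mt_mu_ne _ _ _ _ _ hij]
  · simp [mt_mu_ne _ _ _ _ _ h]
theorem exp_mu (b : B) : b = ∑ i, ∑ k, ∑ l, (w.mt i b k l) • w.mu i k l := by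
  apply w.ext_mt; intro j
  simp only [map_sum, map_smul]
  rw [Finset.sum_eq_single j]
  · simp only [mt_mu]
    conv_lhs => rw [Matrix.matrix_eq_sum_single (w.mt j b)]
    simp
  · intro i _ h; simp [mt_mu_ne _ _ _ _ _ h.symm]
  · simp
theorem pid_idem (i) : w.pid i * w.pid i = w.pid i := by simp [pid, mu_mul]
theorem ch_pid (i j) : w.ch i (w.pid j) = if i = j then 1 else 0 := by
  split_ifs with h
  · subst h; simp [ch_mt, pid, mt_mu]
  · simp [ch_mt, pid, mt_mu_ne _ _ _ _ _ h]
theorem trace_exp {U : Type*} [AddCommGroup U] [Module ℂ U] (τ : B →ₗ[ℂ] U)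
    (h : ∀ x y, τ (x * y) = τ (y * x)) (b : B) :
    τ b = ∑ i, w.ch i b • τ (w.pid i) := by
  conv_lhs => rw [w.exp_mu b]
  simp only [map_sum, map_smul]
  refine Finset.sum_congr rfl fun i _ => ?_
  have h1 : ∀ k l, τ (w.mu i k l) = if k = l then τ (w.pid i) else 0 := fun k l => by
    have h2 : w.mu i k l = w.mu i k 0 * w.mu i 0 l := by simp [mu_mul]
    rw [h2, h, mu_mul]
    split_ifs with h3 h4 h4
    · rfl
    · exact absurd h3.symm h4
    · exact absurd h4.symm h3
    · simp
  simp only [h1, smul_ite, smul_zero, Finset.sum_ite_eq, Finset.mem_univ, if_true, ← Finset.sum_smul]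
  rfl
theorem trace_lr [FiniteDimensional ℂ B] (x y : B) : LinearMap.trace ℂ B (LinearMap.mulLeft ℂ x ∘ₗ LinearMap.mulRight ℂ y)
    = ∑ i, w.ch i x * w.ch i y := by
  classical
  let b := (Pi.basis (fun j : Fin w.n => Matrix.stdBasis ℂ (Fin (w.d j)) (Fin (w.d j)))).map
    w.e.symm.toLinearEquiv
  rw [LinearMap.trace_eq_matrix_trace ℂ b, Matrix.trace]
  simp only [Matrix.diag_apply, LinearMap.toMatrix_apply]
  have : ∀ i, (b.repr ((LinearMap.mulLeft ℂ x ∘ₗ LinearMap.mulRight ℂ y) (b i))) i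
      = w.mt i.1 x i.2.1 i.2.1 * w.mt i.1 y i.2.2 i.2.2 := by
    rintro ⟨i, k, l⟩
    have h1 : b ⟨i, k, l⟩ = w.mu i k l := by simp [b, mu, Matrix.stdBasis_eq_single]
    rw [h1]
    simp only [b, Module.Basis.map_repr, LinearEquiv.trans_apply, Pi.basis_repr, Matrix.stdBasis]
    have h2 : (w.e (x * w.mu i k l * y)) i = w.mt i x * Matrix.single k l 1 * w.mt i y := by
      rw [← mt_mu]; simp [mt]
    simp [h2, Matrix.mul_apply, Matrix.single_apply, ← mul_assoc]
    simp [ite_and]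
  simp only [this, Fintype.sum_sigma, Fintype.sum_prod_type, ch_mt, Matrix.trace, Matrix.diag_apply]
  refine Finset.sum_congr rfl fun i _ => ?_
  rw [Finset.sum_mul_sum]
theorem trace_reg [FiniteDimensional ℂ B] (x : B) : LinearMap.trace ℂ B (LinearMap.mulLeft ℂ x)
    = ∑ i, w.d i * w.ch i x := by
  have := w.trace_lr x 1
  rw [LinearMap.mulRight_one, LinearMap.comp_id] at this
  rw [this]; simp [ch_one, mul_comm]
theorem nondeg [FiniteDimensional ℂ B] (w : Wd B) (x : B)
    (h : ∀ y, LinearMap.trace ℂ B (LinearMap.mulLeft ℂ (x * y)) = 0) : x = 0 := by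
  apply w.ext_mt; intro i; ext k l
  have h1 := h (w.mu i l k)
  rw [trace_reg, Finset.sum_eq_single i] at h1
  · have h2 : (w.d i : ℂ) ≠ 0 := by exact_mod_cast NeZero.ne (w.d i)
    simpa [ch_mt, mt_mu, h2, Matrix.trace, Matrix.mul_apply, Matrix.single_apply, ite_and] using h1
  · intro j _ hj; simp [ch_mt, mt_mu_ne _ _ _ _ _ hj]
  · simp
end Wd
theorem trace_rank1 {U : Type*} [AddCommGroup U] [Module ℂ U] [FiniteDimensional ℂ U] 
   (f : U →ₗ[ℂ] ℂ) (u : U) : LinearMap.trace ℂ U (f.smulRight u) = f u := by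
  simp
end HB
set_option linter.all false
namespace HB
open TensorProduct Coalgebra WithConv HopfAlgebra

section conv
variable {C : Type*} [AddCommGroup C] [Module ℂ C] [Coalgebra ℂ C]
variable {T : Type*} [Ring T] [Algebra ℂ T]

/-- constant -/
noncomputable def cst (t : T) : W C T := toConv ((counit (R := ℂ) (A := C)).smulRight t)

theorem W.ext {f g : W C T} (h : ∀ a, f a = g a) : f = g := WithConv.ext (LinearMap.ext h)

theorem cst_apply (t : T) (c : C) : (cst t : W C T) c = counit (R := ℂ) c • t := rfl

theorem sum_counit_smul' {c : C} {ι : Type*} (r : Coalgebra.Repr ℂ c ι) :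
    ∑ x ∈ r.index, counit (R := ℂ) (r.right x) • r.left x = c := by
  have := congr(TensorProduct.lift (LinearMap.lsmul ℂ C).flip $(sum_tmul_counit_eq (R := ℂ) r))
  simpa only [map_sum, TensorProduct.lift.tmul, LinearMap.flip_apply, LinearMap.lsmul_apply, one_smul]
    using this

theorem cst_mul (t : T) (f : W C T) (c : C) : (cst t * f : W C T) c = t * f c := by
  rw [(ℛ ℂ c).convMul_apply]
  simp only [cst_apply, smul_mul_assoc, ← mul_smul_comm, ← Finset.mul_sum]
  conv_rhs => rw [← sum_counit_smul (ℛ ℂ c)]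
  simp
theorem mul_cst (t : T) (f : W C T) (c : C) : (f * cst t : W C T) c = f c * t := by
  rw [(ℛ ℂ c).convMul_apply]
  simp only [cst_apply, mul_smul_comm, ← smul_mul_assoc, ← Finset.sum_mul]
  conv_rhs => rw [← sum_counit_smul' (ℛ ℂ c)]
  simp
theorem cst_cst (t t' : T) : (cst t : W C T) * cst t' = cst (t * t') := by
  apply W.ext; intro c; rw [cst_mul, cst_apply, cst_apply, mul_smul_comm]
theorem cst_one : (cst 1 : W C T) = 1 := by
  apply W.ext; intro c; simp [cst_apply, Algebra.algebraMap_eq_smul_one]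

/-- algebra map image -/
noncomputable def hc {A : Type*} [Ring A] [Algebra ℂ A] (h : A →ₐ[ℂ] T) : W A T := toConv h.toLinearMap
theorem hc_apply {A : Type*} [Ring A] [Algebra ℂ A] (h : A →ₐ[ℂ] T) (a : A) : hc h a = h a := rfl
end conv

section tw
variable {X T Y : Type*} [Ring X] [Algebra ℂ X] [Ring T] [Algebra ℂ T] [Ring Y] [Algebra ℂ Y]
  [FiniteDimensional ℂ X] [FiniteDimensional ℂ T] [FiniteDimensional ℂ Y]

/-- x ⊗ t ↦ δ x * j t -/
noncomputable def twm (δ : X →ₐ[ℂ] Y) (j : T →ₐ[ℂ] Y) : X ⊗[ℂ] T →ₗ[ℂ] Y :=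
  LinearMap.mul' ℂ Y ∘ₗ TensorProduct.map δ.toLinearMap j.toLinearMap
@[simp] theorem twm_tmul (δ : X →ₐ[ℂ] Y) (j : T →ₐ[ℂ] Y) (x t) : twm δ j (x ⊗ₜ t) = δ x * j t := rfl

theorem tw_bij (δ : X →ₐ[ℂ] Y) (j : T →ₐ[ℂ] Y) (hs : Function.Surjective (twm δ j))
    (hd : Module.finrank ℂ Y = Module.finrank ℂ X * Module.finrank ℂ T) :
    Function.Bijective (twm δ j) :=
  ⟨(LinearMap.injective_iff_surjective_of_finrank_eq_finrank
    (by rw [Module.finrank_tensorProduct, hd])).2 hs, hs⟩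

theorem tw_conj (δ : X →ₐ[ℂ] Y) (j : T →ₐ[ℂ] Y) (hb : Function.Bijective (twm δ j)) (x : X) :
    LinearMap.mulLeft ℂ (δ x) = (LinearEquiv.ofBijective _ hb).conj
      (TensorProduct.map (LinearMap.mulLeft ℂ x) LinearMap.id) := by
  refine LinearMap.ext fun y => ?_
  obtain ⟨z, rfl⟩ := hb.2 y
  rw [LinearEquiv.conj_apply_apply]
  have : (LinearEquiv.ofBijective (twm δ j) hb).symm (twm δ j z) = z :=
    (LinearEquiv.ofBijective (twm δ j) hb).symm_apply_apply z
  rw [this]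
  clear this
  show _ = twm δ j _
  induction z with
  | zero => simp
  | add z z' h h' => simp only [map_add, h, h']
  | tmul a t => simp [mul_assoc]

theorem tw_trace (δ : X →ₐ[ℂ] Y) (j : T →ₐ[ℂ] Y) (hb : Function.Bijective (twm δ j)) (x : X) :
    LinearMap.trace ℂ Y (LinearMap.mulLeft ℂ (δ x)) =
      LinearMap.trace ℂ X (LinearMap.mulLeft ℂ x) * Module.finrank ℂ T := by
  rw [tw_conj δ j hb, LinearMap.trace_conj', LinearMap.trace_tensorProduct', LinearMap.trace_id]

theorem tw_det (δ : X →ₐ[ℂ] Y) (j : T →ₐ[ℂ] Y) (hb : Function.Bijective (twm δ j)) (x : X) :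
    LinearMap.det (LinearMap.mulLeft ℂ (δ x)) =
      LinearMap.det (LinearMap.mulLeft ℂ x) ^ Module.finrank ℂ T := by
  rw [tw_conj δ j hb, LinearEquiv.conj_apply, LinearMap.comp_assoc, LinearMap.det_conj,
    ← LinearMap.det_toMatrix ((Module.finBasis ℂ X).tensorProduct (Module.finBasis ℂ T)),
    TensorProduct.toMatrix_map, Matrix.det_kronecker, LinearMap.det_toMatrix, LinearMap.det_toMatrix]
  simp
end tw

section hopf
variable {A : Type*} [Ring A] [HopfAlgebra ℂ A]
variable {T : Type*} [Ring T] [Algebra ℂ T]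

/-- algebra map composed with the antipode -/
noncomputable def hs (h : A →ₐ[ℂ] T) : W A T := toConv (h.toLinearMap ∘ₗ antipode ℂ)
theorem hs_apply (h : A →ₐ[ℂ] T) (a : A) : hs h a = h (antipode ℂ a) := rfl
theorem hc_hs (h : A →ₐ[ℂ] T) : hc h * hs h = 1 := by
  apply W.ext; intro a
  rw [(ℛ ℂ a).convMul_apply]
  simp only [hs_apply, hc_apply, ← map_mul, ← map_sum, sum_mul_antipode_eq_algebraMap_counit]
  simp
theorem hs_hc (h : A →ₐ[ℂ] T) : hs h * hc h = 1 := by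
  apply W.ext; intro a
  rw [(ℛ ℂ a).convMul_apply]
  simp only [hs_apply, hc_apply, ← map_mul, ← map_sum, sum_antipode_mul_eq_algebraMap_counit]
  simp

/-- first embedding -/
noncomputable abbrev i1 (A B : Type*) [Ring A] [Algebra ℂ A] [Ring B] [Algebra ℂ B] : A →ₐ[ℂ] A ⊗[ℂ] B :=
  Algebra.TensorProduct.includeLeft
/-- second embedding -/
noncomputable abbrev i2 (A B : Type*) [Ring A] [Algebra ℂ A] [Ring B] [Algebra ℂ B] : B →ₐ[ℂ] A ⊗[ℂ] B :=
  Algebra.TensorProduct.includeRight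

variable (A) in
/-- comultiplication -/
noncomputable abbrev dl : A →ₐ[ℂ] A ⊗[ℂ] A := Bialgebra.comulAlgHom ℂ A
theorem dl_eq : hc (dl A) = hc (i1 A A) * hc (i2 A A) := by
  apply W.ext; intro a
  rw [(ℛ ℂ a).convMul_apply]
  simp only [hc_apply, i1, i2, Algebra.TensorProduct.includeLeft_apply, Algebra.TensorProduct.includeRight_apply,
    Algebra.TensorProduct.tmul_mul_tmul, one_mul, mul_one, (ℛ ℂ a).eq]
  rfl
theorem K1 : hs (i1 A A) * hc (dl A) = hc (i2 A A) := by
  rw [dl_eq, ← mul_assoc, hs_hc, one_mul]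
theorem K2 : hc (dl A) * hs (i2 A A) = hc (i1 A A) := by
  rw [dl_eq, mul_assoc, hc_hs, mul_one]

structure IsInt (L : A) : Prop where
  l : ∀ a, a * L = counit (R := ℂ) a • L
  r : ∀ a, L * a = counit (R := ℂ) a • L
  e : counit (R := ℂ) L = 1

theorem exists_int (A : Type*) [Ring A] [HopfAlgebra ℂ A] [IsSemisimpleRing A] : ∃ L : A, IsInt L := by
  let I : Ideal A := RingHom.ker (Bialgebra.counitAlgHom ℂ A).toRingHom
  obtain ⟨e, he, hI⟩ := IsSemisimpleRing.ideal_eq_span_idempotent I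
  let εo : Aᵐᵒᵖ →+* ℂ := ⟨⟨⟨fun x => counit (R := ℂ) x.unop, by simp⟩, by simp [mul_comm]⟩, by simp, by simp⟩
  let J : Ideal Aᵐᵒᵖ := RingHom.ker εo
  obtain ⟨f, hf, hJ⟩ := IsSemisimpleRing.ideal_eq_span_idempotent J
  have e0 : counit (R := ℂ) e = 0 := by
    have : e ∈ I := hI ▸ Ideal.mem_span_singleton_self e
    exact this
  have f0 : counit (R := ℂ) f.unop = 0 := by
    have : f ∈ J := hJ ▸ Ideal.mem_span_singleton_self f
    exact this
  have h1 : ∀ a : A, counit (R := ℂ) a = 0 → a * (1 - e) = 0 := fun a ha => by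
    have : a ∈ I := ha
    rw [hI, Ideal.mem_span_singleton'] at this
    obtain ⟨c, rfl⟩ := this
    rw [mul_sub, mul_one, mul_assoc, he.eq, sub_self]
  have h2 : ∀ a : A, counit (R := ℂ) a = 0 → (1 - f.unop) * a = 0 := fun a ha => by
    have : MulOpposite.op a ∈ J := ha
    rw [hJ, Ideal.mem_span_singleton'] at this
    obtain ⟨c, hc⟩ := this
    have h3 : a = f.unop * c.unop := by rw [← MulOpposite.unop_mul, hc]; rfl
    have h4 : f.unop * f.unop = f.unop := by rw [← MulOpposite.unop_mul, hf.eq]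
    rw [h3, sub_mul, one_mul, ← mul_assoc, h4, sub_self]
  have h1' : ∀ a : A, a * (1 - e) = counit (R := ℂ) a • (1 - e) := fun a => by
    have := h1 (a - algebraMap ℂ A (counit (R := ℂ) a)) (by simp)
    rwa [sub_mul, sub_eq_zero, ← Algebra.smul_def] at this
  have h2' : ∀ a : A, (1 - f.unop) * a = counit (R := ℂ) a • (1 - f.unop) := fun a => by
    have := h2 (a - algebraMap ℂ A (counit (R := ℂ) a)) (by simp)
    rwa [mul_sub, sub_eq_zero, ← Algebra.commutes, ← Algebra.smul_def] at this
  have h3 : 1 - f.unop = 1 - e := by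
    have a1 := h1' (1 - f.unop)
    have a2 := h2' (1 - e)
    simp [e0, f0] at a1 a2
    exact a2.symm.trans a1
  exact ⟨1 - e, h1', fun a => by rw [← h3]; exact h2' a, by simp [e0]⟩
end hopf
end HB
set_option linter.all false
namespace HB
open TensorProduct Coalgebra WithConv HopfAlgebra

/-- regular character -/
noncomputable def chr (B : Type*) [Ring B] [Algebra ℂ B] : B →ₗ[ℂ] ℂ :=
  LinearMap.trace ℂ B ∘ₗ (LinearMap.mul ℂ B)
theorem chr_apply {B : Type*} [Ring B] [Algebra ℂ B] (x : B) :
    chr B x = LinearMap.trace ℂ B (LinearMap.mulLeft ℂ x) := rfl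
theorem mulLeft_mul' {B : Type*} [Ring B] [Algebra ℂ B] (x y : B) :
    LinearMap.mulLeft ℂ (x * y) = LinearMap.mulLeft ℂ x * LinearMap.mulLeft ℂ y := by
  ext z; simp [mul_assoc]
theorem chr_comm {B : Type*} [Ring B] [Algebra ℂ B] (x y : B) : chr B (x * y) = chr B (y * x) := by
  rw [chr_apply, chr_apply, mulLeft_mul', mulLeft_mul', LinearMap.trace_mul_comm]
theorem chr_one {B : Type*} [Ring B] [Algebra ℂ B] [FiniteDimensional ℂ B] :
    chr B 1 = Module.finrank ℂ B := by
  rw [chr_apply, LinearMap.mulLeft_one, LinearMap.trace_id]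
theorem chr_tensor {B B' : Type*} [Ring B] [Algebra ℂ B] [FiniteDimensional ℂ B]
    [Ring B'] [Algebra ℂ B'] [FiniteDimensional ℂ B'] (z : B ⊗[ℂ] B') :
    chr (B ⊗[ℂ] B') z = LinearMap.mul' ℂ ℂ (TensorProduct.map (chr B) (chr B') z) := by
  induction z with
  | zero => simp
  | add x y hx hy => simp only [map_add, hx, hy]
  | tmul x y =>
    have : LinearMap.mulLeft ℂ (x ⊗ₜ[ℂ] y) = TensorProduct.map (LinearMap.mulLeft ℂ x) (LinearMap.mulLeft ℂ y) := by
      ext a b; simp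
    rw [chr_apply, this, LinearMap.trace_tensorProduct']; rfl

theorem Wd.central_scalar {B : Type*} [Ring B] [Algebra ℂ B] (w : Wd B) (z : B)
    (hz : ∀ c, z * c = c * z) (i) : ∃ α : ℂ, w.rp i z = α • 1 := by
  have : w.rp i z ∈ Subalgebra.center ℂ (Module.End ℂ (Fin (w.d i) → ℂ)) := by
    rw [Subalgebra.mem_center_iff]
    intro T
    obtain ⟨b, rfl⟩ := w.rp_surj i T
    rw [← map_mul, ← map_mul, hz]
  rw [Algebra.IsCentral.center_eq_bot] at this
  obtain ⟨α, h⟩ := Algebra.mem_bot.1 this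
  exact ⟨α, by rw [← h, Algebra.algebraMap_eq_smul_one]⟩

section act
variable {A : Type*} [Ring A] [HopfAlgebra ℂ A]
/-- f(a₁) a₂ -/
noncomputable def lf (f : Du A) : A →ₗ[ℂ] A :=
  (TensorProduct.lid ℂ A).toLinearMap ∘ₗ LinearMap.rTensor A (Du.lin f) ∘ₗ comul
/-- a₁ f(a₂) -/
noncomputable def rf (f : Du A) : A →ₗ[ℂ] A :=
  (TensorProduct.rid ℂ A).toLinearMap ∘ₗ LinearMap.lTensor A (Du.lin f) ∘ₗ comul
theorem lf_repr (f : Du A) {a : A} {ι : Type*} (r : Coalgebra.Repr ℂ a ι) :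
    lf f a = ∑ i ∈ r.index, f (r.left i) • r.right i := by simp [lf, ← r.eq]
theorem rf_repr (f : Du A) {a : A} {ι : Type*} (r : Coalgebra.Repr ℂ a ι) :
    rf f a = ∑ i ∈ r.index, f (r.right i) • r.left i := by simp [rf, ← r.eq]
theorem ev_lf (f g : Du A) (a : A) : g (lf f a) = (f * g) a := by
  rw [lf_repr f (ℛ ℂ a), Du.mul_repr _ _ (ℛ ℂ a)]; simp
theorem ev_rf (f g : Du A) (a : A) : g (rf f a) = (g * f) a := by
  rw [rf_repr f (ℛ ℂ a), Du.mul_repr _ _ (ℛ ℂ a)]; simp [mul_comm]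
theorem sepA {a b : A} (h : ∀ f : Du A, f a = f b) : a = b := by
  rw [← sub_eq_zero, ← Module.forall_dual_apply_eq_zero_iff ℂ (a - b)]
  intro f
  rw [map_sub, sub_eq_zero]; exact h (Du.of f)
variable [FiniteDimensional ℂ A]
theorem sepAA {x y : A ⊗[ℂ] A} (h : ∀ f g : Du A, LinearMap.mul' ℂ ℂ (TensorProduct.map (Du.lin f)
    (Du.lin g) x) = LinearMap.mul' ℂ ℂ (TensorProduct.map (Du.lin f) (Du.lin g) y)) : x = y := by
  have key : ∀ x : A ⊗[ℂ] A, ∑ i, ∑ j, (LinearMap.mul' ℂ ℂ (TensorProduct.map (Du.lin (cb A i))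
    (Du.lin (cb A j)) x)) • (bs A i ⊗ₜ[ℂ] bs A j) = x := fun x => by
    induction x with
    | zero => simp
    | add x y hx hy => simp only [map_add, add_smul, Finset.sum_add_distrib, hx, hy]
    | tmul f g =>
      conv_rhs => rw [← exA f, ← exA g, TensorProduct.sum_tmul]
      simp only [TensorProduct.tmul_sum, TensorProduct.smul_tmul_smul]; rfl
  rw [← key x, ← key y]; simp only [h]
theorem comul_rf (f : Du A) (a : A) : comul (R := ℂ) (rf f a) = LinearMap.lTensor A (rf f) (comul a) := by
  apply sepAA; intro g h
  have h1 : Du.lin h ∘ₗ rf f = Du.lin (h * f) := LinearMap.ext fun x => ev_rf f h x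
  have h2 : ∀ z : A ⊗[ℂ] A, TensorProduct.map (Du.lin g) (Du.lin h) (LinearMap.lTensor A (rf f) z) =
      TensorProduct.map (Du.lin g) (Du.lin (h * f)) z := fun z => by
    rw [LinearMap.lTensor, TensorProduct.map_map, h1, LinearMap.comp_id]
  rw [h2, ← Du.mul_apply, ← Du.mul_apply, ev_rf, mul_assoc]
theorem comul_lf (f : Du A) (a : A) : comul (R := ℂ) (lf f a) = LinearMap.rTensor A (lf f) (comul a) := by
  apply sepAA; intro g h
  have h1 : Du.lin g ∘ₗ lf f = Du.lin (f * g) := LinearMap.ext fun x => ev_lf f g x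
  have h2 : ∀ z : A ⊗[ℂ] A, TensorProduct.map (Du.lin g) (Du.lin h) (LinearMap.rTensor A (lf f) z) =
      TensorProduct.map (Du.lin (f * g)) (Du.lin h) z := fun z => by
    rw [LinearMap.rTensor, TensorProduct.map_map, h1, LinearMap.comp_id]
  rw [h2, ← Du.mul_apply, ← Du.mul_apply, ev_lf, mul_assoc]
theorem counit_lf (f : Du A) (a : A) : counit (R := ℂ) (lf f a) = f a := by
  have := ev_lf f 1 a; rwa [mul_one] at this
theorem counit_rf (f : Du A) (a : A) : counit (R := ℂ) (rf f a) = f a := by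
  have := ev_rf f 1 a; rwa [one_mul] at this
end act

section LR
variable {A : Type*} [Ring A] [HopfAlgebra ℂ A] {L : A} (hL : IsInt L)

theorem int_dl (hL : IsInt L) (a : A) : dl A a * dl A L = counit (R := ℂ) a • dl A L := by
  rw [← map_mul, hL.l, map_smul]
theorem int_dr (hL : IsInt L) (a : A) : dl A L * dl A a = counit (R := ℂ) a • dl A L := by
  rw [← map_mul, hL.r, map_smul]
theorem I1 (hL : IsInt L) (a : A) : i2 A A a * dl A L = i1 A A (antipode ℂ a) * dl A L := by
  have h : hc (dl A) * cst (dl A L) = cst (dl A L) := by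
    apply W.ext; intro x; rw [mul_cst, cst_apply]; exact int_dl hL x
  have h2 := congrArg (fun φ : W A (A ⊗[ℂ] A) => (φ * cst (dl A L) : W A (A ⊗[ℂ] A)) a) (K1 (A := A))
  simp only [mul_assoc, h] at h2
  rw [mul_cst, mul_cst] at h2
  exact h2.symm
theorem I2 (hL : IsInt L) (a : A) : dl A L * i1 A A a = dl A L * i2 A A (antipode ℂ a) := by
  have h : cst (dl A L) * hc (dl A) = cst (dl A L) := by
    apply W.ext; intro x; rw [cst_mul, cst_apply]; exact int_dr hL x
  have h2 := congrArg (fun φ : W A (A ⊗[ℂ] A) => (cst (dl A L) * φ : W A (A ⊗[ℂ] A)) a) (K2 (A := A))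
  simp only [← mul_assoc, h] at h2
  rw [cst_mul, cst_mul] at h2
  exact h2.symm

theorem lf_of (f : Du A) (a : A) : lf f a = TensorProduct.lid ℂ A (LinearMap.rTensor A (Du.lin f) (dl A a)) := rfl
theorem rf_of (f : Du A) (a : A) : rf f a = TensorProduct.rid ℂ A (LinearMap.lTensor A (Du.lin f) (dl A a)) := rfl
theorem tind {M N : Type*} [AddCommGroup M] [Module ℂ M] {f g : A ⊗[ℂ] A →ₗ[ℂ] M}
    (h : ∀ x y, f (x ⊗ₜ y) = g (x ⊗ₜ y)) (z) : f z = g z :=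
  LinearMap.congr_fun (TensorProduct.ext' h) z

variable [FiniteDimensional ℂ A]
theorem I1l (hL : IsInt L) (a : A) (f : Du A) : a * lf f L = lf (lmul (antipode ℂ a) f) L := by
  have h1 : ∀ z : A ⊗[ℂ] A, TensorProduct.lid ℂ A (LinearMap.rTensor A (Du.lin f) (i2 A A a * z)) =
      a * TensorProduct.lid ℂ A (LinearMap.rTensor A (Du.lin f) z) := fun z => by
    induction z with
    | zero => simp
    | add x y hx hy => simp only [map_add, mul_add, hx, hy]
    | tmul x y => simp
  have h2 : ∀ (b : A) (z : A ⊗[ℂ] A), TensorProduct.lid ℂ A (LinearMap.rTensor A (Du.lin f) (i1 A A b * z)) =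
      TensorProduct.lid ℂ A (LinearMap.rTensor A (Du.lin (lmul b f)) z) := fun b z => by
    induction z with
    | zero => simp
    | add x y hx hy => simp only [map_add, mul_add, hx, hy]
    | tmul x y => simp
  rw [lf_of, ← h1, I1 hL, h2]; rfl
theorem I1r (hL : IsInt L) (a : A) (f : Du A) : rf (lmul a f) L = antipode ℂ a * rf f L := by
  have h1 : ∀ z : A ⊗[ℂ] A, TensorProduct.rid ℂ A (LinearMap.lTensor A (Du.lin f) (i2 A A a * z)) =
      TensorProduct.rid ℂ A (LinearMap.lTensor A (Du.lin (lmul a f)) z) := fun z => by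
    induction z with
    | zero => simp
    | add x y hx hy => simp only [map_add, mul_add, hx, hy]
    | tmul x y => simp
  have h2 : ∀ (b : A) (z : A ⊗[ℂ] A), TensorProduct.rid ℂ A (LinearMap.lTensor A (Du.lin f) (i1 A A b * z)) =
      b * TensorProduct.rid ℂ A (LinearMap.lTensor A (Du.lin f) z) := fun b z => by
    induction z with
    | zero => simp
    | add x y hx hy => simp only [map_add, mul_add, hx, hy]
    | tmul x y => simp
  rw [rf_of, rf_of, ← h1, I1 hL, h2]
theorem I2l (hL : IsInt L) (a : A) (f : Du A) : lf (rmul a f) L = lf f L * antipode ℂ a := by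
  have h1 : ∀ z : A ⊗[ℂ] A, TensorProduct.lid ℂ A (LinearMap.rTensor A (Du.lin f) (z * i1 A A a)) =
      TensorProduct.lid ℂ A (LinearMap.rTensor A (Du.lin (rmul a f)) z) := fun z => by
    induction z with
    | zero => simp
    | add x y hx hy => simp only [map_add, add_mul, hx, hy]
    | tmul x y => simp
  have h2 : ∀ (b : A) (z : A ⊗[ℂ] A), TensorProduct.lid ℂ A (LinearMap.rTensor A (Du.lin f) (z * i2 A A b)) =
      TensorProduct.lid ℂ A (LinearMap.rTensor A (Du.lin f) z) * b := fun b z => by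
    induction z with
    | zero => simp
    | add x y hx hy => simp only [map_add, add_mul, hx, hy]
    | tmul x y => simp
  rw [lf_of, lf_of, ← h1, I2 hL, h2]
theorem I2r (hL : IsInt L) (a : A) (f : Du A) : rf f L * a = rf (rmul (antipode ℂ a) f) L := by
  have h1 : ∀ z : A ⊗[ℂ] A, TensorProduct.rid ℂ A (LinearMap.lTensor A (Du.lin f) (z * i1 A A a)) =
      TensorProduct.rid ℂ A (LinearMap.lTensor A (Du.lin f) z) * a := fun z => by
    induction z with
    | zero => simp
    | add x y hx hy => simp only [map_add, add_mul, hx, hy]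
    | tmul x y => simp
  have h2 : ∀ (b : A) (z : A ⊗[ℂ] A), TensorProduct.rid ℂ A (LinearMap.lTensor A (Du.lin f) (z * i2 A A b)) =
      TensorProduct.rid ℂ A (LinearMap.lTensor A (Du.lin (rmul b f)) z) := fun b z => by
    induction z with
    | zero => simp
    | add x y hx hy => simp only [map_add, add_mul, hx, hy]
    | tmul x y => simp
  rw [rf_of, rf_of, ← h1, I2 hL, h2]

theorem F_zero1 (hL : IsInt L) (f : Du A) (h : lf f L = 0) : f 1 = 0 := by
  -- trace contraction
  have h1 : ∀ a, lf (rmul a f) L = 0 := fun a => by rw [I2l hL, h, zero_mul]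
  have h2 : ∑ i ∈ (ℛ ℂ L).index, ((Du.lin f ∘ₗ LinearMap.mulLeft ℂ ((ℛ ℂ L).left i) ∘ₗ antipode ℂ).smulRight
      ((ℛ ℂ L).right i)) = 0 := by
    ext a
    have := h1 (antipode ℂ a)
    rw [lf_repr _ (ℛ ℂ L)] at this
    simpa using this
  have h3 := congrArg (LinearMap.trace ℂ A) h2
  simp only [map_sum, trace_rank1, map_zero] at h3
  have h4 := sum_mul_antipode_eq_algebraMap_counit (R := ℂ) (ℛ ℂ L)
  have h5 := congrArg f h4
  rw [map_sum] at h5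
  have h6 : f (algebraMap ℂ A (counit L)) = 0 := by rw [← h5]; exact h3
  rwa [hL.e, map_one] at h6
theorem F_inj (hL : IsInt L) {f g : Du A} (h : lf f L = lf g L) : f = g := by
  ext a
  have h1 : lf (rmul a (f - g)) L = 0 := by
    rw [I2l hL]
    have : lf (f - g) L = lf f L - lf g L := by simp [lf, LinearMap.rTensor_sub]
    rw [this, h, sub_self, zero_mul]
  have := F_zero1 hL _ h1
  simpa [sub_eq_zero] using this
theorem G_zero1 (hL : IsInt L) (f : Du A) (h : rf f L = 0) : f 1 = 0 := by
  have h1 : ∀ a, rf (lmul a f) L = 0 := fun a => by rw [I1r hL, h, mul_zero]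
  have h2 : ∑ i ∈ (ℛ ℂ L).index, ((Du.lin f ∘ₗ LinearMap.mulRight ℂ ((ℛ ℂ L).right i) ∘ₗ antipode ℂ).smulRight
      ((ℛ ℂ L).left i)) = 0 := by
    ext a
    have := h1 (antipode ℂ a)
    rw [rf_repr _ (ℛ ℂ L)] at this
    simpa using this
  have h3 := congrArg (LinearMap.trace ℂ A) h2
  simp only [map_sum, trace_rank1, map_zero] at h3
  have h4 := sum_antipode_mul_eq_algebraMap_counit (R := ℂ) (ℛ ℂ L)
  have h5 := congrArg f h4
  rw [map_sum] at h5
  have h6 : f (algebraMap ℂ A (counit L)) = 0 := by rw [← h5]; exact h3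
  rwa [hL.e, map_one] at h6
theorem G_inj (hL : IsInt L) {f g : Du A} (h : rf f L = rf g L) : f = g := by
  ext a
  have h1 : rf (lmul a (f - g)) L = 0 := by
    rw [I1r hL]
    have : rf (f - g) L = rf f L - rf g L := by simp [rf, LinearMap.lTensor_sub]
    rw [this, h, sub_self, mul_zero]
  have := G_zero1 hL _ h1
  simpa [sub_eq_zero] using this
/-- lf as a linear map in f -/
noncomputable def lfL (a : A) : Du A →ₗ[ℂ] A where
  toFun f := lf f a
  map_add' f g := by simp [lf, LinearMap.rTensor_add]
  map_smul' c f := by simp [lf, LinearMap.rTensor_smul]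
noncomputable def rfL (a : A) : Du A →ₗ[ℂ] A where
  toFun f := rf f a
  map_add' f g := by simp [rf, LinearMap.lTensor_add]
  map_smul' c f := by simp [rf, LinearMap.lTensor_smul]
theorem F_surj (hL : IsInt L) (a : A) : ∃ f : Du A, lf f L = a :=
  (LinearMap.injective_iff_surjective_of_finrank_eq_finrank (f := lfL L) finrank_Du).1
    (fun _ _ h => F_inj hL h) a
theorem G_surj (hL : IsInt L) (a : A) : ∃ f : Du A, rf f L = a :=
  (LinearMap.injective_iff_surjective_of_finrank_eq_finrank (f := rfL L) finrank_Du).1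
    (fun _ _ h => G_inj hL h) a

theorem S_inj (hL : IsInt L) {a : A} (h : antipode ℂ a = 0) : a = 0 := by
  obtain ⟨f, hf⟩ := F_surj hL 1
  rw [← mul_one a, ← hf, I1l hL, h]
  have : lmul (0 : A) f = 0 := by ext; simp
  rw [this]; simp [lf]

variable {l0 : Du A} 
theorem nak (hL : IsInt L) (h0 : lf l0 L = 1) (c x : A) : l0 (antipode ℂ (antipode ℂ c) * x) = l0 (x * c) := by
  have : lmul (antipode ℂ (antipode ℂ c)) l0 = rmul c l0 := by
    apply F_inj hL; rw [← I1l hL, I2l hL, h0, mul_one, one_mul]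
  exact DFunLike.congr_fun this x
theorem nd (hL : IsInt L) (h0 : lf l0 L = 1) (a : A) (h : ∀ x, l0 (x * a) = 0) : a = 0 := by
  apply S_inj hL
  have : rmul a l0 = 0 := by ext x; simpa using h x
  rw [← one_mul (antipode ℂ a), ← h0, ← I2l hL, this]; simp [lf]
theorem tr_formula (hL : IsInt L) (h0 : lf l0 L = 1) (T : A →ₗ[ℂ] A) : LinearMap.trace ℂ A T =
    ∑ i ∈ (ℛ ℂ L).index, l0 (antipode ℂ (T ((ℛ ℂ L).right i)) * (ℛ ℂ L).left i) := by
  have h2 : T = ∑ i ∈ (ℛ ℂ L).index, ((Du.lin l0 ∘ₗ LinearMap.mulRight ℂ ((ℛ ℂ L).left i) ∘ₗ antipode ℂ).smulRight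
      (T ((ℛ ℂ L).right i))) := by
    ext b
    have := I1l hL b l0
    rw [h0, mul_one, lf_repr _ (ℛ ℂ L)] at this
    conv_lhs => rw [this]
    simp
  conv_lhs => rw [h2]
  simp only [map_sum, trace_rank1]; rfl
theorem tr_S2rf (hL : IsInt L) (h0 : lf l0 L = 1) (f : Du A) :
    LinearMap.trace ℂ A ((antipode ℂ ∘ₗ antipode ℂ) ∘ₗ rf f) = l0 1 * f L := by
  rw [tr_formula hL h0]
  simp only [LinearMap.comp_apply, nak hL h0]
  have h1 := mul_antipode_lTensor_comul_apply (R := ℂ) (rf f L)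
  rw [comul_rf, counit_rf, ← (ℛ ℂ L).eq] at h1
  have h2 := congrArg l0 h1
  simp only [map_sum, LinearMap.lTensor_tmul, LinearMap.mul'_apply] at h2
  rw [h2, Algebra.algebraMap_eq_smul_one, map_smul, smul_eq_mul, mul_comm]
theorem rf_one : rf (1 : Du A) = LinearMap.id := by
  ext a; apply sepA; intro f; rw [ev_rf, mul_one]; rfl
theorem lf_one : lf (1 : Du A) = LinearMap.id := by
  ext a; apply sepA; intro f; rw [ev_lf, one_mul]; rfl
theorem tr_S2 (hL : IsInt L) (h0 : lf l0 L = 1) :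
    LinearMap.trace ℂ A (antipode ℂ ∘ₗ antipode ℂ) = l0 1 := by
  have := tr_S2rf hL h0 1
  rwa [rf_one, LinearMap.comp_id, Du.one_apply, hL.e, mul_one] at this
end LR
end HB
set_option linter.all false
namespace HB
open TensorProduct Coalgebra WithConv HopfAlgebra

section LR2
variable {A : Type*} [Ring A] [HopfAlgebra ℂ A] [FiniteDimensional ℂ A] {L : A} {l0 : Du A}

theorem lf_lf (f h : Du A) (a : A) : lf h (lf f a) = lf (f * h) a := by
  apply sepA; intro k; rw [ev_lf, ev_lf, ev_lf, mul_assoc]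
theorem rf_rf (f h : Du A) (a : A) : rf h (rf f a) = rf (h * f) a := by
  apply sepA; intro k; rw [ev_rf, ev_rf, ev_rf, mul_assoc]
theorem lf_at_one (f : Du A) : lf f 1 = f 1 • (1 : A) := by
  simp [lf, Algebra.TensorProduct.one_def]
theorem lf_smul (c : ℂ) (f : Du A) (a : A) : lf (c • f) a = c • lf f a := (lfL a).map_smul c f
theorem E1 (hL : IsInt L) (h0 : lf l0 L = 1) (f : Du A) : l0 * f = f 1 • l0 := by
  apply F_inj hL; rw [← lf_lf, h0, lf_at_one, lf_smul, h0]
theorem E2 (h0 : lf l0 L = 1) : l0 L = 1 := by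
  rw [← counit_lf, h0, Bialgebra.counit_one]
theorem E3 (hL : IsInt L) (h0 : lf l0 L = 1) (f : Du A) : f * l0 = f (rf l0 L) • l0 := by
  apply F_inj hL
  rw [lf_smul, h0, ev_rf]
  apply sepA; intro h
  rw [ev_lf, mul_assoc, E1 hL h0, mul_smul_comm, map_smul, Du.smul_apply, smul_eq_mul, mul_comm]
theorem rf_l0 (hL : IsInt L) (h0 : lf l0 L = 1) (x : A) : rf l0 x = l0 x • rf l0 L := by
  apply sepA; intro f
  rw [ev_rf, E3 hL h0, map_smul, Du.smul_apply, smul_eq_mul, mul_comm]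
theorem g_mul (hL : IsInt L) (h0 : lf l0 L = 1) (f h : Du A) :
    (f * h) (rf l0 L) = f (rf l0 L) * h (rf l0 L) := by
  have h1 : (f * h) * l0 = f * (h * l0) := mul_assoc _ _ _
  rw [E3 hL h0, E3 hL h0 h, mul_smul_comm, E3 hL h0 f] at h1
  have h2 := DFunLike.congr_fun h1 L
  simpa [E2 h0, mul_comm] using h2
theorem g_gl (hL : IsInt L) (h0 : lf l0 L = 1) : IsGroupLikeElem ℂ (rf l0 L) := by
  refine ⟨by rw [counit_rf, E2 h0], ?_⟩
  apply sepAA; intro f h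
  rw [← Du.mul_apply, g_mul hL h0]; simp
theorem rf_gl {g : A} (hg : IsGroupLikeElem ℂ g) (f : Du A) (x : A) : rf (rmul g f) x * g = rf f (x * g) := by
  rw [rf_of f, map_mul]
  have : dl A g = g ⊗ₜ g := hg.comul_eq_tmul_self
  rw [this, rf_of]
  induction dl A x with
  | zero => simp
  | add x y hx hy => simp only [map_add, add_mul, hx, hy]
  | tmul x y => simp
theorem gl_inv {g : A} (hg : IsGroupLikeElem ℂ g) : g * antipode ℂ g = 1 := by
  have h := mul_antipode_lTensor_comul_apply (R := ℂ) g
  rw [hg.comul_eq_tmul_self, hg.counit_eq_one] at h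
  simpa using h
theorem S4 (hL : IsInt L) (h0 : lf l0 L = 1) (c : A) :
    antipode ℂ (antipode ℂ (antipode ℂ (antipode ℂ c))) * rf l0 L = rf l0 L * c := by
  set g := rf l0 L with hgd
  have hg : IsGroupLikeElem ℂ g := g_gl hL h0
  have h1 : rf (rmul g l0) L = 1 := by
    have h2 := rf_gl hg l0 L
    rw [hL.r, hg.counit_eq_one, one_smul, ← hgd] at h2
    calc _ = (rf (rmul g l0) L * g) * antipode ℂ g := by rw [mul_assoc, gl_inv hg, mul_one]
      _ = 1 := by rw [h2, gl_inv hg]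
  have h3 : ∀ a x, l0 (a * x * g) = l0 (x * antipode ℂ (antipode ℂ a) * g) := fun a x => by
    have : lmul a (rmul g l0) = rmul (antipode ℂ (antipode ℂ a)) (rmul g l0) := by
      apply G_inj hL; rw [I1r hL, ← I2r hL, h1, one_mul, mul_one]
    exact DFunLike.congr_fun this x
  rw [← sub_eq_zero]
  apply nd hL h0
  intro x
  have h4 := h3 (antipode ℂ (antipode ℂ c)) x
  rw [mul_assoc, nak hL h0] at h4
  rw [mul_sub, map_sub, ← mul_assoc, ← mul_assoc, ← h4, mul_assoc, sub_self]

theorem gl_fin {g : A} (hg : IsGroupLikeElem ℂ g) : ∃ m, 0 < m ∧ g ^ m = 1 := by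
  have hf : Set.Finite {a : A | IsGroupLikeElem ℂ a} := by
    have := (linearIndepOn_isGroupLikeElem (R := ℂ) (A := A))
    exact this.setFinite
  have hfin : Finite (GroupLike ℂ A) := by
    have : Finite {a : A | IsGroupLikeElem ℂ a} := hf
    exact Finite.of_injective (fun x : GroupLike ℂ A => (⟨x.1, x.2⟩ : {a : A | IsGroupLikeElem ℂ a}))
      (fun x y h => by cases x; cases y; simpa using h)
  let G : GroupLike ℂ A := ⟨g, hg⟩
  refine ⟨orderOf G, orderOf_pos G, ?_⟩
  have := congrArg (fun x : GroupLike ℂ A => (x : A)) (pow_orderOf_eq_one G)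
  simp only [GroupLike.val_pow, GroupLike.val_one] at this
  exact this
theorem S_fin (hL : IsInt L) (h0 : lf l0 L = 1) : ∃ m, 0 < m ∧ (antipode ℂ * antipode ℂ : Module.End ℂ A) ^ m = 1 := by
  obtain ⟨m, hm, h⟩ := gl_fin (g_gl hL h0)
  refine ⟨2 * m, by omega, ?_⟩
  set g := rf l0 L
  have hg : IsGroupLikeElem ℂ g := g_gl hL h0
  set T : Module.End ℂ A := antipode ℂ * antipode ℂ with hT
  have h1 : ∀ k c, ((T ^ 2) ^ k) c * g ^ k = g ^ k * c := by
    intro k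
    induction k with
    | zero => simp
    | succ k ih =>
      intro c
      rw [pow_succ' (T ^ 2), Module.End.mul_apply, pow_succ' g, ← mul_assoc]
      have : (T ^ 2) (((T ^ 2) ^ k) c) * g = g * ((T ^ 2) ^ k) c := S4 hL h0 _
      rw [this, mul_assoc, ih, ← mul_assoc]
  rw [pow_mul]
  ext c
  have := h1 m c
  rwa [h, mul_one, one_mul] at this

/-- character of the regular representation, in the dual -/
noncomputable def xi (A : Type*) [Ring A] [HopfAlgebra ℂ A] : Du A := Du.of (chr A)
theorem xi_apply (a : A) : xi A a = chr A a := rfl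

theorem inner [IsSemisimpleRing A] (hL : IsInt L) (h0 : lf l0 L = 1) : ∃ u v : A, v * u = 1 ∧ u * v = 1 ∧
    ∀ c, antipode ℂ (antipode ℂ c) = v * c * u := by
  obtain ⟨w⟩ := wd_exists A
  have nd1 : ∀ x : A, (∀ y, chr A (x * y) = 0) → x = 0 := fun x h => w.nondeg x h
  let Φ : A →ₗ[ℂ] Du A :=
    { toFun := fun u => lmul u (xi A)
      map_add' := fun x y => by ext; simp [add_mul]
      map_smul' := fun c x => by ext; simp }
  have hi : Function.Injective Φ := by
    rw [← LinearMap.ker_eq_bot, LinearMap.ker_eq_bot']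
    intro x hx
    exact nd1 x fun y => DFunLike.congr_fun hx y
  have hs : Function.Surjective Φ :=
    (LinearMap.injective_iff_surjective_of_finrank_eq_finrank (f := Φ) finrank_Du.symm).1 hi
  obtain ⟨u, hu⟩ := hs l0
  have hu' : ∀ x, l0 x = chr A (u * x) := fun x => by rw [← hu]; rfl
  have hinj : Function.Injective (LinearMap.mulRight ℂ u) := by
    rw [← LinearMap.ker_eq_bot, LinearMap.ker_eq_bot']
    intro a ha
    apply nd hL h0
    intro x
    rw [hu', ← mul_assoc, chr_comm, ← mul_assoc]
    have : a * u = 0 := ha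
    rw [this, zero_mul, map_zero]
  obtain ⟨v, hv⟩ := (LinearMap.injective_iff_surjective.1 hinj) 1
  have hv : v * u = 1 := hv
  have hv2 : u * v = 1 := by
    have : (u * v - 1) * u = 0 := by rw [sub_mul, mul_assoc, hv]; simp
    have h2 : LinearMap.mulRight ℂ u (u * v - 1) = LinearMap.mulRight ℂ u 0 := by simpa using this
    exact sub_eq_zero.1 (hinj h2)
  refine ⟨u, v, hv, hv2, fun c => ?_⟩
  have h3 : u * antipode ℂ (antipode ℂ c) = c * u := by
    rw [← sub_eq_zero]
    apply nd1
    intro x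
    rw [sub_mul, map_sub, mul_assoc, ← hu', nak hL h0, hu', ← mul_assoc, chr_comm (u * x), mul_assoc, sub_self]
  rw [mul_assoc, ← h3, ← mul_assoc, hv, one_mul]

theorem chS2 {u v : A} (huv : v * u = 1) (hvu : u * v = 1)
    (hS : ∀ c, antipode ℂ (antipode ℂ c) = v * c * u) (c : A) :
    chr A (antipode ℂ (antipode ℂ c)) = chr A c := by
  rw [hS, chr_comm, ← mul_assoc, hvu, one_mul]

theorem trS2_ne [IsSemisimpleRing A] (hL : IsInt L) (h0 : lf l0 L = 1) : l0 1 ≠ 0 := by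
  obtain ⟨u, v, huv, hvu, hS⟩ := inner hL h0
  obtain ⟨m, hm, hT⟩ := S_fin hL h0
  obtain ⟨w⟩ := wd_exists A
  rw [← tr_S2 hL h0]
  have e1 : (antipode ℂ ∘ₗ antipode ℂ : A →ₗ[ℂ] A) = LinearMap.mulLeft ℂ v ∘ₗ LinearMap.mulRight ℂ u := by
    ext c; simp [hS, mul_assoc]
  rw [e1, w.trace_lr]
  have h1 : ∀ k c, ((antipode ℂ * antipode ℂ : Module.End ℂ A) ^ k) c = v ^ k * c * u ^ k := by
    intro k
    induction k with
    | zero => simp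
    | succ k ih =>
      intro c
      rw [pow_succ', Module.End.mul_apply, ih, Module.End.mul_apply, hS, pow_succ' v, pow_succ u]
      simp only [mul_assoc]
  have huvm : u ^ m * v ^ m = 1 := by
    rw [← (show Commute u v from by rw [Commute, SemiconjBy, huv, hvu]).mul_pow, hvu, one_pow]
  have hz : ∀ c, u ^ m * c = c * u ^ m := fun c => by
    have h2 := h1 m c
    rw [hT, Module.End.one_apply] at h2
    conv_lhs => rw [h2]
    rw [← mul_assoc, ← mul_assoc, huvm, one_mul]
  have key : ∀ i, w.ch i v * w.ch i u = (Complex.normSq (w.ch i u) / Complex.normSq (w.ch i u) *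
      Complex.normSq (w.ch i v * w.ch i u) / Complex.normSq (1) : ℝ) ∨ True := fun i => Or.inr trivial
  have key : ∀ i, ∃ t : ℝ, 0 ≤ t ∧ w.ch i v * w.ch i u = t ∧ (w.ch i u ≠ 0 → t ≠ 0) := fun i => by
    obtain ⟨α, hα⟩ := w.central_scalar (u ^ m) hz i
    by_cases hd : w.d i = 0
    · exact absurd (w.hd i) (by simp [hd])
    have hα0 : α ≠ 0 := by
      rintro rfl
      have h4 := congrArg (w.rp i) huvm
      rw [map_mul, hα, zero_smul, zero_mul, map_one] at h4
      have : Nonempty (Fin (w.d i)) := ⟨⟨0, Nat.pos_of_ne_zero hd⟩⟩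
      exact zero_ne_one h4
    obtain ⟨β, hβ⟩ := IsAlgClosed.exists_pow_nat_eq α hm
    have hβ0 : β ≠ 0 := by rintro rfl; rw [zero_pow hm.ne'] at hβ; exact hα0 hβ.symm
    have h5 := trace_inv_conj (β⁻¹ • w.rp i u) (β • w.rp i v) m hm
      (by rw [smul_pow, ← map_pow, hα, smul_smul, inv_pow, hβ, inv_mul_cancel₀ hα0, one_smul])
      (by rw [smul_mul_smul_comm, mul_inv_cancel₀ hβ0, ← map_mul, huv, map_one, one_smul])
    rw [map_smul, map_smul, ← w.ch_rp, ← w.ch_rp] at h5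
    refine ⟨Complex.normSq (β⁻¹ • w.ch i u), Complex.normSq_nonneg _, ?_, ?_⟩
    · rw [Complex.normSq_eq_conj_mul_self, ← h5]; simp only [smul_eq_mul]; field_simp
    · intro h; simpa [hβ0] using h
  choose t ht0 ht htn using key
  simp only [ht]
  intro hsum
  have hsum' : ∑ i, t i = 0 := by exact_mod_cast hsum
  rw [Finset.sum_eq_zero_iff_of_nonneg (fun i _ => ht0 i)] at hsum'
  have hz : ∀ i, w.ch i u = 0 := fun i => by
    by_contra h; exact htn i h (hsum' i (Finset.mem_univ i))
  have h6 := w.trace_exp (Bialgebra.counitAlgHom ℂ A).toLinearMap (fun x y => by simp [mul_comm]) u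
  simp [hz] at h6
  have h7 := congrArg (counit (R := ℂ)) huv
  simp [h6] at h7

theorem tw1_surj : Function.Surjective (twm (dl A) (i2 A A)) := by
  have h0 : ∀ z b, twm (dl A) (i2 A A) z * i2 A A b = twm (dl A) (i2 A A) (z * 1 ⊗ₜ b) := fun z b => by
    induction z with
    | zero => simp
    | add x y hx hy => simp only [map_add, add_mul, hx, hy]
    | tmul x y => rw [Algebra.TensorProduct.tmul_mul_tmul, twm_tmul, twm_tmul, mul_one, map_mul (i2 A A), mul_assoc]
  intro y
  induction y with
  | zero => exact ⟨0, map_zero _⟩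
  | add x y hx hy =>
    obtain ⟨x', rfl⟩ := hx; obtain ⟨y', rfl⟩ := hy
    exact ⟨x' + y', map_add _ _ _⟩
  | tmul a b =>
    have h1 : ∃ z, twm (dl A) (i2 A A) z = i1 A A a := by
      have h2 := congrArg (fun φ : W A (A ⊗[ℂ] A) => φ a) (K2 (A := A))
      simp only [(ℛ ℂ a).convMul_apply] at h2
      refine ⟨∑ i ∈ (ℛ ℂ a).index, (ℛ ℂ a).left i ⊗ₜ antipode ℂ ((ℛ ℂ a).right i), ?_⟩
      rw [map_sum]; exact h2
    obtain ⟨z, hz⟩ := h1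
    refine ⟨z * 1 ⊗ₜ b, ?_⟩
    rw [← h0, hz]; simp
theorem xi_xi : xi A * xi A = (Module.finrank ℂ A : ℂ) • xi A := by
  ext a
  have h := tw_trace (dl A) (i2 A A) (tw_bij _ _ tw1_surj (Module.finrank_tensorProduct ..)) a
  rw [← chr_apply, ← chr_apply, chr_tensor] at h
  rw [Du.mul_apply, Du.smul_apply, mul_comm]
  exact h
theorem xi_L (hL : IsInt L) : xi A L = 1 := by
  have : LinearMap.mulLeft ℂ L = (counit (R := ℂ) (A := A)).smulRight L := by
    ext a; simp [hL.r]
  rw [xi_apply, chr_apply, this, trace_rank1, hL.e]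
theorem finrank_ne (hL : IsInt L) : (Module.finrank ℂ A : ℂ) ≠ 0 := by
  have : Nontrivial A := ⟨L, 0, by rintro rfl; simpa using hL.e⟩
  exact_mod_cast (Module.finrank_pos (R := ℂ) (M := A)).ne'

theorem sdu_mul (f g : Du A) : sdu (f * g) = sdu g * sdu f := by
  rw [← du_antipode, ← du_antipode, ← du_antipode, antipode_mul_antidistrib]

theorem S_sq_aux [IsSemisimpleRing A] (hL : IsInt L) (h0 : lf l0 L = 1) :
    (antipode ℂ * antipode ℂ : Module.End ℂ A) = 1 ∧ l0 1 = Module.finrank ℂ A := by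
  obtain ⟨u, v, huv, hvu, hS⟩ := inner hL h0
  obtain ⟨m, hm, hT⟩ := S_fin hL h0
  have hN := finrank_ne hL
  set T : Module.End ℂ A := antipode ℂ * antipode ℂ with hTd
  set e : Du A := (Module.finrank ℂ A : ℂ)⁻¹ • xi A with he
  have ee : e * e = e := by
    rw [he, smul_mul_smul_comm, xi_xi, smul_smul, mul_assoc, inv_mul_cancel₀ hN, mul_one]
  have eS : sdu (sdu e) = e := by
    ext a
    simp only [sdu_apply, he, Du.smul_apply, xi_apply]
    rw [chS2 huv hvu hS]
  have hQ : (rf e : Module.End ℂ A) * rf e = rf e := by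
    ext a; rw [Module.End.mul_apply, rf_rf, ee]
  have hc : T * rf e = (rf e : Module.End ℂ A) * T := by
    ext a
    apply sepA; intro f
    have h1 : f (T (rf e a)) = sdu (sdu f) (rf e a) := rfl
    have h2 : f (rf e (T a)) = sdu (sdu (f * e)) a := by rw [ev_rf]; rfl
    show f (T (rf e a)) = f (rf e (T a))
    rw [h1, h2, sdu_mul, sdu_mul, eS, ev_rf]
  have hint := trace_fin_integral T (rf e) hQ hc m hm hT
  have hval : LinearMap.trace ℂ A (T * rf e) = l0 1 * (Module.finrank ℂ A : ℂ)⁻¹ := by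
    have h3 := tr_S2rf hL h0 e
    rw [he, Du.smul_apply, xi_L hL, mul_one] at h3
    exact h3
  rw [hval] at hint
  have h4 := avg T 1 (one_mul 1) (by simp) m hm hT _ hint
    (mul_ne_zero (trS2_ne hL h0) (inv_ne_zero hN)) (by
      have h5 : LinearMap.trace ℂ A T = l0 1 := tr_S2 hL h0
      rw [mul_one, h5, LinearMap.trace_one]; field_simp)
  rw [mul_one] at h4
  have h5 := LinearMap.congr_fun h4 1
  have h6 : T 1 = 1 := by simp [hTd]
  rw [h6] at h5
  have h7 := congrArg (counit (R := ℂ)) h5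
  simp at h7
  rw [← div_eq_mul_inv, eq_comm, div_eq_one_iff_eq hN] at h7
  refine ⟨?_, h7⟩
  rw [h4, h7, mul_inv_cancel₀ hN, one_smul]
end LR2

section LRmain
variable {A : Type*} [Ring A] [HopfAlgebra ℂ A] [FiniteDimensional ℂ A] [IsSemisimpleRing A] 

variable (A) in
/-- the integral -/
noncomputable def Lm : A := (exists_int A).choose
theorem Lm_int : IsInt (Lm A) := (exists_int A).choose_spec

theorem SS (a : A) : antipode ℂ (antipode ℂ a) = a := by
  obtain ⟨l0, h0⟩ := F_surj (Lm_int (A := A)) 1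
  exact LinearMap.congr_fun (S_sq_aux Lm_int h0).1 a
theorem sdu_sdu (f : Du A) : sdu (sdu f) = f := by ext a; simp [SS]

theorem lf_xi : lf (xi A) (Lm A) = 1 := by
  obtain ⟨l0, h0⟩ := F_surj (Lm_int (A := A)) 1
  have hL := Lm_int (A := A)
  have hN := finrank_ne hL
  have htr : ∀ x y, l0 (x * y) = l0 (y * x) := fun x y => by
    have := nak hL h0 x y; rwa [SS] at this
  have h1 : xi A = sdu l0 := by
    ext a
    rw [xi_apply, chr_apply, tr_formula hL h0, sdu_apply]
    simp only [LinearMap.mulLeft_apply, antipode_mul_antidistrib]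
    have : ∀ i, l0 (antipode ℂ ((ℛ ℂ (Lm A)).right i) * antipode ℂ a * (ℛ ℂ (Lm A)).left i) =
      lmul (antipode ℂ a) l0 ((ℛ ℂ (Lm A)).left i * antipode ℂ ((ℛ ℂ (Lm A)).right i)) := fun i => by
      rw [mul_assoc, htr, lmul_apply, mul_assoc]
    simp only [this]
    rw [← map_sum, sum_mul_antipode_eq_algebraMap_counit, hL.e, map_one, lmul_apply, mul_one]
  have h2 : ∀ f, f * xi A = f 1 • xi A := fun f => by
    rw [h1, ← sdu_sdu f, ← sdu_mul, E1 hL h0]; ext a; simp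
  have h3 : l0 = xi A := by
    have h4 := h2 l0
    rw [E1 hL h0, (S_sq_aux hL h0).2, xi_apply, chr_one] at h4
    have := congrArg (fun z => (Module.finrank ℂ A : ℂ)⁻¹ • z) h4
    simpa [smul_smul, inv_mul_cancel₀ hN] using this
  rw [← h3, h0]
theorem xi_mul (f : Du A) : xi A * f = f 1 • xi A := E1 Lm_int lf_xi f
theorem xi_one : xi A 1 = Module.finrank ℂ A := chr_one
theorem S_Lm : antipode ℂ (Lm A) = Lm A := by
  have hL := Lm_int (A := A)
  have h1 : antipode ℂ (Lm A) * Lm A = Lm A := by rw [hL.l, counit_antipode, hL.e, one_smul]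
  have h2 := congrArg (antipode ℂ) h1
  rw [antipode_mul_antidistrib, SS, h1] at h2
  exact h2.symm
theorem sdu_xi : sdu (xi A) = xi A := by
  have h1 : ∀ f : Du A, f * sdu (xi A) = f 1 • sdu (xi A) := fun f => by
    rw [← sdu_sdu f, ← sdu_mul, xi_mul]; ext a; simp
  have h2 := h1 (xi A)
  rw [xi_mul] at h2
  simp only [sdu_apply, antipode_one, xi_one] at h2
  have hN := finrank_ne (Lm_int (A := A))
  have := congrArg (fun z => (Module.finrank ℂ A : ℂ)⁻¹ • z) h2
  simpa [smul_smul, inv_mul_cancel₀ hN] using this.symm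
theorem mul_xi (f : Du A) : f * xi A = f 1 • xi A := by
  rw [← sdu_sdu f, ← sdu_xi, ← sdu_mul, xi_mul]; ext a; simp
theorem tr_rf (f : Du A) : LinearMap.trace ℂ A (rf f) = Module.finrank ℂ A * f (Lm A) := by
  have h := tr_S2rf Lm_int lf_xi f
  have h2 : (antipode ℂ ∘ₗ antipode ℂ : A →ₗ[ℂ] A) = LinearMap.id := LinearMap.ext SS
  rwa [h2, LinearMap.id_comp, xi_one] at h
theorem tr_Du (T : Du A →ₗ[ℂ] Du A) (T' : A →ₗ[ℂ] A) (h : ∀ f a, T f a = f (T' a)) :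
    LinearMap.trace ℂ (Du A) T = LinearMap.trace ℂ A T' := by
  have h1 : T = ∑ i, (ev (T' (bs A i)) : Du A →ₗ[ℂ] ℂ).smulRight (cb A i) := by
    ext f a
    rw [h]
    conv_lhs => rw [← exA a, map_sum, map_sum]
    rw [LinearMap.sum_apply, Du.sum_apply]
    refine Finset.sum_congr rfl fun i _ => ?_
    rw [LinearMap.smulRight_apply, Du.smul_apply, map_smul, map_smul, smul_eq_mul, mul_comm]; rfl
  have h2 : T' = ∑ i, (Du.lin (cb A i)).smulRight (T' (bs A i)) := by
    ext a
    conv_lhs => rw [← exA a, map_sum]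
    simp
  rw [h1]
  conv_rhs => rw [h2]
  rw [map_sum, map_sum]
  refine Finset.sum_congr rfl fun i _ => ?_
  rw [trace_rank1, trace_rank1]; rfl
theorem tr_mulRight (f : Du A) : LinearMap.trace ℂ (Du A) (LinearMap.mulRight ℂ f) =
    Module.finrank ℂ A * f (Lm A) := by
  rw [tr_Du _ (rf f) (fun g a => by rw [ev_rf]; rfl), tr_rf]
theorem tr_mulLeft (f : Du A) : LinearMap.trace ℂ (Du A) (LinearMap.mulLeft ℂ f) =
    Module.finrank ℂ A * f (Lm A) := by
  let Sd : Du A ≃ₗ[ℂ] Du A := { sdu with invFun := sdu, left_inv := sdu_sdu, right_inv := sdu_sdu }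
  have : LinearMap.mulLeft ℂ f = Sd.conj (LinearMap.mulRight ℂ (sdu f)) := by
    refine LinearMap.ext fun g => ?_
    rw [LinearEquiv.conj_apply_apply]
    show f * g = sdu (sdu g * sdu f)
    rw [sdu_mul, sdu_sdu, sdu_sdu]
  rw [this, LinearMap.trace_conj', tr_mulRight, sdu_apply, S_Lm]
theorem Du_nondeg (f : Du A) (h : ∀ g, (f * g) (Lm A) = 0) : f = 0 := by
  have : lf f (Lm A) = 0 := by
    apply sepA; intro g; rw [ev_lf, h, map_zero]
  exact F_inj Lm_int (by rw [this]; simp [lf])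
instance : FiniteDimensional ℂ (Du A) := FiniteDimensional.of_finrank_pos
  (by rw [finrank_Du]; have := finrank_ne (Lm_int (A := A)); exact Nat.pos_of_ne_zero (by exact_mod_cast this))
instance Du_ss : IsSemisimpleRing (Du A) := ss_of_trace fun f h => Du_nondeg f fun g => by
  have := h g
  rw [tr_mulLeft] at this
  exact (mul_eq_zero.1 this).resolve_left (finrank_ne Lm_int)
end LRmain
end HB
set_option linter.all false
namespace HB
open TensorProduct Coalgebra WithConv HopfAlgebra

section tens
variable {C C' : Type*} [AddCommGroup C] [Module ℂ C] [Coalgebra ℂ C] [AddCommGroup C'] [Module ℂ C'] [Coalgebra ℂ C']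
variable {T : Type*} [Ring T] [Algebra ℂ T]

theorem conv_tmul (F G : W (C ⊗[ℂ] C') T) (a : C) (f : C') {ι κ : Type*} (r : Coalgebra.Repr ℂ a ι) (r' : Coalgebra.Repr ℂ f κ) :
    (F * G : W (C ⊗[ℂ] C') T) (a ⊗ₜ f) = ∑ i ∈ r.index, ∑ j ∈ r'.index,
      F (r.left i ⊗ₜ r'.left j) * G (r.right i ⊗ₜ r'.right j) := by
  rw [LinearMap.convMul_apply, TensorProduct.comul_tmul, ← r.eq, ← r'.eq]
  simp only [TensorProduct.sum_tmul, TensorProduct.tmul_sum, map_sum]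
  simp [AlgebraTensorModule.tensorTensorTensorComm]
  rw [Finset.sum_comm]

theorem Wt.ext {F G : W (C ⊗[ℂ] C') T} (h : ∀ a f, F (a ⊗ₜ f) = G (a ⊗ₜ f)) : F = G :=
  W.ext fun z => LinearMap.congr_fun (TensorProduct.ext' h : F.ofConv = G.ofConv) z

/-- inflate from the first factor -/
noncomputable def tA (φ : W C T) : W (C ⊗[ℂ] C') T :=
  toConv (φ.ofConv ∘ₗ (TensorProduct.rid ℂ C).toLinearMap ∘ₗ TensorProduct.map LinearMap.id counit)
noncomputable def tK (φ : W C' T) : W (C ⊗[ℂ] C') T :=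
  toConv (φ.ofConv ∘ₗ (TensorProduct.lid ℂ C').toLinearMap ∘ₗ TensorProduct.map counit LinearMap.id)
theorem tA_tmul (φ : W C T) (a : C) (f : C') : (tA φ : W (C ⊗[ℂ] C') T) (a ⊗ₜ f) = counit (R := ℂ) f • φ a :=
  φ.ofConv.map_smul _ _
theorem tK_tmul (φ : W C' T) (a : C) (f : C') : (tK φ : W (C ⊗[ℂ] C') T) (a ⊗ₜ f) = counit (R := ℂ) a • φ f :=
  φ.ofConv.map_smul _ _
theorem W.map_sum (φ : W C T) {ι : Type*} (s : Finset ι) (g : ι → C) : φ (∑ i ∈ s, g i) = ∑ i ∈ s, φ (g i) :=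
  _root_.map_sum φ.ofConv g s
theorem W.map_smul (φ : W C T) (c : ℂ) (g : C) : φ (c • g) = c • φ g :=
  φ.ofConv.map_smul c g
theorem mul_tA (F : W (C ⊗[ℂ] C') T) (φ : W C T) (a : C) (f : C') {ι : Type*} (r : Coalgebra.Repr ℂ a ι) :
    (F * tA φ : W (C ⊗[ℂ] C') T) (a ⊗ₜ f) = ∑ i ∈ r.index, F (r.left i ⊗ₜ f) * φ (r.right i) := by
  rw [conv_tmul _ _ _ _ r (ℛ ℂ f)]
  refine Finset.sum_congr rfl fun i _ => ?_
  simp only [tA_tmul, mul_smul_comm, ← smul_mul_assoc, ← Finset.sum_mul]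
  conv_rhs => rw [← sum_counit_smul' (ℛ ℂ f), TensorProduct.tmul_sum, W.map_sum]
  simp only [TensorProduct.tmul_smul, W.map_smul]
theorem tA_mul (F : W (C ⊗[ℂ] C') T) (φ : W C T) (a : C) (f : C') {ι : Type*} (r : Coalgebra.Repr ℂ a ι) :
    (tA φ * F : W (C ⊗[ℂ] C') T) (a ⊗ₜ f) = ∑ i ∈ r.index, φ (r.left i) * F (r.right i ⊗ₜ f) := by
  rw [conv_tmul _ _ _ _ r (ℛ ℂ f)]
  refine Finset.sum_congr rfl fun i _ => ?_
  simp only [tA_tmul, smul_mul_assoc, ← mul_smul_comm, ← Finset.mul_sum]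
  conv_rhs => rw [← sum_counit_smul (ℛ ℂ f), TensorProduct.tmul_sum, W.map_sum]
  simp only [TensorProduct.tmul_smul, W.map_smul]
theorem mul_tK (F : W (C ⊗[ℂ] C') T) (φ : W C' T) (a : C) (f : C') {ι : Type*} (r : Coalgebra.Repr ℂ f ι) :
    (F * tK φ : W (C ⊗[ℂ] C') T) (a ⊗ₜ f) = ∑ i ∈ r.index, F (a ⊗ₜ r.left i) * φ (r.right i) := by
  rw [conv_tmul _ _ _ _ (ℛ ℂ a) r, Finset.sum_comm]
  refine Finset.sum_congr rfl fun i _ => ?_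
  simp only [tK_tmul, mul_smul_comm, ← smul_mul_assoc, ← Finset.sum_mul]
  conv_rhs => rw [← sum_counit_smul' (ℛ ℂ a), TensorProduct.sum_tmul, W.map_sum]
  simp only [← TensorProduct.smul_tmul', W.map_smul]
theorem tK_mul (F : W (C ⊗[ℂ] C') T) (φ : W C' T) (a : C) (f : C') {ι : Type*} (r : Coalgebra.Repr ℂ f ι) :
    (tK φ * F : W (C ⊗[ℂ] C') T) (a ⊗ₜ f) = ∑ i ∈ r.index, φ (r.left i) * F (a ⊗ₜ r.right i) := by
  rw [conv_tmul _ _ _ _ (ℛ ℂ a) r, Finset.sum_comm]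
  refine Finset.sum_congr rfl fun i _ => ?_
  simp only [tK_tmul, smul_mul_assoc, ← mul_smul_comm, ← Finset.mul_sum]
  conv_rhs => rw [← sum_counit_smul (ℛ ℂ a), TensorProduct.sum_tmul, W.map_sum]
  simp only [← TensorProduct.smul_tmul', W.map_smul]
theorem tA_tA (φ ψ : W C T) : (tA (φ * ψ) : W (C ⊗[ℂ] C') T) = tA φ * tA ψ := by
  apply Wt.ext; intro a f
  rw [mul_tA _ _ _ _ (ℛ ℂ a), tA_tmul, (ℛ ℂ a).convMul_apply, Finset.smul_sum]
  simp only [tA_tmul, smul_mul_assoc]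
theorem tK_tK (φ ψ : W C' T) : (tK (φ * ψ) : W (C ⊗[ℂ] C') T) = tK φ * tK ψ := by
  apply Wt.ext; intro a f
  rw [mul_tK _ _ _ _ (ℛ ℂ f), tK_tmul, (ℛ ℂ f).convMul_apply, Finset.smul_sum]
  simp only [tK_tmul, smul_mul_assoc]
theorem tAK (φ : W C T) (ψ : W C' T) (a : C) (f : C') :
    (tA φ * tK ψ : W (C ⊗[ℂ] C') T) (a ⊗ₜ f) = φ a * ψ f := by
  rw [mul_tK _ _ _ _ (ℛ ℂ f)]
  simp only [tA_tmul, smul_mul_assoc, ← mul_smul_comm, ← Finset.mul_sum]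
  conv_rhs => rw [← sum_counit_smul (ℛ ℂ f), W.map_sum]
  simp only [W.map_smul]
theorem tKA (φ : W C T) (ψ : W C' T) (a : C) (f : C') :
    (tK ψ * tA φ : W (C ⊗[ℂ] C') T) (a ⊗ₜ f) = ψ f * φ a := by
  rw [tK_mul _ _ _ _ (ℛ ℂ f)]
  simp only [tA_tmul, mul_smul_comm, ← smul_mul_assoc, ← Finset.sum_mul]
  conv_rhs => rw [← sum_counit_smul' (ℛ ℂ f), W.map_sum]
  simp only [W.map_smul]
theorem t_comm {φ : W C T} {ψ : W C' T} (h : ∀ a f, φ a * ψ f = ψ f * φ a) :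
    (tA φ * tK ψ : W (C ⊗[ℂ] C') T) = tK ψ * tA φ := by
  apply Wt.ext; intro a f; rw [tAK, tKA, h]
end tens

section yd
variable {A : Type*} [Ring A] [HopfAlgebra ℂ A] [FiniteDimensional ℂ A]
variable {T : Type*} [Ring T] [Algebra ℂ T]

variable (A T) in
/-- evaluation pairing -/
noncomputable def Pp : W (A ⊗[ℂ] Du A) T := toConv ((Algebra.linearMap ℂ T) ∘ₗ TensorProduct.lift ev)
theorem Pp_tmul (a : A) (f : Du A) : (Pp A T) (a ⊗ₜ f) = f a • 1 := by
  rw [← Algebra.algebraMap_eq_smul_one]; rfl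

/-- representation of the comultiplication of the dual -/
noncomputable def dr (f : Du A) : Coalgebra.Repr ℂ f (Fin (Module.finrank ℂ A)) where
  index := Finset.univ
  left := cb A
  right i := lmul (bs A i) f
  eq := by rw [du_comul, dcomul_eq]

theorem tK_Pp (s : W (Du A) T) (a : A) (f : Du A) : (tK s * Pp A T : W (A ⊗[ℂ] Du A) T) (a ⊗ₜ f) = s (rmul a f) := by
  rw [tK_mul _ _ _ _ (dr f), ← exD (rmul a f), W.map_sum]
  refine Finset.sum_congr rfl fun i _ => ?_
  simp [dr, Pp_tmul, W.map_smul]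
theorem Pp_tK (s : W (Du A) T) (a : A) (f : Du A) : (Pp A T * tK s : W (A ⊗[ℂ] Du A) T) (a ⊗ₜ f) = s (lmul a f) := by
  rw [mul_tK _ _ _ _ (dr f)]
  simp only [dr, Pp_tmul, smul_mul_assoc, one_mul]
  have : lmul a f = ∑ i, cb A i a • lmul (bs A i) f := by
    ext b
    rw [Du.sum_apply]
    have := exK (Du.lin f ∘ₗ LinearMap.mulRight ℂ b) a
    simpa using this.symm
  rw [this, W.map_sum]
  simp only [W.map_smul]

noncomputable def ydl (r : W A T) (s : W (Du A) T) : W (A ⊗[ℂ] Du A) T := tK s * Pp A T * tA r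
noncomputable def ydr (r : W A T) (s : W (Du A) T) : W (A ⊗[ℂ] Du A) T := tA r * Pp A T * tK s
theorem ydl_apply (r : W A T) (s : W (Du A) T) (a : A) (f : Du A) {ι : Type*} (ra : Coalgebra.Repr ℂ a ι) :
    ydl r s (a ⊗ₜ f) = ∑ i ∈ ra.index, s (rmul (ra.left i) f) * r (ra.right i) := by
  rw [ydl, mul_tA _ _ _ _ ra]; simp only [tK_Pp]
theorem ydr_apply (r : W A T) (s : W (Du A) T) (a : A) (f : Du A) {ι : Type*} (ra : Coalgebra.Repr ℂ a ι) :
    ydr r s (a ⊗ₜ f) = ∑ i ∈ ra.index, r (ra.left i) * s (lmul (ra.right i) f) := by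
  rw [ydr, mul_assoc, tA_mul _ _ _ _ ra]; simp only [Pp_tK]

def YD (r : A →ₐ[ℂ] T) (s : Du A →ₐ[ℂ] T) : Prop := ydl (hc r) (hc s) = ydr (hc r) (hc s)

theorem YD.map {T' : Type*} [Ring T'] [Algebra ℂ T'] {r : A →ₐ[ℂ] T} {s : Du A →ₐ[ℂ] T} (h : YD r s)
    (φ : T →ₐ[ℂ] T') : YD (φ.comp r) (φ.comp s) := by
  apply Wt.ext; intro a f
  have h1 := congrArg (fun F : W (A ⊗[ℂ] Du A) T => φ (F (a ⊗ₜ f))) h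
  simp only [ydl_apply _ _ _ _ (ℛ ℂ a), ydr_apply _ _ _ _ (ℛ ℂ a), _root_.map_sum, map_mul, hc_apply] at h1
  rw [ydl_apply _ _ _ _ (ℛ ℂ a), ydr_apply _ _ _ _ (ℛ ℂ a)]
  exact h1

/-- tensor product of pairs -/
theorem YD.tens {r1 r2 r : A →ₐ[ℂ] T} {s1 s2 s : Du A →ₐ[ℂ] T} (h1 : YD r1 s1) (h2 : YD r2 s2)
    (hr : hc r = hc r1 * hc r2) (hs : hc s = hc s2 * hc s1)
    (c1 : ∀ a f, r1 a * s2 f = s2 f * r1 a) (c2 : ∀ a f, r2 a * s1 f = s1 f * r2 a) : YD r s := by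
  have e1 : (tA (hc r1) * tK (hc s2) : W (A ⊗[ℂ] Du A) T) = tK (hc s2) * tA (hc r1) := t_comm c1
  have e2 : (tA (hc r2) * tK (hc s1) : W (A ⊗[ℂ] Du A) T) = tK (hc s1) * tA (hc r2) := t_comm c2
  unfold YD ydl ydr at *
  rw [hr, hs, tA_tA, tK_tK]
  calc _ = tK (hc s2) * (tK (hc s1) * Pp A T * tA (hc r1)) * tA (hc r2) := by simp only [mul_assoc]
    _ = (tK (hc s2) * tA (hc r1)) * Pp A T * (tK (hc s1) * tA (hc r2)) := by rw [h1]; simp only [mul_assoc]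
    _ = tA (hc r1) * (tK (hc s2) * Pp A T * tA (hc r2)) * tK (hc s1) := by rw [← e1, ← e2]; simp only [mul_assoc]
    _ = _ := by rw [h2]; simp only [mul_assoc]

/-- module construction -/
theorem YD.mod {r k t ρ : A →ₐ[ℂ] T} {s : Du A →ₐ[ℂ] T} (hρ : hc ρ = hc r * hc k * hc t)
    (c : ∀ a f, k a * s f = s f * k a) (h1 : ydl (hc r) (hc s) = tA (hc r) * tK (hc s))
    (h2 : ydr (hc t) (hc s) = tK (hc s) * tA (hc t)) : YD ρ s := by
  have e1 : (tA (hc k) * tK (hc s) : W (A ⊗[ℂ] Du A) T) = tK (hc s) * tA (hc k) := t_comm c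
  unfold YD ydl ydr at *
  rw [hρ, tA_tA, tA_tA]
  calc _ = (tK (hc s) * Pp A T * tA (hc r)) * tA (hc k) * tA (hc t) := by simp only [mul_assoc]
    _ = tA (hc r) * (tK (hc s) * tA (hc k)) * tA (hc t) := by rw [h1]; simp only [mul_assoc]
    _ = tA (hc r) * tA (hc k) * (tK (hc s) * tA (hc t)) := by rw [← e1]; simp only [mul_assoc]
    _ = _ := by rw [← h2]; simp only [mul_assoc]
end yd
end HB
set_option linter.all false
namespace HB
open TensorProduct Coalgebra WithConv HopfAlgebra

section pre
variable {A : Type*} [Ring A] [HopfAlgebra ℂ A] [FiniteDimensional ℂ A]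

noncomputable def pr (f g : Du A) : A ⊗[ℂ] A →ₗ[ℂ] ℂ :=
  LinearMap.mul' ℂ ℂ ∘ₗ TensorProduct.map (Du.lin f) (Du.lin g)
theorem pr_tmul (f g : Du A) (a b : A) : pr f g (a ⊗ₜ b) = f a * g b := rfl
theorem pr_dl (f g : Du A) (a : A) : (f * g) a = pr f g (dl A a) := by
  rw [Du.mul_apply]; rfl
theorem pr_i1 (f g : Du A) (c : A) (z) : pr (lmul c f) g z = pr f g (i1 A A c * z) := by
  induction z with
  | zero => simp
  | add x y hx hy => simp only [map_add, mul_add, hx, hy]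
  | tmul x y => simp [pr_tmul]
theorem pr_i2 (f g : Du A) (c : A) (z) : pr f (lmul c g) z = pr f g (i2 A A c * z) := by
  induction z with
  | zero => simp
  | add x y hx hy => simp only [map_add, mul_add, hx, hy]
  | tmul x y => simp [pr_tmul]
theorem pr_r (f g : Du A) (c d : A) (z) : pr (rmul c f) (rmul d g) z = pr f g (z * (i1 A A c * i2 A A d)) := by
  induction z with
  | zero => simp
  | add x y hx hy => simp only [map_add, add_mul, hx, hy]
  | tmul x y => simp [pr_tmul]

/-- representation for the antipode -/
noncomputable def rS {a : A} {ι : Type*} (r : Coalgebra.Repr ℂ a ι) : Coalgebra.Repr ℂ (antipode ℂ a) ι where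
  index := r.index
  left i := antipode ℂ (r.right i)
  right i := antipode ℂ (r.left i)
  eq := by
    apply sepAA; intro f g
    have h1 := congrArg (fun h : Du A => h a) (sdu_mul f g)
    simp only [sdu_apply] at h1
    rw [pr_dl, Du.mul_repr _ _ r] at h1
    rw [map_sum, map_sum]
    refine Eq.trans ?_ h1.symm
    refine Finset.sum_congr rfl fun i _ => ?_
    simp [mul_comm]

noncomputable def r0 : A →ₐ[ℂ] Module.End ℂ (Du A) :=
  AlgHom.ofLinearMap ⟨⟨fun a => rmul a, fun a b => by ext; simp [mul_add]⟩, fun c a => by ext; simp⟩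
    (by ext; simp) (fun a b => by ext; simp [mul_assoc])
theorem r0_apply (a : A) (z : Du A) : r0 a z = rmul a z := rfl
noncomputable def t0 : A →ₐ[ℂ] Module.End ℂ (Du A) :=
  AlgHom.ofLinearMap ⟨⟨fun a => lmul (antipode ℂ a), fun a b => by ext; simp [add_mul]⟩, fun c a => by ext; simp⟩
    (by ext; simp) (fun a b => by ext; simp [antipode_mul_antidistrib, mul_assoc])
theorem t0_apply (a : A) (z : Du A) : t0 a z = lmul (antipode ℂ a) z := rfl
noncomputable def s0 : Du A →ₐ[ℂ] Module.End ℂ (Du A) := Algebra.lmul ℂ (Du A)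
theorem s0_apply (f z : Du A) : s0 f z = f * z := rfl
theorem rt_comm (a b : A) : r0 a * t0 b = t0 b * r0 a := by
  ext z x; simp [r0_apply, t0_apply, mul_assoc]

/-- convolution product of commuting algebra maps -/
noncomputable def hm {T : Type*} [Ring T] [Algebra ℂ T] (f g : A →ₐ[ℂ] T) (h : ∀ a b, f a * g b = g b * f a) : A →ₐ[ℂ] T :=
  (Algebra.TensorProduct.lift f g h).comp (dl A)
theorem hc_hm {T : Type*} [Ring T] [Algebra ℂ T] (f g : A →ₐ[ℂ] T) (h : ∀ a b, f a * g b = g b * f a) :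
    hc (hm f g h) = hc f * hc g := by
  apply W.ext; intro a
  rw [(ℛ ℂ a).convMul_apply]
  show Algebra.TensorProduct.lift f g h (comul a) = _
  rw [← (ℛ ℂ a).eq, map_sum]
  exact Finset.sum_congr rfl fun i _ => Algebra.TensorProduct.lift_tmul _ _ _ _ _

theorem mod1 {T : Type*} [Ring T] [Algebra ℂ T] (φ : Module.End ℂ (Du A) →ₐ[ℂ] T) :
    ydl (hc (φ.comp r0)) (hc (φ.comp s0)) = (tA (hc (φ.comp r0)) * tK (hc (φ.comp s0)) : W (A ⊗[ℂ] Du A) T) := by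
  apply Wt.ext; intro a f
  rw [ydl_apply _ _ _ _ (ℛ ℂ a), tAK]
  simp only [hc_apply, AlgHom.comp_apply, ← map_mul, ← map_sum]
  congr 1
  ext z x
  simp only [LinearMap.sum_apply, Module.End.mul_apply, s0_apply, r0_apply, Du.sum_apply, rmul_apply, pr_dl, map_mul]
  simp only [pr_r, ← map_sum, ← Finset.mul_sum]
  congr 2
  have := congrArg (fun F : W A (A ⊗[ℂ] A) => F a) (dl_eq (A := A))
  simp only [(ℛ ℂ a).convMul_apply] at this
  exact this.symm
end pre
section ss
variable {A : Type*} [Ring A] [HopfAlgebra ℂ A] [FiniteDimensional ℂ A] [IsSemisimpleRing A]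
theorem K3 {a : A} {ι : Type*} (r : Coalgebra.Repr ℂ a ι) :
    ∑ i ∈ r.index, i2 A A (antipode ℂ (r.right i)) * dl A (r.left i) = i1 A A a := by
  have h1 : (hc (i1 A A) * hs (i2 A A)) * hc (i2 A A) = hc (i1 A A) := by rw [mul_assoc, hs_hc, mul_one]
  have h2 : ∀ b : A, (hc (i1 A A) * hs (i2 A A) : W A (A ⊗[ℂ] A)) b = LinearMap.lTensor A (antipode ℂ) (dl A b) := fun b => by
    rw [(ℛ ℂ b).convMul_apply]
    show _ = LinearMap.lTensor A (antipode ℂ) (comul b)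
    rw [← (ℛ ℂ b).eq, map_sum]
    simp [hc_apply, hs_apply]
  have h3 := congrArg (fun F : W A (A ⊗[ℂ] A) => LinearMap.lTensor A (antipode ℂ) (F a)) h1
  simp only [r.convMul_apply, map_sum, h2] at h3
  have h4 : ∀ (b : A) (z : A ⊗[ℂ] A), LinearMap.lTensor A (antipode ℂ) (LinearMap.lTensor A (antipode ℂ) z * i2 A A b) =
      i2 A A (antipode ℂ b) * z := fun b z => by
    induction z with
    | zero => simp
    | add x y hx hy => simp only [map_add, add_mul, mul_add, hx, hy]
    | tmul x y => simp [antipode_mul_antidistrib, SS]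
  simp only [hc_apply, h4] at h3
  rw [h3]; simp
theorem K4 {a : A} {ι : Type*} (r : Coalgebra.Repr ℂ a ι) :
    ∑ i ∈ r.index, i1 A A (r.right i) * dl A (antipode ℂ (r.left i)) = i2 A A (antipode ℂ a) := by
  have h := congrArg (fun F : W A (A ⊗[ℂ] A) => F (antipode ℂ a)) (K1 (A := A))
  simp only [(rS r).convMul_apply] at h
  simp only [rS, hs_apply, hc_apply, SS] at h
  exact h
theorem mod2 {T : Type*} [Ring T] [Algebra ℂ T] (φ : Module.End ℂ (Du A) →ₐ[ℂ] T) :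
    ydr (hc (φ.comp t0)) (hc (φ.comp s0)) = (tK (hc (φ.comp s0)) * tA (hc (φ.comp t0)) : W (A ⊗[ℂ] Du A) T) := by
  apply Wt.ext; intro a f
  rw [ydr_apply _ _ _ _ (ℛ ℂ a), tKA]
  simp only [hc_apply, AlgHom.comp_apply, ← map_mul, ← map_sum]
  congr 1
  ext z x
  simp only [LinearMap.sum_apply, Module.End.mul_apply, s0_apply, t0_apply, Du.sum_apply, lmul_apply, pr_dl, map_mul]
  simp only [pr_i1, pr_i2, ← map_sum, ← mul_assoc, ← Finset.sum_mul]
  rw [K4]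

/-- the module structure on the dual -/
theorem ydK : YD (hm r0 t0 rt_comm) (s0 (A := A)) := by
  refine YD.mod (r := r0) (t := t0) (k := (Algebra.ofId ℂ _).comp (Bialgebra.counitAlgHom ℂ A)) ?_ ?_
    (mod1 (AlgHom.id ℂ _)) (mod2 (AlgHom.id ℂ _))
  · have : hc ((Algebra.ofId ℂ (Module.End ℂ (Du A))).comp (Bialgebra.counitAlgHom ℂ A)) = 1 := by
      rw [← cst_one]; apply W.ext; intro a; rw [cst_apply, ← Algebra.algebraMap_eq_smul_one]; rfl
    rw [this, mul_one, hc_hm]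
  · intro a f; exact Algebra.commutes (R := ℂ) (counit (R := ℂ) a) (s0 f)

abbrev TA (A : Type*) [Ring A] [HopfAlgebra ℂ A] [FiniteDimensional ℂ A] := Module.End ℂ (Du A) ⊗[ℂ] A
theorem ra_comm (a b : A) : ((i1 _ _).comp r0 : A →ₐ[ℂ] TA A) a * i2 _ _ b = i2 _ _ b * ((i1 _ _).comp r0 : A →ₐ[ℂ] TA A) a := by
  simp
theorem rat_comm (a b : A) : hm _ _ (ra_comm (A := A)) a * ((i1 _ _).comp t0 : A →ₐ[ℂ] TA A) b =
    ((i1 _ _).comp t0 : A →ₐ[ℂ] TA A) b * hm _ _ (ra_comm (A := A)) a := by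
  have := congrArg (fun F : W A (TA A) => F a) (hc_hm _ _ (ra_comm (A := A)))
  simp only [hc_apply, (ℛ ℂ a).convMul_apply] at this
  rw [this, Finset.sum_mul, Finset.mul_sum]
  refine Finset.sum_congr rfl fun i _ => ?_
  simp [rt_comm]
theorem ydTA : YD (hm _ _ (rat_comm (A := A))) ((i1 _ _).comp s0 : Du A →ₐ[ℂ] TA A) := by
  refine YD.mod (r := (i1 _ _).comp r0) (t := (i1 _ _).comp t0) (k := i2 _ _) ?_ ?_ (mod1 _) (mod2 _)
  · rw [hc_hm, hc_hm]
  · intro a f; simp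
end ss
end HB
set_option linter.all false
namespace HB
open TensorProduct Coalgebra WithConv HopfAlgebra

section dd
variable (A : Type*) [Ring A] [HopfAlgebra ℂ A] [FiniteDimensional ℂ A]
noncomputable def jA : A →ₗ[ℂ] TensorAlgebra ℂ (A × Du A) := TensorAlgebra.ι ℂ ∘ₗ LinearMap.inl ℂ A (Du A)
noncomputable def jK : Du A →ₗ[ℂ] TensorAlgebra ℂ (A × Du A) := TensorAlgebra.ι ℂ ∘ₗ LinearMap.inr ℂ A (Du A)
inductive DRel : TensorAlgebra ℂ (A × Du A) → TensorAlgebra ℂ (A × Du A) → Prop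
  | a1 : DRel (jA A 1) 1
  | am (a b : A) : DRel (jA A (a * b)) (jA A a * jA A b)
  | k1 : DRel (jK A 1) 1
  | km (a b : Du A) : DRel (jK A (a * b)) (jK A a * jK A b)
  | yd (z : A ⊗[ℂ] Du A) : DRel (ydl (toConv (jA A)) (toConv (jK A)) z) (ydr (toConv (jA A)) (toConv (jK A)) z)
/-- the double -/
def DD := RingQuot (DRel A)
noncomputable instance : Ring (DD A) := inferInstanceAs (Ring (RingQuot (DRel A)))
noncomputable instance : Algebra ℂ (DD A) := inferInstanceAs (Algebra ℂ (RingQuot (DRel A)))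
noncomputable def dmk : TensorAlgebra ℂ (A × Du A) →ₐ[ℂ] DD A := RingQuot.mkAlgHom ℂ (DRel A)
variable {A}
theorem dmk_rel {x y} (h : DRel A x y) : dmk A x = dmk A y := RingQuot.mkAlgHom_rel ℂ h
noncomputable def rho : A →ₐ[ℂ] DD A := AlgHom.ofLinearMap ((dmk A).toLinearMap ∘ₗ jA A)
  ((dmk_rel .a1).trans (map_one _)) (fun a b => (dmk_rel (.am a b)).trans (map_mul _ _ _))
noncomputable def sig : Du A →ₐ[ℂ] DD A := AlgHom.ofLinearMap ((dmk A).toLinearMap ∘ₗ jK A)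
  ((dmk_rel .k1).trans (map_one _)) (fun a b => (dmk_rel (.km a b)).trans (map_mul _ _ _))
theorem rho_def (a : A) : rho a = dmk A (jA A a) := rfl
theorem sig_def (a : Du A) : sig a = dmk A (jK A a) := rfl
theorem yd_map {T T' : Type*} [Ring T] [Algebra ℂ T] [Ring T'] [Algebra ℂ T'] (φ : T →ₐ[ℂ] T') (r : A →ₗ[ℂ] T) (s : Du A →ₗ[ℂ] T) (z) :
    φ (ydl (toConv r) (toConv s) z) = ydl (toConv (φ.toLinearMap ∘ₗ r)) (toConv (φ.toLinearMap ∘ₗ s)) z ∧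
    φ (ydr (toConv r) (toConv s) z) = ydr (toConv (φ.toLinearMap ∘ₗ r)) (toConv (φ.toLinearMap ∘ₗ s)) z := by
  refine ⟨?_, ?_⟩
  · refine LinearMap.congr_fun (f := φ.toLinearMap ∘ₗ (ydl (toConv r) (toConv s)).ofConv)
      (g := (ydl (toConv (φ.toLinearMap ∘ₗ r)) (toConv (φ.toLinearMap ∘ₗ s))).ofConv) (TensorProduct.ext' fun a f => ?_) z
    show φ (ydl (toConv r) (toConv s) (a ⊗ₜ f)) = ydl (toConv (φ.toLinearMap ∘ₗ r)) (toConv (φ.toLinearMap ∘ₗ s)) (a ⊗ₜ f)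
    rw [ydl_apply _ _ _ _ (ℛ ℂ a), ydl_apply _ _ _ _ (ℛ ℂ a), map_sum]
    exact Finset.sum_congr rfl fun i _ => map_mul _ _ _
  · refine LinearMap.congr_fun (f := φ.toLinearMap ∘ₗ (ydr (toConv r) (toConv s)).ofConv)
      (g := (ydr (toConv (φ.toLinearMap ∘ₗ r)) (toConv (φ.toLinearMap ∘ₗ s))).ofConv) (TensorProduct.ext' fun a f => ?_) z
    show φ (ydr (toConv r) (toConv s) (a ⊗ₜ f)) = ydr (toConv (φ.toLinearMap ∘ₗ r)) (toConv (φ.toLinearMap ∘ₗ s)) (a ⊗ₜ f)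
    rw [ydr_apply _ _ _ _ (ℛ ℂ a), ydr_apply _ _ _ _ (ℛ ℂ a), map_sum]
    exact Finset.sum_congr rfl fun i _ => map_mul _ _ _
theorem ydD : YD (rho (A := A)) sig := by
  apply W.ext; intro z
  exact (yd_map (dmk A) _ _ z).1.symm.trans ((dmk_rel (.yd z)).trans (yd_map (dmk A) _ _ z).2)
variable {T : Type*} [Ring T] [Algebra ℂ T]
theorem dl_aux {r : A →ₐ[ℂ] T} {s : Du A →ₐ[ℂ] T} (h : YD r s) ⦃x y : TensorAlgebra ℂ (A × Du A)⦄ (hx : DRel A x y) :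
    TensorAlgebra.lift ℂ (r.toLinearMap.coprod s.toLinearMap) x = TensorAlgebra.lift ℂ (r.toLinearMap.coprod s.toLinearMap) y := by
  have h1 : (TensorAlgebra.lift ℂ (r.toLinearMap.coprod s.toLinearMap)).toLinearMap ∘ₗ jA A = r.toLinearMap := by
    ext a; simp [jA]
  have h2 : (TensorAlgebra.lift ℂ (r.toLinearMap.coprod s.toLinearMap)).toLinearMap ∘ₗ jK A = s.toLinearMap := by
    ext a; simp [jK]
  induction hx with
  | a1 => simp [jA]
  | am a b => simp [jA]
  | k1 => simp [jK]
  | km a b => simp [jK]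
  | yd z => rw [(yd_map _ _ _ z).1, (yd_map _ _ _ z).2, h1, h2]; exact congrArg (fun F : W (A ⊗[ℂ] Du A) T => F z) h
noncomputable def dlift {r : A →ₐ[ℂ] T} {s : Du A →ₐ[ℂ] T} (h : YD r s) : DD A →ₐ[ℂ] T :=
  RingQuot.liftAlgHom ℂ ⟨TensorAlgebra.lift ℂ (r.toLinearMap.coprod s.toLinearMap), dl_aux h⟩
theorem dlift_rho {r : A →ₐ[ℂ] T} {s : Du A →ₐ[ℂ] T} (h : YD r s) (a : A) : dlift h (rho a) = r a :=
  (RingQuot.liftAlgHom_mkAlgHom_apply ℂ _ _ _).trans (by simp [jA])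
theorem dlift_sig {r : A →ₐ[ℂ] T} {s : Du A →ₐ[ℂ] T} (h : YD r s) (a : Du A) : dlift h (sig a) = s a :=
  (RingQuot.liftAlgHom_mkAlgHom_apply ℂ _ _ _).trans (by simp [jK])
theorem DD.ind (S : Subalgebra ℂ (DD A)) (hr : ∀ a, rho a ∈ S) (hs : ∀ f, sig f ∈ S) (x) : x ∈ S := by
  obtain ⟨y, rfl⟩ : ∃ y, dmk A y = x := RingQuot.mkAlgHom_surjective ℂ (DRel A) x
  induction y using TensorAlgebra.induction with
  | algebraMap r => rw [AlgHom.commutes]; exact S.algebraMap_mem r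
  | ι x =>
    have : TensorAlgebra.ι ℂ x = jA A x.1 + jK A x.2 := by simp [jA, jK, ← map_add]
    rw [this, map_add]; exact S.add_mem (hr _) (hs _)
  | mul a b ha hb => rw [map_mul]; exact S.mul_mem ha hb
  | add a b ha hb => rw [map_add]; exact S.add_mem ha hb
theorem DD.hom_ext {f g : DD A →ₐ[ℂ] T} (hr : ∀ a, f (rho a) = g (rho a)) (hs : ∀ k, f (sig k) = g (sig k)) : f = g :=
  AlgHom.ext fun x => DD.ind (AlgHom.equalizer f g) hr hs x

/-- multiplication map -/
noncomputable def mK : Du A ⊗[ℂ] A →ₗ[ℂ] DD A :=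
  LinearMap.mul' ℂ (DD A) ∘ₗ TensorProduct.map sig.toLinearMap rho.toLinearMap
theorem mK_tmul (f : Du A) (a : A) : mK (f ⊗ₜ a) = sig f * rho a := rfl
end dd
section ss
variable {A : Type*} [Ring A] [HopfAlgebra ℂ A] [FiniteDimensional ℂ A] [IsSemisimpleRing A]
theorem mK_mem (f : Du A) (a : A) : rho a * sig f ∈ LinearMap.range (mK (A := A)) := by
  let Θ : A ⊗[ℂ] A →ₗ[ℂ] DD A := TensorProduct.lift
    ⟨⟨fun x => LinearMap.mulLeft ℂ (rho x) ∘ₗ sig.toLinearMap ∘ₗ ⟨⟨fun b => lmul b f, fun a b => by ext; simp [add_mul]⟩, fun c b => by ext; simp⟩,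
      fun x y => by ext; simp [add_mul]⟩, fun c x => by ext; simp⟩
  have hΘ : ∀ x b, Θ (x ⊗ₜ b) = rho x * sig (lmul b f) := fun x b => rfl
  have h := congrArg Θ (K3 (ℛ ℂ a))
  have h1 : Θ (i1 A A a) = rho a * sig f := by
    show Θ (a ⊗ₜ 1) = _
    rw [hΘ]; congr 2; ext; simp
  rw [h1, map_sum] at h
  rw [← h]
  refine Submodule.sum_mem _ fun i _ => ?_
  have h2 : Θ (i2 A A (antipode ℂ ((ℛ ℂ a).right i)) * dl A ((ℛ ℂ a).left i)) =
      ydr (hc rho) (hc sig) ((ℛ ℂ a).left i ⊗ₜ lmul (antipode ℂ ((ℛ ℂ a).right i)) f) := by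
    rw [ydr_apply _ _ _ _ (ℛ ℂ ((ℛ ℂ a).left i))]
    show Θ (_ * comul _) = _
    conv_lhs => rw [← (ℛ ℂ ((ℛ ℂ a).left i)).eq]
    rw [Finset.mul_sum, map_sum]
    refine Finset.sum_congr rfl fun j _ => ?_
    rw [i2, Algebra.TensorProduct.includeRight_apply, Algebra.TensorProduct.tmul_mul_tmul, one_mul, hΘ]
    simp only [hc_apply]; congr 2; ext; simp [mul_assoc]
  rw [h2, ← (ydD : ydl _ _ = _), ydl_apply _ _ _ _ (ℛ ℂ ((ℛ ℂ a).left i))]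
  exact Submodule.sum_mem _ fun j _ => ⟨_ ⊗ₜ _, mK_tmul _ _⟩
theorem mK_surj : Function.Surjective (mK (A := A)) := by
  intro x
  have h1 : ∀ f, ∀ y ∈ LinearMap.range (mK (A := A)), sig f * y ∈ LinearMap.range (mK (A := A)) := by
    rintro f _ ⟨z, rfl⟩
    induction z with
    | zero => simp
    | add x y hx hy => simp only [map_add, mul_add]; exact Submodule.add_mem _ hx hy
    | tmul g a => exact ⟨(f * g) ⊗ₜ a, by rw [mK_tmul, mK_tmul, map_mul, mul_assoc]⟩
  have h3 : ∀ a, ∀ y ∈ LinearMap.range (mK (A := A)), y * rho a ∈ LinearMap.range (mK (A := A)) := by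
    rintro b _ ⟨z, rfl⟩
    induction z with
    | zero => simp
    | add x y hx hy => simp only [map_add, add_mul]; exact Submodule.add_mem _ hx hy
    | tmul g a => exact ⟨g ⊗ₜ (a * b), by rw [mK_tmul, mK_tmul, map_mul, mul_assoc]⟩
  have h2 : ∀ a, ∀ y ∈ LinearMap.range (mK (A := A)), rho a * y ∈ LinearMap.range (mK (A := A)) := by
    rintro a _ ⟨z, rfl⟩
    induction z with
    | zero => simp
    | add x y hx hy => simp only [map_add, mul_add]; exact Submodule.add_mem _ hx hy
    | tmul g b => rw [mK_tmul, ← mul_assoc]; exact h3 _ _ (mK_mem _ _)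
  let S : Subalgebra ℂ (DD A) :=
    { carrier := {x | ∀ y ∈ LinearMap.range (mK (A := A)), x * y ∈ LinearMap.range (mK (A := A))}
      mul_mem' := fun {a b} ha hb y hy => by rw [mul_assoc]; exact ha _ (hb y hy)
      add_mem' := fun {a b} ha hb y hy => by rw [add_mul]; exact Submodule.add_mem _ (ha y hy) (hb y hy)
      algebraMap_mem' := fun c y hy => by rw [← Algebra.smul_def]; exact Submodule.smul_mem _ c hy }
  have h := DD.ind S h2 h1 x 1 ⟨1 ⊗ₜ 1, by rw [mK_tmul, map_one, map_one, one_mul]⟩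
  rwa [mul_one] at h

noncomputable def Psi : DD A →ₐ[ℂ] TA A := dlift ydTA
noncomputable def evT : TA A →ₗ[ℂ] Du A ⊗[ℂ] A := LinearMap.rTensor A (LinearMap.applyₗ 1)
noncomputable def actT : TA A →ₗ[ℂ] Module.End ℂ (Du A ⊗[ℂ] A) :=
  TensorProduct.homTensorHomMap (RingHom.id ℂ) (Du A) A (Du A) A ∘ₗ LinearMap.lTensor _ (LinearMap.mul ℂ A)
theorem evT_tmul (φ : Module.End ℂ (Du A)) (a : A) : evT (φ ⊗ₜ a) = φ 1 ⊗ₜ a := rfl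
theorem actT_tmul (φ : Module.End ℂ (Du A)) (a : A) : actT (φ ⊗ₜ a) = TensorProduct.map φ (LinearMap.mulLeft ℂ a) := rfl
theorem evT_mul (x y : Module.End ℂ (Du A) ⊗[ℂ] A) : evT (x * y) = actT x (evT y) := by
  induction x with
  | zero => simp
  | add x y hx hy => simp only [add_mul, map_add, hx, hy, LinearMap.add_apply]
  | tmul φ a =>
    induction y with
    | zero => simp
    | add x y hx hy => simp only [mul_add, map_add, hx, hy]
    | tmul ψ b => simp [evT_tmul, actT_tmul]
theorem Psi_rho_repr (a : A) : Psi (rho a) = ∑ i ∈ (ℛ ℂ a).index,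
    (∑ j ∈ (ℛ ℂ ((ℛ ℂ a).left i)).index, (r0 ((ℛ ℂ ((ℛ ℂ a).left i)).left j) * t0 ((ℛ ℂ a).right i)) ⊗ₜ
      ((ℛ ℂ ((ℛ ℂ a).left i)).right j) : TA A) := by
  rw [Psi, dlift_rho]
  have := congrArg (fun F : W A (TA A) => F a) (hc_hm _ _ (rat_comm (A := A)))
  simp only [hc_apply, (ℛ ℂ a).convMul_apply] at this
  rw [this]
  refine Finset.sum_congr rfl fun i _ => ?_
  have := congrArg (fun F : W A (TA A) => F ((ℛ ℂ a).left i)) (hc_hm _ _ (ra_comm (A := A)))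
  simp only [hc_apply, (ℛ ℂ ((ℛ ℂ a).left i)).convMul_apply] at this
  rw [this, Finset.sum_mul]
  refine Finset.sum_congr rfl fun j _ => ?_
  simp
theorem Psi_sig (f : Du A) : Psi (sig f) = s0 f ⊗ₜ 1 := by rw [Psi, dlift_sig]; rfl
theorem ev_mK (z : Du A ⊗[ℂ] A) : evT (Psi (mK z)) = z := by
  induction z with
  | zero => simp
  | add x y hx hy => simp only [map_add, hx, hy]
  | tmul f a =>
    rw [mK_tmul, map_mul, Psi_sig, Psi_rho_repr]
    have e1 : ∀ b : A, rmul b (1 : Du A) = counit (R := ℂ) b • 1 := fun b => by ext; simp [mul_comm]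
    have e2 : ∀ b : A, lmul b (1 : Du A) = counit (R := ℂ) b • 1 := fun b => by ext; simp
    have e3 : ∀ i ∈ (ℛ ℂ a).index, (∑ j ∈ (ℛ ℂ ((ℛ ℂ a).left i)).index, evT (s0 f ⊗ₜ 1 * (r0 ((ℛ ℂ ((ℛ ℂ a).left i)).left j) * t0 ((ℛ ℂ a).right i)) ⊗ₜ[ℂ]
      ((ℛ ℂ ((ℛ ℂ a).left i)).right j) : TA A)) = f ⊗ₜ[ℂ] (counit (R := ℂ) ((ℛ ℂ a).right i) • (ℛ ℂ a).left i) := fun i _ => by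
      conv_rhs => rw [← sum_counit_smul (ℛ ℂ ((ℛ ℂ a).left i)), Finset.smul_sum, TensorProduct.tmul_sum]
      refine Finset.sum_congr rfl fun j _ => ?_
      rw [Algebra.TensorProduct.tmul_mul_tmul, evT_tmul]
      simp only [Module.End.mul_apply, t0_apply, r0_apply, s0_apply, e2, map_smul, e1, counit_antipode, one_mul,
        mul_smul_comm, mul_one, smul_smul, TensorProduct.smul_tmul]
    simp only [Finset.mul_sum, map_sum]
    rw [Finset.sum_congr rfl e3, ← TensorProduct.tmul_sum, sum_counit_smul']
theorem mK_ev (x : DD A) : mK (evT (Psi x)) = x := by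
  obtain ⟨z, rfl⟩ := mK_surj x; rw [ev_mK]
noncomputable def mKe : Du A ⊗[ℂ] A ≃ₗ[ℂ] DD A :=
  LinearEquiv.ofBijective mK ⟨fun x y h => by rw [← ev_mK x, h, ev_mK], mK_surj⟩
instance : FiniteDimensional ℂ (DD A) := LinearEquiv.finiteDimensional mKe
theorem mulLeft_D (x : DD A) : LinearMap.mulLeft ℂ x = mKe.conj (actT (Psi x)) := by
  apply LinearMap.ext; intro y
  have : mKe.symm y = evT (Psi y) := by rw [LinearEquiv.symm_apply_eq]; exact (mK_ev y).symm
  rw [LinearEquiv.conj_apply_apply, this, ← evT_mul, ← map_mul]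
  exact (mK_ev _).symm
noncomputable def laT : TA A →ₗ[ℂ] Module.End ℂ (Du A) := (TensorProduct.rid ℂ _).toLinearMap ∘ₗ LinearMap.lTensor _ (chr A)
theorem laT_tmul (φ : Module.End ℂ (Du A)) (a : A) : laT (φ ⊗ₜ a) = chr A a • φ := rfl
theorem tr_act (x : Module.End ℂ (Du A) ⊗[ℂ] A) : LinearMap.trace ℂ _ (actT x) = LinearMap.trace ℂ _ (laT x) := by
  induction x with
  | zero => simp
  | add x y hx hy => simp only [map_add, hx, hy]
  | tmul φ a => rw [actT_tmul, laT_tmul, LinearMap.trace_tensorProduct', map_smul, chr_apply, smul_eq_mul, mul_comm]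
theorem rf_xi (a : A) : rf (xi A) a = chr A a • (1 : A) := sepA fun f => by
  rw [ev_rf, mul_xi, Du.smul_apply, map_smul, smul_eq_mul, mul_comm, xi_apply]
theorem lf_xi' (a : A) : lf (xi A) a = chr A a • (1 : A) := sepA fun f => by
  rw [ev_lf, xi_mul, Du.smul_apply, map_smul, smul_eq_mul, mul_comm, xi_apply]
theorem chr_D (f : Du A) (a : A) : chr (DD A) (sig f * rho a) = Module.finrank ℂ A * f (Lm A) * chr A a := by
  rw [chr_apply, mulLeft_D, LinearMap.trace_conj', tr_act, map_mul, Psi_sig, Psi_rho_repr]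
  have e3 : ∀ i ∈ (ℛ ℂ a).index, (∑ j ∈ (ℛ ℂ ((ℛ ℂ a).left i)).index, laT (s0 f ⊗ₜ 1 * (r0 ((ℛ ℂ ((ℛ ℂ a).left i)).left j) * t0 ((ℛ ℂ a).right i)) ⊗ₜ[ℂ]
      ((ℛ ℂ ((ℛ ℂ a).left i)).right j) : TA A)) = chr A ((ℛ ℂ a).left i) • (s0 f * t0 ((ℛ ℂ a).right i)) := fun i _ => by
    have h := congrArg (fun x => s0 f * r0 x * t0 ((ℛ ℂ a).right i)) (rf_xi ((ℛ ℂ a).left i))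
    simp only [rf_repr _ (ℛ ℂ ((ℛ ℂ a).left i)), map_sum, map_smul, map_one, mul_smul_comm, mul_one, smul_mul_assoc, Finset.mul_sum, Finset.sum_mul] at h
    rw [← h]
    refine Finset.sum_congr rfl fun j _ => ?_
    rw [Algebra.TensorProduct.tmul_mul_tmul, laT_tmul, one_mul, ← mul_assoc]; rfl
  simp only [Finset.mul_sum, map_sum laT]
  rw [Finset.sum_congr rfl e3]
  have h := congrArg (fun x => s0 f * t0 x) (lf_xi' a)
  simp only [lf_repr _ (ℛ ℂ a), map_sum, map_smul, map_one, mul_smul_comm, mul_one, Finset.mul_sum] at h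
  erw [h]
  rw [map_smul, smul_eq_mul, mul_comm]
  congr 1
  exact tr_mulLeft f
theorem chr_Drho (a : A) : chr (DD A) (rho a) = Module.finrank ℂ A * chr A a := by
  have := chr_D (1 : Du A) a
  rw [map_one, one_mul] at this
  rw [this, Du.one_apply, (Lm_int).e, mul_one]
theorem exKA (z : Du A ⊗[ℂ] A) : ∃ c : Fin (Module.finrank ℂ A) → Du A, z = ∑ i, c i ⊗ₜ bs A i := by
  induction z with
  | zero => exact ⟨0, by simp⟩
  | add x y hx hy =>
    obtain ⟨c, rfl⟩ := hx; obtain ⟨d, rfl⟩ := hy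
    exact ⟨c + d, by simp [TensorProduct.add_tmul, Finset.sum_add_distrib]⟩
  | tmul f a => exact ⟨fun i => cb A i a • f, by
      conv_lhs => rw [← exA a, TensorProduct.tmul_sum]
      simp [TensorProduct.smul_tmul]⟩
instance DD_ss : IsSemisimpleRing (DD A) := ss_of_trace fun x h => by
  have h0 : ∀ y, chr (DD A) (x * y) = 0 := h
  obtain ⟨z, rfl⟩ := mK_surj x
  have hN : (Module.finrank ℂ A : ℂ) ≠ 0 := finrank_ne (Lm_int (A := A))
  let b := bs A
  obtain ⟨c, rfl⟩ : ∃ c : Fin (Module.finrank ℂ A) → Du A, z = ∑ i, c i ⊗ₜ bs A i := by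
    exact exKA z
  have h1 : ∀ (g : Du A) (i), (g * c i) (Lm A) = 0 := fun g => by
    have h2 : ∑ i, (g * c i) (Lm A) • bs A i = 0 := nd Lm_int lf_xi _ fun y => by
      have h3 := h0 (rho y * sig g)
      rw [← mul_assoc, chr_comm, map_sum, Finset.sum_mul, Finset.mul_sum, map_sum] at h3
      have h4 : ∀ i, chr (DD A) (sig g * (mK (c i ⊗ₜ bs A i) * rho y)) = (Module.finrank ℂ A : ℂ) * ((g * c i) (Lm A) * chr A (bs A i * y)) := fun i => by
        rw [mK_tmul, mul_assoc, ← map_mul, ← mul_assoc, ← map_mul, chr_D, mul_assoc]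
      simp only [h4, ← Finset.mul_sum] at h3
      have h5 := (mul_eq_zero.1 h3).resolve_left hN
      rw [xi_apply, chr_comm, Finset.sum_mul, map_sum, ← h5]
      exact Finset.sum_congr rfl fun i _ => by rw [smul_mul_assoc, map_smul, smul_eq_mul]
    exact fun i => Fintype.linearIndependent_iff.1 (bs A).linearIndependent _ h2 i
  have h6 : ∀ i, c i = 0 := fun i => Du_nondeg _ fun g => by
    have e : (c i * g) (Lm A) * (Module.finrank ℂ A : ℂ) = (g * c i) (Lm A) * (Module.finrank ℂ A : ℂ) := by
      rw [mul_comm, ← tr_mulLeft, mul_comm, ← tr_mulLeft]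
      exact chr_comm (c i) g
    rw [h1, zero_mul] at e
    exact (mul_eq_zero.1 e).resolve_right hN
  simp [h6]
end ss
end HB
set_option linter.all false
namespace HB
open TensorProduct Coalgebra WithConv HopfAlgebra

section can
variable {A : Type*} [Ring A] [HopfAlgebra ℂ A] [FiniteDimensional ℂ A]
variable {T : Type*} [Ring T] [Algebra ℂ T]
theorem exD' (ψ : Du A →ₗ[ℂ] T) (f : Du A) : ∑ i, f (bs A i) • ψ (cb A i) = ψ f := by
  conv_rhs => rw [← exD f, map_sum]
  simp
theorem can0 (Φ : A →ₗ[ℂ] A) (Φ' : Du A →ₗ[ℂ] Du A) (h : ∀ f a, Φ' f a = f (Φ a)) (φ : A →ₗ[ℂ] T) (ψ : Du A →ₗ[ℂ] T) :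
    ∑ i, φ (Φ (bs A i)) * ψ (cb A i) = ∑ i, φ (bs A i) * ψ (Φ' (cb A i)) := by
  have h1 : ∀ i, φ (Φ (bs A i)) = ∑ j, cb A j (Φ (bs A i)) • φ (bs A j) := fun i => (exK φ _).symm
  have h2 : ∀ j, ψ (Φ' (cb A j)) = ∑ i, cb A j (Φ (bs A i)) • ψ (cb A i) := fun j => by
    rw [← exD' ψ (Φ' (cb A j))]; simp only [h]
  simp only [h1, h2, Finset.sum_mul, Finset.mul_sum, smul_mul_assoc, mul_smul_comm]
  exact Finset.sum_comm
theorem can1r (a : A) (φ : A →ₗ[ℂ] T) (ψ : Du A →ₗ[ℂ] T) :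
    ∑ i, φ (bs A i * a) * ψ (cb A i) = ∑ i, φ (bs A i) * ψ (rmul a (cb A i)) :=
  can0 (LinearMap.mulRight ℂ a) (rmul a) (fun _ _ => rfl) φ ψ
theorem can1l (a : A) (φ : A →ₗ[ℂ] T) (ψ : Du A →ₗ[ℂ] T) :
    ∑ i, φ (a * bs A i) * ψ (cb A i) = ∑ i, φ (bs A i) * ψ (lmul a (cb A i)) :=
  can0 (LinearMap.mulLeft ℂ a) (lmul a) (fun _ _ => rfl) φ ψ
theorem dl_exp (a : A) : dl A a = ∑ i, ∑ j, (cb A i * cb A j) a • (bs A i ⊗ₜ[ℂ] bs A j) := by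
  show comul a = _
  simp only [Du.mul_repr _ _ (ℛ ℂ a)]
  conv_lhs => rw [← (ℛ ℂ a).eq]
  simp only [Finset.sum_smul]
  symm
  refine (Finset.sum_congr rfl fun i _ => Finset.sum_comm).trans (Finset.sum_comm.trans (Finset.sum_congr rfl fun k _ => ?_))
  symm
  conv_lhs => rw [← exA ((ℛ ℂ a).left k), ← exA ((ℛ ℂ a).right k)]
  simp only [TensorProduct.sum_tmul, TensorProduct.tmul_sum, ← TensorProduct.smul_tmul', TensorProduct.tmul_smul, smul_smul, Finset.smul_sum]
  rw [Finset.sum_comm]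
  simp only [mul_comm]
theorem dlK_exp (f : Du A) : dl (Du A) f = ∑ i, ∑ j, f (bs A i * bs A j) • (cb A i ⊗ₜ[ℂ] cb A j) := by
  show comul f = _
  rw [du_comul, dcomul_eq]
  refine Finset.sum_congr rfl fun i _ => ?_
  rw [← exD (lmul (bs A i) f)]
  simp only [TensorProduct.tmul_sum, TensorProduct.tmul_smul, lmul_apply]
theorem can2 (G : A ⊗[ℂ] A →ₗ[ℂ] T) (ψ : Du A →ₗ[ℂ] T) :
    ∑ k, G (dl A (bs A k)) * ψ (cb A k) = ∑ i, ∑ j, G (bs A i ⊗ₜ bs A j) * ψ (cb A i * cb A j) := by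
  simp only [dl_exp, map_sum, map_smul, Finset.sum_mul, smul_mul_assoc]
  rw [Finset.sum_comm]
  refine Finset.sum_congr rfl fun i _ => ?_
  rw [Finset.sum_comm]
  refine Finset.sum_congr rfl fun j _ => ?_
  simp only [← mul_smul_comm, ← Finset.mul_sum, exD']
theorem can3 (φ : A →ₗ[ℂ] T) (H : Du A ⊗[ℂ] Du A →ₗ[ℂ] T) :
    ∑ k, φ (bs A k) * H (dl (Du A) (cb A k)) = ∑ i, ∑ j, φ (bs A i * bs A j) * H (cb A i ⊗ₜ cb A j) := by
  simp only [dlK_exp, map_sum, map_smul, Finset.mul_sum, mul_smul_comm]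
  rw [Finset.sum_comm]
  refine Finset.sum_congr rfl fun i _ => ?_
  rw [Finset.sum_comm]
  refine Finset.sum_congr rfl fun j _ => ?_
  simp only [← smul_mul_assoc, ← Finset.sum_mul, exK]
/-- multiply two linear maps -/
noncomputable def mm (φ ψ : A →ₗ[ℂ] T) : A ⊗[ℂ] A →ₗ[ℂ] T := LinearMap.mul' ℂ T ∘ₗ TensorProduct.map φ ψ
theorem mm_tmul (φ ψ : A →ₗ[ℂ] T) (a b : A) : mm φ ψ (a ⊗ₜ b) = φ a * ψ b := rfl
theorem mm_dl (φ ψ : A →ₗ[ℂ] T) (a : A) {ι : Type*} (r : Coalgebra.Repr ℂ a ι) :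
    mm φ ψ (dl A a) = ∑ i ∈ r.index, φ (r.left i) * ψ (r.right i) := by
  show mm φ ψ (comul a) = _
  rw [← r.eq, map_sum]; rfl
theorem mm_hm (f g : A →ₐ[ℂ] T) (h) (a : A) : mm f.toLinearMap g.toLinearMap (dl A a) = hm f g h a := by
  rw [mm_dl _ _ a (ℛ ℂ a)]
  have := congrArg (fun F : W A T => F a) (hc_hm f g h)
  simp only [(ℛ ℂ a).convMul_apply] at this
  exact this.symm
/-- canonical element -/
noncomputable def cE (r : A →ₐ[ℂ] T) (s : Du A →ₐ[ℂ] T) : T := ∑ i, r (bs A i) * s (cb A i)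
theorem cE_map {T' : Type*} [Ring T'] [Algebra ℂ T'] (φ : T →ₐ[ℂ] T') (r : A →ₐ[ℂ] T) (s : Du A →ₐ[ℂ] T) :
    φ (cE r s) = cE (φ.comp r) (φ.comp s) := by simp [cE]
/-- basis form of the Yetter--Drinfeld relation -/
theorem yd_basis {r : A →ₐ[ℂ] T} {s : Du A →ₐ[ℂ] T} (h : YD r s) (φ : A →ₗ[ℂ] T) (a : A) :
    ∑ k ∈ (ℛ ℂ a).index, ∑ i, φ (bs A i * (ℛ ℂ a).left k) * s (cb A i) * r ((ℛ ℂ a).right k) =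
    ∑ k ∈ (ℛ ℂ a).index, ∑ i, φ ((ℛ ℂ a).right k * bs A i) * (r ((ℛ ℂ a).left k) * s (cb A i)) := by
  have h1 : ∀ i, φ (bs A i) * ydl (hc r) (hc s) (a ⊗ₜ cb A i) = φ (bs A i) * ydr (hc r) (hc s) (a ⊗ₜ cb A i) := fun i => by
    rw [(h : ydl _ _ = _)]
  have h2 := Finset.sum_congr (rfl : (Finset.univ : Finset (Fin (Module.finrank ℂ A))) = Finset.univ) fun i _ => h1 i
  simp only [ydl_apply _ _ _ _ (ℛ ℂ a), ydr_apply _ _ _ _ (ℛ ℂ a), Finset.mul_sum, hc_apply] at h2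
  rw [Finset.sum_comm, Finset.sum_comm (s := Finset.univ) (t := (ℛ ℂ a).index)] at h2
  refine Eq.trans (Finset.sum_congr rfl fun k _ => ?_) (h2.trans (Finset.sum_congr rfl fun k _ => ?_))
  · rw [← Finset.sum_mul]
    have := can1r ((ℛ ℂ a).left k) φ s.toLinearMap
    simp only [AlgHom.toLinearMap_apply] at this
    rw [this, Finset.sum_mul]; simp only [mul_assoc]
  · exact (can1l ((ℛ ℂ a).right k) φ ((LinearMap.mulLeft ℂ (r ((ℛ ℂ a).left k))) ∘ₗ s.toLinearMap)).symm
/-- dual basis form -/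
theorem yd_basis' {r : A →ₐ[ℂ] T} {s : Du A →ₐ[ℂ] T} (h : YD r s) (ψ : Du A →ₗ[ℂ] T) (f : Du A) :
    ∑ k ∈ (ℛ ℂ f).index, ∑ i, s ((ℛ ℂ f).left k) * (r (bs A i) * ψ ((ℛ ℂ f).right k * cb A i)) =
    ∑ k ∈ (ℛ ℂ f).index, ∑ i, r (bs A i) * s ((ℛ ℂ f).right k) * ψ (cb A i * (ℛ ℂ f).left k) := by
  have h1 : ∀ i, ydl (hc r) (hc s) (bs A i ⊗ₜ f) * ψ (cb A i) = ydr (hc r) (hc s) (bs A i ⊗ₜ f) * ψ (cb A i) := fun i => by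
    rw [(h : ydl _ _ = _)]
  have h2 := Finset.sum_congr (rfl : (Finset.univ : Finset (Fin (Module.finrank ℂ A))) = Finset.univ) fun i _ => h1 i
  let R' : A →ₗ[ℂ] Du A := ⟨⟨fun b => rmul b f, fun a b => by ext; simp [mul_add]⟩, fun c b => by ext; simp⟩
  let L' : A →ₗ[ℂ] Du A := ⟨⟨fun b => lmul b f, fun a b => by ext; simp [add_mul]⟩, fun c b => by ext; simp⟩
  have e1 : ∀ a, ydl (hc r) (hc s) (a ⊗ₜ f) = mm (s.toLinearMap ∘ₗ R') r.toLinearMap (dl A a) := fun a => by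
    rw [ydl_apply _ _ _ _ (ℛ ℂ a), mm_dl _ _ _ (ℛ ℂ a)]; rfl
  have e2 : ∀ a, ydr (hc r) (hc s) (a ⊗ₜ f) = mm r.toLinearMap (s.toLinearMap ∘ₗ L') (dl A a) := fun a => by
    rw [ydr_apply _ _ _ _ (ℛ ℂ a), mm_dl _ _ _ (ℛ ℂ a)]; rfl
  have c1 : ∑ k ∈ (ℛ ℂ f).index, (ℛ ℂ f).left k ⊗ₜ[ℂ] (ℛ ℂ f).right k = ∑ i, rmul (bs A i) f ⊗ₜ[ℂ] cb A i := by
    rw [(ℛ ℂ f).eq]; show dl (Du A) f = _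
    rw [dlK_exp, Finset.sum_comm]
    refine Finset.sum_congr rfl fun j _ => ?_
    rw [← exD (rmul (bs A j) f), TensorProduct.sum_tmul]
    simp [TensorProduct.smul_tmul']
  have c2 : ∑ k ∈ (ℛ ℂ f).index, (ℛ ℂ f).left k ⊗ₜ[ℂ] (ℛ ℂ f).right k = ∑ i, cb A i ⊗ₜ[ℂ] lmul (bs A i) f := by
    rw [(ℛ ℂ f).eq, du_comul, dcomul_eq]
  simp only [e1, e2, can2, mm_tmul] at h2
  have g1 : ∀ j, ∑ k ∈ (ℛ ℂ f).index, s ((ℛ ℂ f).left k) * (r (bs A j) * ψ ((ℛ ℂ f).right k * cb A j)) =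
     ∑ i, s (rmul (bs A i) f) * (r (bs A j) * ψ (cb A i * cb A j)) := fun j => by
    have := congrArg (mm s.toLinearMap (LinearMap.mulLeft ℂ (r (bs A j)) ∘ₗ ψ ∘ₗ LinearMap.mulRight ℂ (cb A j))) c1
    simp only [map_sum] at this
    exact this
  have g2 : ∀ j, ∑ k ∈ (ℛ ℂ f).index, r (bs A j) * s ((ℛ ℂ f).right k) * ψ (cb A j * (ℛ ℂ f).left k) =
     ∑ i, r (bs A j) * s (lmul (bs A i) f) * ψ (cb A j * cb A i) := fun j => by
    let X : Du A ⊗[ℂ] Du A →ₗ[ℂ] T := LinearMap.mul' ℂ T ∘ₗ TensorProduct.map (LinearMap.mulLeft ℂ (r (bs A j)) ∘ₗ s.toLinearMap)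
      (ψ ∘ₗ LinearMap.mulLeft ℂ (cb A j)) ∘ₗ (TensorProduct.comm ℂ _ _).toLinearMap
    have := congrArg X c2
    simp only [map_sum] at this
    exact this
  rw [Finset.sum_comm, Finset.sum_comm (s := (ℛ ℂ f).index) (t := Finset.univ)]
  simp only [g1, g2]
  rw [Finset.sum_comm]
  refine Eq.trans ?_ (h2.trans ?_)
  · refine Finset.sum_congr rfl fun i _ => Finset.sum_congr rfl fun j _ => ?_
    simp only [mul_assoc]; rfl
  · rfl
end can
section ss
variable {A : Type*} [Ring A] [HopfAlgebra ℂ A] [FiniteDimensional ℂ A] [IsSemisimpleRing A]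
theorem K5 {a : A} {ι : Type*} (r : Coalgebra.Repr ℂ a ι) :
    ∑ i ∈ r.index, dl A (r.right i) * i1 A A (antipode ℂ (r.left i)) = i2 A A a := by
  have h1 : hc (i1 A A) * (hs (i1 A A) * hc (i2 A A)) = hc (i2 A A) := by rw [← mul_assoc, hc_hs, one_mul]
  have h2 : ∀ b : A, (hs (i1 A A) * hc (i2 A A) : W A (A ⊗[ℂ] A)) b = LinearMap.rTensor A (antipode ℂ) (dl A b) := fun b => by
    rw [(ℛ ℂ b).convMul_apply]
    show _ = LinearMap.rTensor A (antipode ℂ) (comul b)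
    rw [← (ℛ ℂ b).eq, map_sum]
    simp [hc_apply, hs_apply]
  have h3 := congrArg (fun F : W A (A ⊗[ℂ] A) => LinearMap.rTensor A (antipode ℂ) (F a)) h1
  simp only [r.convMul_apply, map_sum, h2] at h3
  have h4 : ∀ (b : A) (z : A ⊗[ℂ] A), LinearMap.rTensor A (antipode ℂ) (i1 A A b * LinearMap.rTensor A (antipode ℂ) z) =
      z * i1 A A (antipode ℂ b) := fun b z => by
    induction z with
    | zero => simp
    | add x y hx hy => simp only [map_add, add_mul, mul_add, hx, hy]
    | tmul x y => simp [antipode_mul_antidistrib, SS]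
  simp only [hc_apply, h4] at h3
  rw [h3]; simp
theorem Sop {a : A} {ι : Type*} (r : Coalgebra.Repr ℂ a ι) :
    ∑ i ∈ r.index, antipode ℂ (r.right i) * r.left i = counit (R := ℂ) a • 1 := by
  have h := congrArg (antipode ℂ) (sum_antipode_mul_eq_smul r)
  simpa [antipode_mul_antidistrib, SS] using h
/-- the central element -/
noncomputable def wD (A : Type*) [Ring A] [HopfAlgebra ℂ A] [FiniteDimensional ℂ A] : DD A := cE rho sig
theorem w_rho (a : A) : wD A * rho a = rho a * wD A := by
  let G : A ⊗[ℂ] A →ₗ[ℂ] DD A := TensorProduct.lift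
    ⟨⟨fun x => LinearMap.mulLeft ℂ (∑ i, rho (bs A i * x) * sig (cb A i)) ∘ₗ rho.toLinearMap,
      fun x y => by ext; simp [mul_add, add_mul, Finset.sum_add_distrib, mul_assoc]⟩, fun c x => by ext; simp [← Finset.smul_sum, mul_assoc]⟩
  let H : A ⊗[ℂ] A →ₗ[ℂ] DD A := TensorProduct.lift
    ⟨⟨fun x => ∑ i, LinearMap.mulRight ℂ (sig (cb A i)) ∘ₗ rho.toLinearMap ∘ₗ LinearMap.mulRight ℂ (bs A i * x),
      fun x y => by ext; simp [mul_add, add_mul, Finset.sum_add_distrib, mul_assoc]⟩, fun c x => by ext; simp [← Finset.smul_sum, mul_assoc]⟩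
  have hG : ∀ x y, G (x ⊗ₜ y) = ∑ i, rho (bs A i * x) * sig (cb A i) * rho y := fun x y => by
    simp [G, Finset.sum_mul]
  have hH : ∀ x y, H (x ⊗ₜ y) = ∑ i, rho (y * (bs A i * x)) * sig (cb A i) := fun x y => by
    simp [H, LinearMap.sum_apply, mul_assoc]
  have key : ∀ b z : A, G (dl A b * i1 A A z) = H (i1 A A z * dl A b) := fun b z => by
    have h := yd_basis ydD (rho.toLinearMap ∘ₗ LinearMap.mulRight ℂ z) b
    have e : dl A b = ∑ k ∈ (ℛ ℂ b).index, (ℛ ℂ b).left k ⊗ₜ (ℛ ℂ b).right k := (ℛ ℂ b).eq.symm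
    rw [e, Finset.sum_mul, Finset.mul_sum, map_sum, map_sum]
    refine Eq.trans (Finset.sum_congr rfl fun k _ => ?_) (h.trans (Finset.sum_congr rfl fun k _ => ?_))
    · simp [hG, mul_assoc]
    · simp [hH, mul_assoc]
  have h1 := congrArg G (K5 (ℛ ℂ a))
  have h2 := congrArg (fun F : W A (A ⊗[ℂ] A) => H (F a)) (K1 (A := A))
  simp only [(ℛ ℂ a).convMul_apply, map_sum, hs_apply, hc_apply] at h2
  simp only [map_sum, key] at h1
  rw [h2] at h1
  simp only [i2, Algebra.TensorProduct.includeRight_apply, hG, hH, mul_one] at h1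
  rw [wD, cE, Finset.sum_mul, Finset.mul_sum, ← h1]
  exact Finset.sum_congr rfl fun i _ => by rw [map_mul, mul_assoc]
theorem w_sig (f : Du A) : wD A * sig f = sig f * wD A := by
  let G : Du A ⊗[ℂ] Du A →ₗ[ℂ] DD A := TensorProduct.lift
    ⟨⟨fun x => ∑ i, LinearMap.mulLeft ℂ (sig x * rho (bs A i)) ∘ₗ sig.toLinearMap ∘ₗ LinearMap.mulRight ℂ (cb A i),
      fun x y => by ext; simp [mul_add, add_mul, Finset.sum_add_distrib, mul_assoc]⟩, fun c x => by ext; simp [← Finset.smul_sum, mul_assoc]⟩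
  let H : Du A ⊗[ℂ] Du A →ₗ[ℂ] DD A := TensorProduct.lift
    ⟨⟨fun x => ∑ i, LinearMap.mulLeft ℂ (rho (bs A i)) ∘ₗ sig.toLinearMap ∘ₗ LinearMap.mulRight ℂ (cb A i * x),
      fun x y => by ext; simp [mul_add, add_mul, Finset.sum_add_distrib, mul_assoc]⟩, fun c x => by ext; simp [← Finset.smul_sum, mul_assoc]⟩
  have hG : ∀ x y, G (x ⊗ₜ y) = ∑ i, sig x * rho (bs A i) * sig (y * cb A i) := fun x y => by
    simp [G, LinearMap.sum_apply, mul_assoc]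
  have hH : ∀ x y, H (x ⊗ₜ y) = ∑ i, rho (bs A i) * sig (y * (cb A i * x)) := fun x y => by
    simp [H, LinearMap.sum_apply, mul_assoc]
  have key : ∀ b z : Du A, G (i2 _ _ z * dl _ b) = H (dl _ b * i2 _ _ z) := fun b z => by
    have h := yd_basis' ydD (sig.toLinearMap ∘ₗ LinearMap.mulLeft ℂ z) b
    have e : dl _ b = ∑ k ∈ (ℛ ℂ b).index, (ℛ ℂ b).left k ⊗ₜ (ℛ ℂ b).right k := (ℛ ℂ b).eq.symm
    rw [e, Finset.sum_mul, Finset.mul_sum, map_sum, map_sum]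
    refine Eq.trans (Finset.sum_congr rfl fun k _ => ?_) (h.trans (Finset.sum_congr rfl fun k _ => ?_))
    · simp [hG, mul_assoc]
    · simp [hH, mul_assoc]
  have h1 := congrArg G (K3 (ℛ ℂ f))
  have h2 := congrArg (fun F : W (Du A) (Du A ⊗[ℂ] Du A) => H (F f)) (K2 (A := Du A))
  simp only [(ℛ ℂ f).convMul_apply, map_sum, hs_apply, hc_apply] at h2
  simp only [map_sum, key] at h1
  rw [h2] at h1
  simp only [i1, Algebra.TensorProduct.includeLeft_apply, hG, hH, one_mul] at h1
  rw [wD, cE, Finset.sum_mul, Finset.mul_sum]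
  refine Eq.trans (Finset.sum_congr rfl fun i _ => ?_) (h1.trans (Finset.sum_congr rfl fun i _ => ?_))
  · rw [map_mul, mul_assoc]
  · rw [mul_assoc]
theorem w_comm (x : DD A) : wD A * x = x * wD A := by
  have h := DD.ind (Subalgebra.centralizer ℂ {wD A}) (fun a => ?_) (fun f => ?_) x
  · exact Subalgebra.mem_centralizer_iff ℂ |>.1 h _ rfl
  · exact Subalgebra.mem_centralizer_iff ℂ |>.2 fun g hg => by rw [Set.mem_singleton_iff.1 hg]; exact w_rho a
  · exact Subalgebra.mem_centralizer_iff ℂ |>.2 fun g hg => by rw [Set.mem_singleton_iff.1 hg]; exact w_sig f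
theorem w_inv : ∃ w' : DD A, wD A * w' = 1 := by
  refine ⟨∑ j, rho (antipode ℂ (bs A j)) * sig (cb A j), ?_⟩
  let G : A ⊗[ℂ] A →ₗ[ℂ] DD A := rho.toLinearMap ∘ₗ LinearMap.mul' ℂ A ∘ₗ LinearMap.rTensor A (antipode ℂ) ∘ₗ (TensorProduct.comm ℂ A A).toLinearMap
  have hG : ∀ x y, G (x ⊗ₜ y) = rho (antipode ℂ y * x) := fun x y => rfl
  have h := can2 G sig.toLinearMap
  have h1 : ∀ b, G (dl A b) = counit (R := ℂ) b • 1 := fun b => by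
    have e : dl A b = ∑ k ∈ (ℛ ℂ b).index, (ℛ ℂ b).left k ⊗ₜ (ℛ ℂ b).right k := (ℛ ℂ b).eq.symm
    rw [e, map_sum]; simp only [hG]; rw [← map_sum, Sop, map_smul, map_one]
  have h2 : ∑ k, G (dl A (bs A k)) * sig.toLinearMap (cb A k) = 1 := by
    simp only [h1, smul_mul_assoc, one_mul]
    have := exD' (sig.toLinearMap (A := Du A)) (1 : Du A)
    simp only [Du.one_apply, AlgHom.toLinearMap_apply, map_one] at this
    exact this
  rw [h2] at h
  rw [Finset.mul_sum, h, Finset.sum_comm]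
  refine Finset.sum_congr rfl fun j _ => ?_
  rw [← mul_assoc, w_comm, wD, cE, Finset.mul_sum, Finset.sum_mul]
  refine Finset.sum_congr rfl fun i _ => ?_
  simp only [hG, AlgHom.toLinearMap_apply, map_mul, mul_assoc]
end ss
end HB
set_option linter.all false
namespace HB
open TensorProduct Coalgebra WithConv HopfAlgebra

section gen
variable {A : Type*} [Ring A] [HopfAlgebra ℂ A] {T : Type*} [Ring T] [Algebra ℂ T] [FiniteDimensional ℂ A]
/-- lift of commuting maps -/
noncomputable def ml (f g : A →ₐ[ℂ] T) (h : ∀ a b, f a * g b = g b * f a) : A ⊗[ℂ] A →ₐ[ℂ] T := Algebra.TensorProduct.lift f g h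
theorem ml_tmul (f g : A →ₐ[ℂ] T) (h) (a b : A) : ml f g h (a ⊗ₜ b) = f a * g b := Algebra.TensorProduct.lift_tmul f g h a b
theorem ml_dl (f g : A →ₐ[ℂ] T) (h) (a : A) : ml f g h (dl A a) = hm f g h a := rfl
theorem hm_repr (f g : A →ₐ[ℂ] T) (h) (a : A) {ι : Type*} (r : Coalgebra.Repr ℂ a ι) :
    hm f g h a = ∑ k ∈ r.index, f (r.left k) * g (r.right k) := by
  have := congrArg (fun F : W A T => F a) (hc_hm f g h)
  simp only [r.convMul_apply] at this
  exact this
theorem hmK1 (f g : A →ₐ[ℂ] T) (h) (a : A) :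
    ∑ k ∈ (ℛ ℂ a).index, f (antipode ℂ ((ℛ ℂ a).left k)) * hm f g h ((ℛ ℂ a).right k) = g a := by
  have := congrArg (fun F : W A _ => ml f g h (F a)) (K1 (A := A))
  simp only [(ℛ ℂ a).convMul_apply, hs_apply, hc_apply, map_sum, map_mul, ml_dl, Algebra.TensorProduct.includeLeft_apply, Algebra.TensorProduct.includeRight_apply, ml_tmul, map_one, mul_one, one_mul] at this
  exact this
theorem hmK2 (f g : A →ₐ[ℂ] T) (h) (a : A) :
    ∑ k ∈ (ℛ ℂ a).index, hm f g h ((ℛ ℂ a).left k) * g (antipode ℂ ((ℛ ℂ a).right k)) = f a := by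
  have := congrArg (fun F : W A _ => ml f g h (F a)) (K2 (A := A))
  simp only [(ℛ ℂ a).convMul_apply, hs_apply, hc_apply, map_sum, map_mul, ml_dl, Algebra.TensorProduct.includeLeft_apply, Algebra.TensorProduct.includeRight_apply, ml_tmul, map_one, mul_one, one_mul] at this
  exact this
theorem hmc (f g : A →ₐ[ℂ] T) (h) (s : Du A →ₐ[ℂ] T) (hg : ∀ a k, g a * s k = s k * g a) :
    ∑ k, hm f g h (bs A k) * s (cb A k) = cE f s * cE g s := by
  have := can2 (ml f g h).toLinearMap s.toLinearMap
  simp only [AlgHom.toLinearMap_apply, ml_tmul, map_mul] at this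
  refine Eq.trans this ?_
  rw [cE, cE, Finset.sum_mul_sum]
  refine Finset.sum_congr rfl fun i _ => Finset.sum_congr rfl fun j _ => ?_
  rw [mul_assoc, ← mul_assoc (g _), hg]; simp only [mul_assoc]
variable [IsSemisimpleRing A]
theorem hmK3 (f g : A →ₐ[ℂ] T) (h) (a : A) :
    ∑ k ∈ (ℛ ℂ a).index, g (antipode ℂ ((ℛ ℂ a).right k)) * hm f g h ((ℛ ℂ a).left k) = f a := by
  have := congrArg (ml f g h) (K3 (ℛ ℂ a))
  simp only [map_sum, map_mul, ml_dl, Algebra.TensorProduct.includeLeft_apply, Algebra.TensorProduct.includeRight_apply, ml_tmul, map_one, mul_one, one_mul] at this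
  exact this
theorem hmK5 (f g : A →ₐ[ℂ] T) (h) (a : A) :
    ∑ k ∈ (ℛ ℂ a).index, hm f g h ((ℛ ℂ a).right k) * f (antipode ℂ ((ℛ ℂ a).left k)) = g a := by
  have := congrArg (ml f g h) (K5 (ℛ ℂ a))
  simp only [map_sum, map_mul, ml_dl, Algebra.TensorProduct.includeLeft_apply, Algebra.TensorProduct.includeRight_apply, ml_tmul, map_one, mul_one, one_mul] at this
  exact this
theorem cE_inv (r : A →ₐ[ℂ] T) (s : Du A →ₐ[ℂ] T) (hg : ∀ a k, r a * s k = s k * r a) : ∃ y, cE r s * y = 1 := by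
  refine ⟨∑ j, r (antipode ℂ (bs A j)) * s (cb A j), ?_⟩
  let G : A ⊗[ℂ] A →ₗ[ℂ] T := r.toLinearMap ∘ₗ LinearMap.mul' ℂ A ∘ₗ LinearMap.lTensor A (antipode ℂ)
  have h := can2 G s.toLinearMap
  have h1 : ∀ b, G (dl A b) = counit (R := ℂ) b • 1 := fun b => by
    have e : dl A b = ∑ k ∈ (ℛ ℂ b).index, (ℛ ℂ b).left k ⊗ₜ (ℛ ℂ b).right k := (ℛ ℂ b).eq.symm
    rw [e]; simp only [G, LinearMap.comp_apply, map_sum, LinearMap.lTensor_tmul, LinearMap.mul'_apply]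
    rw [← map_sum, sum_mul_antipode_eq_smul]; simp
  have h2 : ∑ k, G (dl A (bs A k)) * s.toLinearMap (cb A k) = 1 := by
    simp only [h1, smul_mul_assoc, one_mul]
    have := exD' s.toLinearMap (1 : Du A)
    simp only [Du.one_apply, AlgHom.toLinearMap_apply, map_one] at this
    exact this
  rw [← h2, h, cE, Finset.sum_mul_sum]
  refine Finset.sum_congr rfl fun i _ => Finset.sum_congr rfl fun j _ => ?_
  simp only [G, LinearMap.comp_apply, LinearMap.lTensor_tmul, LinearMap.mul'_apply, AlgHom.toLinearMap_apply, map_mul]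
  rw [mul_assoc, ← mul_assoc (s _), ← hg]; simp only [mul_assoc]

section twr
variable {X T T' Y : Type*} [Ring X] [Algebra ℂ X] [Ring T] [Algebra ℂ T] [Ring Y] [Algebra ℂ Y] [Ring T'] [Algebra ℂ T']
  [FiniteDimensional ℂ X] [FiniteDimensional ℂ T] [FiniteDimensional ℂ Y]
theorem twl (δ : X →ₐ[ℂ] Y) (j : T →ₐ[ℂ] Y) (x : X) {y : Y} (hy : y ∈ LinearMap.range (twm δ j)) :
    δ x * y ∈ LinearMap.range (twm δ j) := by
  obtain ⟨z, rfl⟩ := hy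
  induction z with
  | zero => simp
  | add a b ha hb => rw [map_add, mul_add]; exact add_mem ha hb
  | tmul a b => exact ⟨(x * a) ⊗ₜ b, by simp [mul_assoc]⟩
theorem twrr (δ : X →ₐ[ℂ] Y) (j : T →ₐ[ℂ] Y) (x : T) {y : Y} (hy : y ∈ LinearMap.range (twm δ j)) :
    y * j x ∈ LinearMap.range (twm δ j) := by
  obtain ⟨z, rfl⟩ := hy
  induction z with
  | zero => simp
  | add a b ha hb => rw [map_add, add_mul]; exact add_mem ha hb
  | tmul a b => exact ⟨a ⊗ₜ (b * x), by simp [mul_assoc]⟩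
theorem tw_mem (δ : X →ₐ[ℂ] Y) (j : T →ₐ[ℂ] Y) (x : X) (t : T) : δ x * j t ∈ LinearMap.range (twm δ j) := ⟨x ⊗ₜ t, rfl⟩
/-- the subalgebra of elements with image in the range -/
noncomputable def twS (δ : X →ₐ[ℂ] Y) (j : T →ₐ[ℂ] Y) (j' : T' →ₐ[ℂ] Y) (hj : ∀ a b, j a * j' b = j' b * j a) : Subalgebra ℂ T' where
  carrier := {y | j' y ∈ LinearMap.range (twm δ j)}
  mul_mem' {a b} ha hb := by
    obtain ⟨z, hz⟩ := ha
    show j' (a * b) ∈ LinearMap.range (twm δ j)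
    rw [map_mul, ← hz]
    clear hz
    induction z with
    | zero => simp
    | add x y hx hy => rw [map_add, add_mul]; exact add_mem hx hy
    | tmul x t => rw [twm_tmul, mul_assoc, hj, ← mul_assoc]; exact twrr _ _ _ (twl _ _ _ hb)
  add_mem' {a b} ha hb := by show j' (a + b) ∈ LinearMap.range (twm δ j); rw [map_add]; exact add_mem ha hb
  algebraMap_mem' c := by
    show j' (algebraMap ℂ T' c) ∈ LinearMap.range (twm δ j)
    exact ⟨algebraMap ℂ X c ⊗ₜ 1, by simp⟩
theorem det_mul' {X : Type*} [Ring X] [Algebra ℂ X] (x y : X) : LinearMap.det (LinearMap.mulLeft ℂ (x * y)) =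
    LinearMap.det (LinearMap.mulLeft ℂ x) * LinearMap.det (LinearMap.mulLeft ℂ y) := by
  rw [LinearMap.mulLeft_mul, ← LinearMap.det_comp]
theorem det_i2 [FiniteDimensional ℂ T'] (x : T') : LinearMap.det (LinearMap.mulLeft ℂ (i2 T T' x)) = LinearMap.det (LinearMap.mulLeft ℂ x) ^ Module.finrank ℂ T := by
  refine tw_det _ (i1 T T') (tw_bij _ _ (fun y => ?_) (by rw [Module.finrank_tensorProduct, mul_comm])) x
  induction y with
  | zero => exact ⟨0, by simp⟩
  | add a b ha hb => exact (LinearMap.range (twm (i2 T T') (i1 T T'))).add_mem ha hb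
  | tmul a b => exact ⟨b ⊗ₜ a, by simp⟩
end twr
theorem detX [FiniteDimensional ℂ T] (κ : A →ₐ[ℂ] T) (s : Du A →ₐ[ℂ] T) (hg : ∀ a k, κ a * s k = s k * κ a) :
    LinearMap.det (LinearMap.mulLeft ℂ (cE κ s)) ^ Module.finrank ℂ A = 1 := by
  have hcm : ∀ a b, i1 A T a * (i2 A T).comp κ b = (i2 A T).comp κ b * i1 A T a := fun a b => by simp
  let δ := hm (i1 A T) ((i2 A T).comp κ) hcm
  have hδ : ∀ a k, δ a * i2 A T (s k) = i2 A T (s k) * δ a := fun a k => by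
    simp only [δ, hm_repr _ _ _ a (ℛ ℂ a), Finset.sum_mul, Finset.mul_sum]
    exact Finset.sum_congr rfl fun i _ => by simp [hg]
  have hb : Function.Bijective (twm δ (i2 A T)) := tw_bij _ _ (fun y => by
    show y ∈ LinearMap.range _
    induction y with
    | zero => simp
    | add a b ha hb => exact add_mem ha hb
    | tmul a t =>
      have : a ⊗ₜ t = i1 A T a * i2 A T t := by simp
      rw [this]
      refine twrr _ _ _ ?_
      rw [← hmK2 (i1 A T) _ hcm a]
      exact Submodule.sum_mem _ fun k _ => tw_mem _ _ _ _) (by rw [Module.finrank_tensorProduct])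
  let Y := cE (i1 A T) ((i2 A T).comp s)
  have hY : ∀ z, twm δ (i2 A T) (Y * z) = Y * i2 A T (cE κ s) * twm δ (i2 A T) z := fun z => by
    have h1 := hmc (i1 A T) ((i2 A T).comp κ) hcm ((i2 A T).comp s) (fun a k => by simp [hg])
    rw [← cE_map] at h1
    rw [← h1]
    induction z with
    | zero => simp
    | add a b ha hb => simp only [mul_add, map_add, ha, hb]
    | tmul a t =>
      simp only [Y, cE, Finset.sum_mul, map_sum]
      refine Finset.sum_congr rfl fun i _ => ?_
      have : i1 A T (bs A i) * (i2 A T).comp s (cb A i) * a ⊗ₜ t = (bs A i * a) ⊗ₜ (s (cb A i) * t) := by simp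
      rw [this]
      simp only [twm_tmul, map_mul, AlgHom.comp_apply, mul_assoc]
      rw [← mul_assoc (δ a), hδ]; simp only [mul_assoc]; rfl
  obtain ⟨Y', hY'⟩ := cE_inv (i1 A T) ((i2 A T).comp s) (fun a k => by simp)
  have hne : LinearMap.det (LinearMap.mulLeft ℂ Y) ≠ 0 := fun h0 => by
    have := det_mul' Y Y'
    rw [h0, hY', zero_mul] at this
    simp [LinearMap.mulLeft_one] at this
  let Φ := LinearEquiv.ofBijective _ hb
  have h2 : LinearMap.mulLeft ℂ (Y * i2 A T (cE κ s)) = Φ.conj (LinearMap.mulLeft ℂ Y) := by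
    refine LinearMap.ext fun y => ?_
    obtain ⟨z, rfl⟩ := Φ.surjective y
    rw [LinearEquiv.conj_apply_apply, LinearEquiv.symm_apply_apply]
    exact (hY z).symm
  have h3 := congrArg LinearMap.det h2
  rw [LinearEquiv.conj_apply, LinearMap.comp_assoc, LinearMap.det_conj, det_mul', det_i2] at h3
  exact mul_left_cancel₀ hne (by rw [h3, mul_one])
end gen
end HB
set_option linter.all false
namespace HB
open TensorProduct Coalgebra WithConv HopfAlgebra
section
variable {A : Type*} [Ring A] [HopfAlgebra ℂ A] [FiniteDimensional ℂ A] [IsSemisimpleRing A]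
variable {T : Type*} [Ring T] [Algebra ℂ T]
noncomputable abbrev ρ1 : A →ₐ[ℂ] DD A ⊗[ℂ] DD A := (i1 _ _).comp rho
noncomputable abbrev ρ2 : A →ₐ[ℂ] DD A ⊗[ℂ] DD A := (i2 _ _).comp rho
noncomputable abbrev σ1 : Du A →ₐ[ℂ] DD A ⊗[ℂ] DD A := (i1 _ _).comp sig
noncomputable abbrev σ2 : Du A →ₐ[ℂ] DD A ⊗[ℂ] DD A := (i2 _ _).comp sig
theorem ρ12 (a b : A) : ρ1 a * ρ2 b = ρ2 b * ρ1 a := by simp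
theorem ρ21 (a b : A) : ρ2 a * ρ1 b = ρ1 b * ρ2 a := by simp
theorem σ21 (a b : Du A) : σ2 a * σ1 b = σ1 b * σ2 a := by simp
theorem ρσ12 (a : A) (b : Du A) : ρ1 a * σ2 b = σ2 b * ρ1 a := by simp
theorem ρσ21 (a : A) (b : Du A) : ρ2 a * σ1 b = σ1 b * ρ2 a := by simp
theorem yd_D2 : YD (hm (ρ1 (A := A)) ρ2 ρ12) (hm σ2 σ1 σ21) :=
  YD.tens (ydD.map (i1 _ _)) (ydD.map (i2 _ _)) (hc_hm _ _ _) (hc_hm _ _ _) ρσ12 ρσ21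
/-- comultiplication of the double -/
noncomputable def dD : DD A →ₐ[ℂ] DD A ⊗[ℂ] DD A := dlift yd_D2
theorem dD_rho (a : A) : dD (rho a) = hm ρ1 ρ2 ρ12 a := dlift_rho _ _
theorem dD_sig (f : Du A) : dD (sig f) = hm σ2 σ1 σ21 f := dlift_sig _ _
noncomputable def R21 (A : Type*) [Ring A] [HopfAlgebra ℂ A] [FiniteDimensional ℂ A] : DD A ⊗[ℂ] DD A := cE ρ2 σ1
noncomputable def R12 (A : Type*) [Ring A] [HopfAlgebra ℂ A] [FiniteDimensional ℂ A] : DD A ⊗[ℂ] DD A := cE ρ1 σ2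
/-- monodromy -/
noncomputable def MM (A : Type*) [Ring A] [HopfAlgebra ℂ A] [FiniteDimensional ℂ A] : DD A ⊗[ℂ] DD A := R21 A * R12 A
theorem R21_int (a : A) : hm ρ1 ρ2 ρ12 a * R21 A = R21 A * hm ρ2 ρ1 ρ21 a := by
  have h := yd_basis (ydD.map (i1 (DD A) (DD A))) (ρ2.toLinearMap) a
  rw [hm_repr _ _ _ a (ℛ ℂ a), hm_repr _ _ _ a (ℛ ℂ a), R21, cE, Finset.sum_mul_sum, Finset.sum_mul_sum]
  rw [Finset.sum_comm (s := Finset.univ)]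
  refine Eq.symm (Eq.trans (Finset.sum_congr rfl fun k _ => Finset.sum_congr rfl fun i _ => ?_) (h.trans (Finset.sum_congr rfl fun k _ => Finset.sum_congr rfl fun i _ => ?_)))
  · simp
  · simp
theorem i1_comm {B C : Type*} [Ring B] [Algebra ℂ B] [Ring C] [Algebra ℂ C] {w : B} (h : ∀ x, w * x = x * w) (z : B ⊗[ℂ] C) : i1 B C w * z = z * i1 B C w := by
  induction z with
  | zero => simp
  | add a b ha hb => rw [mul_add, add_mul, ha, hb]
  | tmul a b => simp [h]
theorem i2_comm {B C : Type*} [Ring B] [Algebra ℂ B] [Ring C] [Algebra ℂ C] {w : C} (h : ∀ x, w * x = x * w) (z : B ⊗[ℂ] C) : i2 B C w * z = z * i2 B C w := by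
  induction z with
  | zero => simp
  | add a b ha hb => rw [mul_add, add_mul, ha, hb]
  | tmul a b => simp [h]
theorem dD_w : dD (wD A) = i1 _ _ (wD A) * i2 _ _ (wD A) * MM A := by
  have h3 := can3 (hm (ρ1 (A := A)) ρ2 ρ12).toLinearMap (ml σ2 σ1 σ21).toLinearMap
  simp only [AlgHom.toLinearMap_apply, ml_dl, ml_tmul, map_mul] at h3
  have e0 : dD (wD A) = ∑ k, hm ρ1 ρ2 ρ12 (bs A k) * hm σ2 σ1 σ21 (cb A k) := by
    simp only [wD, cE, map_sum, map_mul, dD_rho, dD_sig]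
  rw [e0, h3]
  have e1 := hmc (ρ1 (A := A)) ρ2 ρ12 σ1 ρσ21
  have e2 := hmc (ρ2 (A := A)) ρ1 ρ21 σ2 ρσ12
  have w1 : cE (ρ1 (A := A)) σ1 = i1 _ _ (wD A) := (cE_map _ _ _).symm
  have w2 : cE (ρ2 (A := A)) σ2 = i2 _ _ (wD A) := (cE_map _ _ _).symm
  rw [w1] at e1; rw [w2] at e2
  have e3 : ∀ i, ∑ j, hm ρ1 ρ2 ρ12 (bs A i) * hm ρ1 ρ2 ρ12 (bs A j) * (σ2 (cb A i) * σ1 (cb A j)) =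
      i1 _ _ (wD A) * R21 A * (hm ρ2 ρ1 ρ21 (bs A i) * σ2 (cb A i)) := fun i => by
    rw [← mul_assoc (i1 _ _ (wD A) * R21 A), mul_assoc (i1 _ _ (wD A)), ← R21_int, ← mul_assoc, i1_comm w_comm, mul_assoc (hm ρ1 ρ2 ρ12 (bs A i)), R21, ← e1,
      Finset.mul_sum, Finset.sum_mul]
    exact Finset.sum_congr rfl fun j _ => by rw [σ21]; simp only [mul_assoc]
  rw [Finset.sum_congr rfl fun i _ => e3 i, ← Finset.mul_sum, e2, MM, R12, mul_assoc, mul_assoc, ← mul_assoc (R21 A), ← i2_comm w_comm]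
  simp only [mul_assoc]
theorem M_comm (x : DD A) : MM A * dD x = dD x * MM A := by
  obtain ⟨w', hw⟩ := w_inv (A := A)
  have h : dD (wD A) * dD x = dD x * dD (wD A) := by rw [← map_mul, w_comm, map_mul]
  have hc : ∀ z, i1 _ _ (wD A) * i2 (DD A) (DD A) (wD A) * z = z * (i1 _ _ (wD A) * i2 _ _ (wD A)) := fun z => by
    rw [mul_assoc, i2_comm w_comm, ← mul_assoc, i1_comm w_comm, mul_assoc]
  have hi : i1 (DD A) (DD A) (wD A) * i2 (DD A) (DD A) (wD A) * (i2 _ _ w' * i1 _ _ w') = 1 := by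
    rw [mul_assoc, ← mul_assoc (i2 _ _ _), ← map_mul, hw, map_one, one_mul, ← map_mul, hw, map_one]
  rw [dD_w, mul_assoc, ← mul_assoc (dD x), ← hc, mul_assoc _ (dD x)] at h
  have h2 := congrArg (fun z => z * (i2 _ _ w' * i1 _ _ w')) h
  simp only [hc] at h2
  rwa [mul_assoc (MM A * dD x), hi, mul_one, mul_assoc (dD x * MM A), hi, mul_one] at h2

theorem w_scal {E : Type*} [Ring E] [Algebra ℂ E] [FiniteDimensional ℂ E] (π : DD A →ₐ[ℂ] E) (θ : ℂ) (hθ : π (wD A) = θ • 1) :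
    θ ^ (Module.finrank ℂ (E ⊗[ℂ] DD A) * Module.finrank ℂ A) = 1 := by
  let P : DD A ⊗[ℂ] DD A →ₐ[ℂ] E ⊗[ℂ] DD A := Algebra.TensorProduct.map (π) (AlgHom.id ℂ _)
  have P1 : ∀ x, P (i1 _ _ x) = i1 _ _ (π x) := fun x => by simp [P]
  have P2 : ∀ x, P (i2 _ _ x) = i2 _ _ x := fun x => by simp [P]
  let δ := P.comp dD
  have hS : ∀ y, y ∈ twS δ (i1 E (DD A)) (i2 E (DD A)) (fun a b => by simp) := DD.ind _ (fun a => by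
    show i2 _ _ (rho a) ∈ LinearMap.range (twm δ (i1 E (DD A)))
    have h := congrArg P (hmK5 ρ1 ρ2 ρ12 a)
    simp only [map_sum, map_mul, AlgHom.comp_apply, P1, P2] at h
    rw [← h]
    refine Submodule.sum_mem _ fun k _ => ?_
    rw [← dD_rho]; exact tw_mem δ (i1 E (DD A)) _ _) (fun f => by
    show i2 _ _ (sig f) ∈ LinearMap.range (twm δ (i1 E (DD A)))
    have h := congrArg P (hmK2 σ2 σ1 σ21 f)
    simp only [map_sum, map_mul, AlgHom.comp_apply, P1, P2] at h
    rw [← h]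
    refine Submodule.sum_mem _ fun k _ => ?_
    rw [← dD_sig]; exact tw_mem δ (i1 E (DD A)) _ _)
  have hb : Function.Bijective (twm δ (i1 E (DD A))) := tw_bij _ _ (fun y => by
    show y ∈ LinearMap.range _
    induction y with
    | zero => simp
    | add a b ha hb => exact add_mem ha hb
    | tmul a t =>
      have : a ⊗ₜ t = i2 E (DD A) t * i1 E (DD A) a := by simp
      rw [this]
      exact twrr _ _ _ (hS t)) (by rw [Module.finrank_tensorProduct, mul_comm])
  have hd := tw_det δ _ hb (wD A)
  have e : δ (wD A) = algebraMap ℂ _ θ * i2 _ _ (wD A) * (P (R21 A) * P (R12 A)) := by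
    show P (dD _) = _
    rw [dD_w, MM, map_mul, map_mul, map_mul, P1, P2, hθ]
    congr 2
    rw [Algebra.algebraMap_eq_smul_one, Algebra.TensorProduct.one_def, TensorProduct.smul_tmul']; rfl
  have d1 : LinearMap.det (LinearMap.mulLeft ℂ (P (R21 A))) ^ Module.finrank ℂ A = 1 := by
    rw [R21, cE_map]; exact detX _ _ fun a k => by have := congrArg P (ρσ21 a k); rwa [map_mul, map_mul] at this
  have d2 : LinearMap.det (LinearMap.mulLeft ℂ (P (R12 A))) ^ Module.finrank ℂ A = 1 := by
    rw [R12, cE_map]; exact detX _ _ fun a k => by have := congrArg P (ρσ12 a k); rwa [map_mul, map_mul] at this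
  have d0 : LinearMap.det (LinearMap.mulLeft ℂ (algebraMap ℂ (E ⊗[ℂ] DD A) θ)) = θ ^ Module.finrank ℂ (E ⊗[ℂ] DD A) := by
    have : LinearMap.mulLeft ℂ (algebraMap ℂ (E ⊗[ℂ] DD A) θ) = θ • LinearMap.id := by
      ext x; simp [Algebra.algebraMap_eq_smul_one]
    rw [this, LinearMap.det_smul, LinearMap.det_id, mul_one]
  rw [e, det_mul', det_mul', det_mul', d0, det_i2] at hd
  have hw : LinearMap.det (LinearMap.mulLeft ℂ (wD A)) ≠ 0 := fun h0 => by
    obtain ⟨w', hw⟩ := w_inv (A := A)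
    have := det_mul' (wD A) w'
    rw [h0, hw, zero_mul] at this
    simp [LinearMap.mulLeft_one] at this
  have hd2 := congrArg (· ^ Module.finrank ℂ A) hd
  simp only [mul_pow, d1, d2, mul_one] at hd2
  exact (pow_mul _ _ _).trans (show (θ ^ Module.finrank ℂ (E ⊗[ℂ] DD A)) ^ Module.finrank ℂ A = 1 from
    mul_right_cancel₀ (pow_ne_zero _ (pow_ne_zero _ hw)) (hd2.trans (one_mul _).symm))
theorem w_fin : ∃ m : ℕ, 0 < m ∧ wD A ^ m = 1 := by
  classical
  obtain ⟨W⟩ := wd_exists (DD A)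
  have key : ∀ i : Fin W.n, ∃ m : ℕ, 0 < m ∧ W.rp i (wD A) ^ m = 1 := fun i => by
    obtain ⟨θ, hθ⟩ := W.central_scalar (wD A) w_comm i
    have hd3 := w_scal (W.rp i) θ hθ
    haveI := W.hd i
    haveI : Nonempty (Fin (W.d i)) := ⟨⟨0, Nat.pos_of_ne_zero this.out⟩⟩
    haveI : Nontrivial (DD A) := (W.rp_surj i).nontrivial
    haveI : Nontrivial A := ⟨0, 1, fun h => zero_ne_one (α := DD A) (by rw [← map_zero (rho (A := A)), h, map_one])⟩
    refine ⟨Module.finrank ℂ (Module.End ℂ (Fin (W.d i) → ℂ) ⊗[ℂ] DD A) * Module.finrank ℂ A, Nat.mul_pos ?_ Module.finrank_pos, ?_⟩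
    · rw [Module.finrank_tensorProduct]; exact Nat.mul_pos Module.finrank_pos Module.finrank_pos
    · rw [hθ, smul_pow, one_pow, hd3, one_smul]
  choose m hm0 hm1 using key
  refine ⟨∏ i, m i, Finset.prod_pos fun i _ => hm0 i, W.ext_rp fun i => ?_⟩
  rw [map_pow, map_one, ← Finset.mul_prod_erase _ _ (Finset.mem_univ i), pow_mul, hm1, one_pow]
theorem M_fin : ∃ m : ℕ, 0 < m ∧ MM A ^ m = 1 := by
  obtain ⟨m, h0, h⟩ := w_fin (A := A)
  refine ⟨m, h0, ?_⟩
  have h1 := congrArg dD h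
  rw [map_pow, map_one, dD_w, Commute.mul_pow (show Commute _ _ from ?_), Commute.mul_pow (i1_comm w_comm _), ← map_pow, ← map_pow, h] at h1
  · rw [map_one, map_one, one_mul, one_mul] at h1; exact h1
  · show _ * _ = _ * _
    rw [mul_assoc, i2_comm w_comm, ← mul_assoc, i1_comm w_comm]; simp only [mul_assoc]
end
end HB
set_option linter.all false
namespace HB
open TensorProduct Coalgebra WithConv HopfAlgebra
section
variable {A : Type*} [Ring A] [HopfAlgebra ℂ A] [FiniteDimensional ℂ A] [IsSemisimpleRing A]
section pt
variable {D : Type*} [Ring D] [Algebra ℂ D]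
noncomputable def pt (τ : D →ₗ[ℂ] ℂ) : D ⊗[ℂ] D →ₗ[ℂ] D := (TensorProduct.rid ℂ D).toLinearMap ∘ₗ LinearMap.lTensor D τ
theorem pt_tmul (τ : D →ₗ[ℂ] ℂ) (x y : D) : pt τ (x ⊗ₜ y) = τ y • x := rfl
theorem pt_l (τ : D →ₗ[ℂ] ℂ) (x : D) (z : D ⊗[ℂ] D) : pt τ (i1 D D x * z) = x * pt τ z := by
  induction z with
  | zero => simp
  | add a b ha hb => rw [mul_add, map_add, map_add, ha, hb, mul_add]
  | tmul a b => simp [pt_tmul]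
theorem pt_r (τ : D →ₗ[ℂ] ℂ) (x : D) (z : D ⊗[ℂ] D) : pt τ (z * i1 D D x) = pt τ z * x := by
  induction z with
  | zero => simp
  | add a b ha hb => rw [add_mul, map_add, map_add, ha, hb, add_mul]
  | tmul a b => simp [pt_tmul]
theorem pt_t (τ : D →ₗ[ℂ] ℂ) (h : ∀ x y, τ (x * y) = τ (y * x)) (x : D) (z : D ⊗[ℂ] D) : pt τ (z * i2 D D x) = pt τ (i2 D D x * z) := by
  induction z with
  | zero => simp
  | add a b ha hb => rw [add_mul, mul_add, map_add, map_add, ha, hb]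
  | tmul a b => simp [pt_tmul, h b x]
theorem pt_cent (τ : D →ₗ[ℂ] ℂ) (h : ∀ x y, τ (x * y) = τ (y * x)) (M : D ⊗[ℂ] D) {ι : Type*} (s : Finset ι) (Y : ι → D ⊗[ℂ] D) (y : ι → D)
    (hY : ∀ k, M * Y k = Y k * M) (x : D) (h1 : ∑ k ∈ s, Y k * i2 D D (y k) = i1 D D x) (h2 : ∑ k ∈ s, i2 D D (y k) * Y k = i1 D D x) :
    pt τ M * x = x * pt τ M := by
  rw [← pt_r, ← pt_l, ← h1, Finset.mul_sum, map_sum, h1, ← h2, Finset.sum_mul, map_sum]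
  refine Finset.sum_congr rfl fun k _ => ?_
  rw [← mul_assoc, pt_t τ h, hY, mul_assoc]
noncomputable def tt (τ τ' : D →ₗ[ℂ] ℂ) : D ⊗[ℂ] D →ₗ[ℂ] ℂ := LinearMap.mul' ℂ ℂ ∘ₗ TensorProduct.map τ τ'
theorem tt_tmul (τ τ' : D →ₗ[ℂ] ℂ) (x y : D) : tt τ τ' (x ⊗ₜ y) = τ x * τ' y := rfl
theorem tt_pt (τ τ' : D →ₗ[ℂ] ℂ) (z : D ⊗[ℂ] D) : tt τ τ' z = τ (pt τ' z) := by
  induction z with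
  | zero => simp
  | add a b ha hb => rw [map_add, map_add, map_add, ha, hb]
  | tmul a b => simp [pt_tmul, tt_tmul, mul_comm]
end pt
/-- Drinfeld map -/
noncomputable def cc (τ : DD A →ₗ[ℂ] ℂ) : DD A := pt τ (MM A)
theorem MM_eq : MM A = ∑ i, ∑ j, (sig (cb A i) * rho (bs A j)) ⊗ₜ[ℂ] (rho (bs A i) * sig (cb A j)) := by
  rw [MM, R21, R12, cE, cE, Finset.sum_mul_sum]
  simp
theorem cc_eq (τ : DD A →ₗ[ℂ] ℂ) : cc τ = ∑ i, ∑ j, τ (rho (bs A i) * sig (cb A j)) • (sig (cb A i) * rho (bs A j)) := by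
  rw [cc, MM_eq]; simp only [map_sum, pt_tmul]
theorem cc_comm (τ : DD A →ₗ[ℂ] ℂ) (h : ∀ x y, τ (x * y) = τ (y * x)) (x : DD A) : cc τ * x = x * cc τ := by
  have := DD.ind (Subalgebra.centralizer ℂ {cc τ}) (fun a => ?_) (fun f => ?_) x
  · exact (Subalgebra.mem_centralizer_iff ℂ).1 this _ rfl
  · rw [Subalgebra.mem_centralizer_iff]; rintro _ rfl
    refine pt_cent τ h (MM A) (ℛ ℂ a).index (fun k => hm ρ1 ρ2 ρ12 ((ℛ ℂ a).left k)) (fun k => rho (antipode ℂ ((ℛ ℂ a).right k))) (fun k => ?_) _ (hmK2 ρ1 ρ2 ρ12 a) (hmK3 ρ1 ρ2 ρ12 a)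
    rw [← dD_rho]; exact M_comm _
  · rw [Subalgebra.mem_centralizer_iff]; rintro _ rfl
    have k5 := hmK5 (A := Du A) (σ2 (A := A)) σ1 σ21 f
    have k1 := hmK1 (A := Du A) (σ2 (A := A)) σ1 σ21 f
    simp only [← dD_sig] at k5 k1
    exact pt_cent τ h (MM A) _ _ _ (fun k => M_comm _) _ k5 k1
theorem cc_mul (τ τ' : DD A →ₗ[ℂ] ℂ) (h : ∀ x y, τ' (x * y) = τ' (y * x)) : cc (tt τ τ' ∘ₗ dD.toLinearMap) = cc τ' * cc τ := by
  rw [cc_eq, Finset.sum_comm]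
  have h1 : ∀ j, ∑ i, (tt τ τ' ∘ₗ dD.toLinearMap) (rho (bs A i) * sig (cb A j)) • (sig (cb A i) * rho (bs A j)) =
      ∑ i, ∑ i', tt τ τ' (ρ1 (bs A i) * ρ2 (bs A i') * hm σ2 σ1 σ21 (cb A j)) • (sig (cb A i * cb A i') * rho (bs A j)) := fun j => by
    have := can2 (((tt τ τ') ∘ₗ LinearMap.mulRight ℂ (hm σ2 σ1 σ21 (cb A j)) ∘ₗ (ml ρ1 ρ2 ρ12).toLinearMap).smulRight (1 : DD A))
      (LinearMap.mulRight ℂ (rho (bs A j)) ∘ₗ (sig (A := A)).toLinearMap)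
    simp only [LinearMap.smulRight_apply, LinearMap.comp_apply, AlgHom.toLinearMap_apply, LinearMap.mulRight_apply, ml_dl, ml_tmul, smul_mul_assoc, one_mul] at this
    simp only [LinearMap.comp_apply, AlgHom.toLinearMap_apply, map_mul, dD_rho, dD_sig] at this ⊢
    exact this
  rw [Finset.sum_congr rfl fun j _ => h1 j, Finset.sum_comm]
  have h2 : ∀ i, ∑ j, ∑ i', tt τ τ' (ρ1 (bs A i) * ρ2 (bs A i') * hm σ2 σ1 σ21 (cb A j)) • (sig (cb A i * cb A i') * rho (bs A j)) =
      ∑ i', ∑ j, ∑ j', tt τ τ' (ρ1 (bs A i) * ρ2 (bs A i') * (σ2 (cb A j) * σ1 (cb A j'))) • (sig (cb A i * cb A i') * rho (bs A j * bs A j')) := fun i => by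
    rw [Finset.sum_comm]
    refine Finset.sum_congr rfl fun i' _ => ?_
    have := can3 (LinearMap.mulLeft ℂ (sig (cb A i * cb A i')) ∘ₗ (rho (A := A)).toLinearMap) 
      (((tt τ τ') ∘ₗ LinearMap.mulLeft ℂ (ρ1 (bs A i) * ρ2 (bs A i')) ∘ₗ (ml σ2 σ1 σ21).toLinearMap).smulRight (1 : DD A))
    simp only [LinearMap.smulRight_apply, LinearMap.comp_apply, AlgHom.toLinearMap_apply, LinearMap.mulLeft_apply, ml_dl, ml_tmul, mul_smul_comm, mul_one] at this
    exact this
  rw [Finset.sum_congr rfl fun j _ => h2 j]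
  rw [cc_eq τ, Finset.mul_sum]
  refine Finset.sum_congr rfl fun i _ => ?_
  rw [Finset.mul_sum]
  have h3 : ∀ j, cc τ' * τ (rho (bs A i) * sig (cb A j)) • (sig (cb A i) * rho (bs A j)) = 
    τ (rho (bs A i) * sig (cb A j)) • (sig (cb A i) * cc τ' * rho (bs A j)) := fun j => by
    rw [mul_smul_comm, ← mul_assoc, cc_comm τ' h]
  rw [Finset.sum_congr rfl fun j _ => h3 j]
  simp only [cc_eq τ', Finset.mul_sum, Finset.sum_mul, Finset.smul_sum]
  symm
  rw [Finset.sum_comm]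
  refine Finset.sum_congr rfl fun i' _ => ?_
  rw [Finset.sum_comm]
  refine Finset.sum_congr rfl fun j _ => Finset.sum_congr rfl fun j' _ => ?_
  simp [tt_tmul, mul_smul, smul_mul_assoc, mul_smul_comm, mul_assoc]
end
end HB
set_option linter.all false
namespace HB
open TensorProduct Coalgebra WithConv HopfAlgebra
section gen
variable {B : Type*} [Ring B] [Algebra ℂ B] (w : Wd B)
theorem rep_dec {V : Type*} [AddCommGroup V] [Module ℂ V] [FiniteDimensional ℂ V] (P : B →ₐ[ℂ] Module.End ℂ V) (Q : Module.End ℂ V)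
    (hQ : Q * Q = Q) (hc : ∀ b, Q * P b = P b * Q) : ∃ N : Fin w.n → ℕ, ∀ b, LinearMap.trace ℂ V (Q * P b) = ∑ m, N m * w.ch m b := by
  have h : ∀ m, (Q * P (w.pid m)) * (Q * P (w.pid m)) = Q * P (w.pid m) := fun m => by
    rw [mul_assoc, ← mul_assoc (P _), ← hc, mul_assoc, ← map_mul, w.pid_idem, ← mul_assoc, hQ]
  choose N hN using fun m => trace_idem_nat (h m)
  refine ⟨N, fun b => ?_⟩
  have := w.trace_exp (LinearMap.trace ℂ V ∘ₗ LinearMap.mulLeft ℂ Q ∘ₗ P.toLinearMap) (fun x y => by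
    simp only [LinearMap.comp_apply, LinearMap.mulLeft_apply, AlgHom.toLinearMap_apply, map_mul]
    rw [← mul_assoc, LinearMap.trace_mul_comm, ← mul_assoc, ← hc, mul_assoc]) b
  simp only [LinearMap.comp_apply, LinearMap.mulLeft_apply, AlgHom.toLinearMap_apply, hN, smul_eq_mul] at this
  rw [this]; simp only [mul_comm]
theorem tt_trace {V V' : Type*} [AddCommGroup V] [Module ℂ V] [FiniteDimensional ℂ V] [AddCommGroup V'] [Module ℂ V'] [FiniteDimensional ℂ V']
   {C : Type*} [Ring C] [Algebra ℂ C] (P : B →ₐ[ℂ] Module.End ℂ V) (P' : C →ₐ[ℂ] Module.End ℂ V') (x : B) (y : C) :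
   LinearMap.trace ℂ _ (Module.endTensorEndAlgHom.comp (Algebra.TensorProduct.map P P') (x ⊗ₜ y) : Module.End ℂ (V ⊗[ℂ] V')) = LinearMap.trace ℂ _ (P x) * LinearMap.trace ℂ _ (P' y) := by
  rw [AlgHom.comp_apply, Algebra.TensorProduct.map_tmul, Module.endTensorEndAlgHom_apply]
  exact LinearMap.trace_tensorProduct' _ _
theorem fusion (δ : B →ₐ[ℂ] B ⊗[ℂ] B) (k l) : ∃ N : Fin w.n → ℕ, ∀ b, tt (w.ch k) (w.ch l) (δ b) = ∑ m, N m * w.ch m b := by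
  obtain ⟨N, hN⟩ := rep_dec w ((Module.endTensorEndAlgHom.comp (Algebra.TensorProduct.map (w.rp k) (w.rp l))).comp δ : B →ₐ[ℂ] Module.End ℂ (_ ⊗[ℂ] _)) 1 (by simp) (by simp)
  refine ⟨N, fun b => ?_⟩
  rw [← hN, one_mul, AlgHom.comp_apply]
  generalize δ b = z
  induction z with
  | zero => simp
  | add a b ha hb => rw [map_add, map_add, map_add, ha, hb]
  | tmul a b => rw [tt_trace, tt_tmul, w.ch_rp, w.ch_rp]
theorem alg_irr (φ : B →ₐ[ℂ] ℂ) : ∃ j, w.d j = 1 ∧ ∀ b, φ b = w.ch j b := by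
  have h0 := w.trace_exp φ.toLinearMap (fun x y => by simp [mul_comm])
  simp only [AlgHom.toLinearMap_apply, smul_eq_mul] at h0
  have hx : ∀ i, ∃ x : ℕ, φ (w.pid i) = x ∧ x * x = x := fun i => by
    have : φ (w.pid i) * φ (w.pid i) = φ (w.pid i) := by rw [← map_mul, w.pid_idem]
    rcases eq_or_ne (φ (w.pid i)) 0 with h | h
    · exact ⟨0, by simpa using h, rfl⟩
    · exact ⟨1, by simpa using mul_right_cancel₀ h (by rw [this, one_mul]), rfl⟩
  choose x hx hxx using hx
  have h1 := h0 1
  simp only [w.ch_one, hx, map_one] at h1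
  have h2 : ∑ i, w.d i * x i = 1 := by exact_mod_cast h1.symm
  obtain ⟨j, -, hj⟩ := Finset.exists_ne_zero_of_sum_ne_zero (h2.trans_ne one_ne_zero)
  have hxj : x j = 1 := Nat.eq_of_mul_eq_mul_left (Nat.pos_of_ne_zero (right_ne_zero_of_mul hj)) (by rw [hxx, mul_one])
  rw [← Finset.add_sum_erase _ _ (Finset.mem_univ j), hxj, mul_one] at h2
  have hd := (w.hd j).out
  have h3 : ∑ i ∈ Finset.univ.erase j, w.d i * x i = 0 := by omega
  refine ⟨j, by omega, fun b => ?_⟩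
  rw [h0 b, Finset.sum_eq_single j, hx, hxj, Nat.cast_one, mul_one]
  · intro i _ hi
    have := (Finset.sum_eq_zero_iff.1 h3) i (Finset.mem_erase.2 ⟨hi, Finset.mem_univ _⟩)
    rw [hx, (mul_eq_zero.1 this).resolve_left (w.hd i).out]; simp
  · simp
end gen
section
variable {A : Type*} [Ring A] [HopfAlgebra ℂ A] [FiniteDimensional ℂ A] [IsSemisimpleRing A]
theorem yd_eps : YD (Bialgebra.counitAlgHom ℂ A) (Bialgebra.counitAlgHom ℂ (Du A)) := by
  apply Wt.ext; intro a f
  rw [ydl_apply _ _ _ _ (ℛ ℂ a), ydr_apply _ _ _ _ (ℛ ℂ a)]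
  simp only [hc_apply, Bialgebra.counitAlgHom_apply, du_counit, rmul_apply, lmul_apply, one_mul, mul_one]
  have e1 := congrArg f (Coalgebra.sum_counit_smul (ℛ ℂ a))
  have e2 := congrArg f (sum_counit_smul' (ℛ ℂ a))
  simp only [map_sum, map_smul, smul_eq_mul] at e1 e2
  rw [e1]; rw [← e2]; simp only [mul_comm]
noncomputable def epsD (A : Type*) [Ring A] [HopfAlgebra ℂ A] [FiniteDimensional ℂ A] [IsSemisimpleRing A] : DD A →ₐ[ℂ] ℂ := dlift (yd_eps (A := A))
theorem epsD_rho (a : A) : epsD A (rho a) = counit (R := ℂ) a := dlift_rho _ _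
theorem epsD_sig (f : Du A) : epsD A (sig f) = f 1 := dlift_sig _ _
theorem cc_eps : cc (epsD A).toLinearMap = 1 := by
  rw [cc_eq]
  have e1 : ∑ i, (counit (R := ℂ) (bs A i)) • sig (cb A i) = (1 : DD A) := by
    rw [← map_one (sig (A := A))]; exact exD' (sig (A := A)).toLinearMap 1
  have e2 : ∑ j, (cb A j 1) • rho (bs A j) = (1 : DD A) := by
    rw [← map_one (rho (A := A))]; exact exK (rho (A := A)).toLinearMap 1
  have := congrArg₂ (· * ·) e1 e2
  simp only [Finset.sum_mul_sum, mul_one, smul_mul_smul_comm] at this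
  rw [← this]
  simp [epsD_rho, epsD_sig]
noncomputable def ccL : (DD A →ₗ[ℂ] ℂ) →ₗ[ℂ] DD A where
  toFun := cc
  map_add' x y := by simp only [cc_eq, LinearMap.add_apply, add_smul, Finset.sum_add_distrib]
  map_smul' c x := by simp only [cc_eq, LinearMap.smul_apply, smul_assoc, Finset.smul_sum, RingHom.id_apply]
theorem cc_sum {ι : Type*} (s : Finset ι) (c : ι → ℂ) (τ : ι → DD A →ₗ[ℂ] ℂ) : cc (∑ i ∈ s, c i • τ i) = ∑ i ∈ s, c i • cc (τ i) := by
  show ccL _ = _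
  simp only [map_sum, map_smul]; rfl
theorem cc_symm (τ τ' : DD A →ₗ[ℂ] ℂ) (h : ∀ x y, τ (x * y) = τ (y * x)) (h' : ∀ x y, τ' (x * y) = τ' (y * x)) : τ (cc τ') = τ' (cc τ) := by
  simp only [cc_eq, map_sum, map_smul, smul_eq_mul]
  rw [Finset.sum_comm]
  refine Finset.sum_congr rfl fun i _ => Finset.sum_congr rfl fun j _ => ?_
  rw [h' , h (sig _), mul_comm]
theorem cc_int (w : Wd (DD A)) (j) : ∃ α : Fin w.n → ℂ, (∀ k, w.rp j (cc (w.ch k)) = α k • 1) ∧ ∀ k, IsIntegral ℤ (α k) := by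
  choose α hα using fun k => w.central_scalar (cc (w.ch k)) (cc_comm _ (w.ch_comm k)) j
  refine ⟨α, hα, fun l => ?_⟩
  have inj : ∀ a b : ℂ, a • (1 : Module.End ℂ (Fin (w.d j) → ℂ)) = b • 1 → a = b := fun a b h => by
    have := congrArg (fun T : Module.End ℂ (Fin (w.d j) → ℂ) => T (fun _ => 1) 0) h
    simpa using this
  choose N hN using fun k => fusion w (dD (A := A)) k l
  have h1 : ∀ k, ∑ m, (N k m : ℂ) * α m = α l * α k := fun k => by
    have e : tt (w.ch k) (w.ch l) ∘ₗ (dD (A := A)).toLinearMap = ∑ m, (N k m : ℂ) • w.ch m := by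
      ext x; simpa using hN k x
    have := congrArg (w.rp j) (cc_mul (w.ch k) (w.ch l) (w.ch_comm l))
    rw [e, cc_sum, map_sum, map_mul, hα, hα] at this
    simp only [map_smul, hα, smul_smul, ← Finset.sum_smul, smul_mul_smul_comm, one_mul] at this
    exact inj _ _ this
  have h2 : ∃ k, α k ≠ 0 := by
    by_contra hcon
    push Not at hcon
    have h0 := w.trace_exp (epsD A).toLinearMap (fun x y => by simp [mul_comm])
    have e : (epsD A).toLinearMap = ∑ m, (epsD A (w.pid m)) • w.ch m := by
      ext x; rw [h0 x]; simp [mul_comm]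
    have := congrArg (w.rp j) (cc_eps (A := A))
    rw [e, cc_sum, map_sum] at this
    simp only [map_smul, hα, hcon, map_one, zero_smul, smul_zero, Finset.sum_const_zero] at this
    exact zero_ne_one (α := ℂ) (inj 0 1 (by simpa using this))
  obtain ⟨k, hk⟩ := h2
  exact eig_int (fun a b => (N a b : ℤ)) α k hk _ (by simpa using h1)
end
end HB
set_option linter.all false
namespace HB
open TensorProduct Coalgebra WithConv HopfAlgebra
theorem ss_of_form {B : Type*} [Ring B] [Algebra ℂ B] [FiniteDimensional ℂ B] (lam : B →ₗ[ℂ] ℂ) (hn : ∀ x, IsNilpotent x → lam x = 0)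
    (h : ∀ x : B, (∀ y, lam (x * y) = 0) → x = 0) : IsSemisimpleRing B := by
  have : IsArtinianRing B := IsArtinianRing.of_finite ℂ B
  rw [IsArtinianRing.isSemisimpleRing_iff_jacobson, eq_bot_iff]
  intro x hx
  obtain ⟨n, hn'⟩ := (IsSemiprimaryRing.isNilpotent (R := B))
  refine (Submodule.mem_bot _).2 (h x fun y => hn _ ⟨n, ?_⟩)
  have := Ideal.pow_mem_pow (Ideal.mul_mem_right y _ hx : x * y ∈ Ring.jacobson B) n
  rw [hn'] at this; simpa using this
theorem dvd_of_int (a b : ℕ) (hb : b ≠ 0) (h : IsIntegral ℤ ((a : ℂ) / b)) : b ∣ a := by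
  have h1 : IsIntegral ℤ ((a : ℚ) / b) := by
    rw [← isIntegral_algebraMap_iff (A := ℚ) (B := ℂ) (algebraMap ℚ ℂ).injective]; simpa using h
  obtain ⟨z, hz⟩ := IsIntegrallyClosed.isIntegral_iff.1 h1
  have hz' : (z : ℚ) * b = a := by
    have : (z : ℚ) = a / b := by simpa using hz
    rw [this, div_mul_cancel₀ _ (by exact_mod_cast hb)]
  have : z * (b : ℤ) = a := by exact_mod_cast hz'
  exact Int.natCast_dvd_natCast.1 ⟨z, by rw [← this, mul_comm]⟩
section
variable {A : Type*} [Ring A] [HopfAlgebra ℂ A] [FiniteDimensional ℂ A]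
def Cl (f : Du A) : Prop := ∀ a b, f (a * b) = f (b * a)
theorem Cl.one : Cl (1 : Du A) := fun a b => by simp [Du.one_apply, mul_comm]
theorem Cl.mul {f g : Du A} (hf : Cl f) (hg : Cl g) : Cl (f * g) := fun a b => by
  rw [pr_dl, pr_dl, map_mul (dl A), map_mul (dl A)]
  generalize dl A a = x
  generalize dl A b = y
  induction x with
  | zero => simp
  | add u v hu hv => rw [add_mul, mul_add, map_add, map_add, hu, hv]
  | tmul u v =>
    induction y with
    | zero => simp
    | add u v hu hv => rw [add_mul, mul_add, map_add, map_add, hu, hv]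
    | tmul u' v' => simp only [Algebra.TensorProduct.tmul_mul_tmul, pr_tmul, hf u, hg v]
theorem Cl.sdu {f : Du A} (hf : Cl f) : Cl (sdu f) := fun a b => by
  simp only [sdu_apply, antipode_mul_antidistrib]; exact hf _ _
variable (A) in
/-- class functions -/
noncomputable def RA : Subalgebra ℂ (Du A) where
  carrier := {f | Cl f}
  mul_mem' := Cl.mul
  one_mem' := Cl.one
  zero_mem' := fun a b => by simp
  add_mem' := fun hf hg a b => by simp [hf a, hg a]
  algebraMap_mem' r := fun a b => by rw [Algebra.algebraMap_eq_smul_one]; simp [Cl.one a b]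
theorem mem_RA {f : Du A} : f ∈ RA A ↔ Cl f := Iff.rfl
end
section
variable {A : Type*} [Ring A] [HopfAlgebra ℂ A] [FiniteDimensional ℂ A] [IsSemisimpleRing A]
/-- the Frobenius form on the dual -/
noncomputable def lam (A : Type*) [Ring A] [HopfAlgebra ℂ A] [FiniteDimensional ℂ A] [IsSemisimpleRing A] : Du A →ₗ[ℂ] ℂ := ev (Lm A)
theorem lam_apply (f : Du A) : lam A f = f (Lm A) := rfl
theorem N_ne : (Module.finrank ℂ A : ℂ) ≠ 0 := finrank_ne (Lm_int (A := A))
theorem lam_tr (f : Du A) : LinearMap.trace ℂ (Du A) (LinearMap.mulRight ℂ f) = Module.finrank ℂ A * lam A f := tr_mulRight f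
theorem lam_comm (f g : Du A) : lam A (f * g) = lam A (g * f) := by
  refine mul_left_cancel₀ (N_ne (A := A)) ?_
  rw [lam_apply, lam_apply, ← tr_mulLeft, ← tr_mulLeft]; exact chr_comm f g
theorem lam_nil (f : Du A) (h : IsNilpotent f) : lam A f = 0 := by
  refine (mul_eq_zero.1 ((lam_tr f).symm.trans ?_)).resolve_left (N_ne (A := A))
  obtain ⟨n, hn⟩ := h
  refine (LinearMap.isNilpotent_trace_of_isNilpotent ?_).eq_zero
  exact ⟨n, by rw [LinearMap.pow_mulRight, hn]; simp⟩
theorem lam_sdu (f : Du A) : lam A (sdu f) = lam A f := by rw [lam_apply, sdu_apply, S_Lm, lam_apply]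
variable (w : Wd A)
noncomputable def ich (i : Fin w.n) : Du A := Du.of (w.ch i)
theorem ich_apply (i) (a : A) : ich w i a = w.ch i a := rfl
theorem ich_cl (i) : Cl (ich w i) := w.ch_comm i
theorem cl_exp {f : Du A} (h : Cl f) : f = ∑ i, f (w.pid i) • ich w i := by
  ext a
  have := w.trace_exp (Du.lin f) h a
  simp only [Du.lin_apply, smul_eq_mul] at this
  rw [this]; simp [ich_apply, mul_comm]
theorem orth (i j) : lam A (ich w i * sdu (ich w j)) = if i = j then 1 else 0 := by
  let z : A := w.e.symm (Pi.single i 1)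
  have hz : ∀ k x, w.ch k (z * x) = if k = i then w.ch k x else 0 := fun k x => by
    rw [w.ch_mt, map_mul]
    split_ifs with h
    · subst h; simp [z, Wd.mt, w.ch_mt]
    · simp [z, Wd.mt, Pi.single_eq_of_ne h]
  have h1 : lmul z (xi A) = (w.d i : ℂ) • ich w i := by
    ext x
    rw [lmul_apply, xi_apply, chr_apply, w.trace_reg]
    simp [hz, ich_apply]
  have h2 := I1l (Lm_int (A := A)) (antipode ℂ z) (xi A)
  rw [lf_xi, mul_one, SS, h1] at h2
  have h3 := congrArg (sdu (ich w j)) h2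
  rw [ev_lf, sdu_apply, SS, ich_apply, smul_mul_assoc, Du.smul_apply] at h3
  have h4 := hz j 1
  rw [mul_one, w.ch_one] at h4
  rw [h4] at h3
  have hd : (w.d i : ℂ) ≠ 0 := by exact_mod_cast (w.hd i).out
  refine mul_left_cancel₀ hd (h3.symm.trans ?_)
  by_cases h : i = j
  · subst h; simp
  · simp [h, Ne.symm h]
theorem cl_exp' {f : Du A} (h : Cl f) : f = ∑ i, lam A (f * ich w i) • sdu (ich w i) := by
  have h1 := cl_exp w h.sdu
  have h2 : ∀ j, lam A (f * ich w j) = sdu f (w.pid j) := fun j => by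
    rw [lam_comm, ← lam_sdu, sdu_mul]
    conv_lhs => rw [h1]
    simp [Finset.sum_mul, orth, smul_mul_assoc]
  simp only [h2]
  conv_lhs => rw [← sdu_sdu f, h1, map_sum]
  simp
theorem lam_nd {f : Du A} (h : Cl f) (h0 : ∀ g, Cl g → lam A (f * g) = 0) : f = 0 := by
  obtain ⟨w⟩ := wd_exists A
  rw [cl_exp' w h]
  exact Finset.sum_eq_zero fun i _ => by rw [h0 _ (ich_cl w i), zero_smul]
instance RA_fd : FiniteDimensional ℂ (RA A) := inferInstanceAs (FiniteDimensional ℂ (RA A).toSubmodule)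
instance RA_ss : IsSemisimpleRing (RA A) := ss_of_form (lam A ∘ₗ (RA A).val.toLinearMap) (fun x hx => lam_nil _ (hx.map (RA A).val))
  fun x hx => Subtype.ext (lam_nd x.2 fun g hg => hx ⟨g, hg⟩)
theorem ich_mul (k l) : ∃ N : Fin w.n → ℕ, ich w k * ich w l = ∑ m, (N m : ℂ) • ich w m := by
  obtain ⟨N, hN⟩ := fusion w (dl A) k l
  refine ⟨N, ?_⟩
  ext a
  rw [pr_dl]
  refine Eq.trans (hN a) ?_
  simp [ich_apply]
theorem sdu_ich (k) : ∃ N : Fin w.n → ℕ, sdu (ich w k) = ∑ m, (N m : ℂ) • ich w m := by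
  have h : ∀ m, ∃ n : ℕ, w.ch k (antipode ℂ (w.pid m)) = n := fun m => by
    rw [w.ch_rp]
    apply trace_idem_nat
    rw [← map_mul, ← antipode_mul_antidistrib, w.pid_idem]
  choose N hN using h
  refine ⟨N, ?_⟩
  rw [cl_exp w (ich_cl w k).sdu]
  simp [ich_apply, hN]
theorem deg_int {e : Du A} (he : Cl e) (h0 : e ≠ 0) (hee : e * e = e) (hp : ∀ f, Cl f → ∃ c : ℂ, e * f * e = c • e) :
    lam A e ≠ 0 ∧ IsIntegral ℤ (1 / lam A e) := by
  obtain ⟨w⟩ := wd_exists A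
  have hl : ∀ f, Cl f → ∀ c : ℂ, e * f * e = c • e → lam A (f * e) = c * lam A e := fun f hf c hc => by
    have := congrArg (lam A) hc
    rwa [lam_comm, ← mul_assoc, hee, lam_comm, map_smul, smul_eq_mul] at this
  have hex : ∃ l, lam A (ich w l * e) ≠ 0 := by
    by_contra hcon
    push Not at hcon
    refine h0 ?_
    rw [cl_exp' w he]
    exact Finset.sum_eq_zero fun i _ => by rw [lam_comm, hcon, zero_smul]
  obtain ⟨l0, hl0⟩ := hex
  choose c hc using fun l => hp _ (ich_cl w l)
  have ht : lam A e ≠ 0 := fun h => hl0 (by rw [hl _ (ich_cl w l0) _ (hc l0), h, mul_zero])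
  refine ⟨ht, ?_⟩
  choose N1 h1 using ich_mul w
  choose N2 h2 using sdu_ich w
  refine eig_int (ι := Fin w.n × Fin w.n) (fun x y => ∑ i, N1 x.1 i y.1 * ∑ k, N2 i k * N1 x.2 k y.2)
    (fun x => lam A (ich w x.1 * e) * lam A (ich w x.2 * e)) (l0, l0) (mul_ne_zero hl0 hl0) _ ?_
  rintro ⟨l, m⟩
  have e1 : ∀ i, lam A (ich w l * ich w i * e) = ∑ l', N1 l i l' * lam A (ich w l' * e) := fun i => by
    rw [h1]; simp [Finset.sum_mul]
  have e2 : ∀ i, lam A (ich w m * sdu (ich w i) * e) = ∑ m', (∑ k, N2 i k * N1 m k m') * lam A (ich w m' * e) := fun i => by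
    rw [h2]; simp only [Finset.mul_sum, mul_smul_comm, h1, Finset.sum_mul, smul_mul_assoc, map_sum, map_smul, Finset.smul_sum, smul_eq_mul]
    rw [Finset.sum_comm]; simp [Finset.sum_mul, mul_assoc]
  have e3 : ∑ i, lam A (ich w l * ich w i * e) * lam A (ich w m * sdu (ich w i) * e) = lam A (ich w m * (e * ich w l) * e) := by
    conv_rhs => rw [cl_exp' w (he.mul (ich_cl w l))]
    simp only [Finset.mul_sum, Finset.sum_mul, mul_smul_comm, smul_mul_assoc, map_sum, map_smul, smul_eq_mul]
    refine Finset.sum_congr rfl fun i _ => ?_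
    rw [lam_comm _ e, ← mul_assoc]
  have e4 : lam A (ich w m * (e * ich w l) * e) = 1 / lam A e * (lam A (ich w l * e) * lam A (ich w m * e)) := by
    rw [mul_assoc, hc, mul_smul_comm, map_smul, hl _ (ich_cl w l) _ (hc l), smul_eq_mul]; field_simp
  rw [← e4, ← e3]
  simp only [e1, e2, Finset.sum_mul_sum, Fintype.sum_prod_type]
  push_cast
  simp only [Finset.sum_mul]
  symm
  rw [Finset.sum_comm]
  refine Finset.sum_congr rfl fun i _ => ?_
  rw [Finset.sum_comm]
  refine Finset.sum_congr rfl fun j _ => ?_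
  refine Finset.sum_congr rfl fun k _ => ?_
  rw [← Finset.sum_mul]; ring
end
end HB
set_option linter.all false
namespace HB
open TensorProduct Coalgebra WithConv HopfAlgebra
section
variable {B : Type*} [Ring B] [Algebra ℂ B] (w : Wd B)
theorem Wd.mu_prim (i k) (b : B) : w.mu i k k * b * w.mu i k k = (w.mt i b k k) • w.mu i k k := by
  apply w.ext_mt; intro j
  rw [map_mul, map_mul, map_smul]
  by_cases h : j = i
  · subst h; rw [w.mt_mu]; ext x y
    by_cases hx : x = k <;> by_cases hy : y = k <;> simp_all [Matrix.mul_apply, Matrix.single, eq_comm]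
  · rw [w.mt_mu_ne _ _ _ _ h]; simp
theorem Wd.mu_sum : ∑ i, ∑ k, w.mu i k k = 1 := by
  conv_rhs => rw [w.exp_mu 1]
  refine Finset.sum_congr rfl fun i _ => Finset.sum_congr rfl fun k _ => ?_
  rw [Finset.sum_eq_single k] <;> simp +contextual [Matrix.one_apply, eq_comm]
theorem Wd.mu_ne (i k) : w.mu i k k ≠ 0 := fun h => by
  have := congrArg (fun M => M k k) (w.mt_mu i k k)
  rw [h] at this; simp at this
end
section
variable {A : Type*} [Ring A] [HopfAlgebra ℂ A] [FiniteDimensional ℂ A] [IsSemisimpleRing A]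
theorem part4 {p : ℕ} (hp : p.Prime) (hpN : p ∣ Module.finrank ℂ A) : ∃ e : Du A, Cl e ∧ e * e = e ∧ e ≠ 0 ∧ e 1 = 0 ∧
    (∀ f, Cl f → ∃ c : ℂ, e * f * e = c • e) ∧ ∃ n : ℕ, Module.finrank ℂ A * lam A e = n ∧ n ∣ Module.finrank ℂ A ∧ ¬ p ∣ n := by
  obtain ⟨w⟩ := wd_exists (RA A)
  obtain ⟨j0, hj0, hch⟩ := alg_irr w ((Bialgebra.counitAlgHom ℂ (Du A)).comp (RA A).val)
  have hch : ∀ f : RA A, (f : Du A) 1 = w.ch j0 f := hch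
  have hpr : ∀ i k f, Cl f → ∃ c : ℂ, (w.mu i k k : Du A) * f * (w.mu i k k : Du A) = c • (w.mu i k k : Du A) := fun i k f hf =>
    ⟨_, congrArg Subtype.val (w.mu_prim i k ⟨f, hf⟩)⟩
  have hid : ∀ i k, (w.mu i k k : Du A) * (w.mu i k k : Du A) = (w.mu i k k : Du A) := fun i k =>
    congrArg Subtype.val (show w.mu i k k * w.mu i k k = _ by simp [w.mu_mul])
  have hne : ∀ i k, (w.mu i k k : Du A) ≠ 0 := fun i k h => w.mu_ne i k (Subtype.ext h)
  have hn : ∀ i k, ∃ n : ℕ, Module.finrank ℂ A * lam A (w.mu i k k) = n := fun i k => by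
    rw [← lam_tr]; apply trace_idem_nat
    ext1 x; simp [mul_assoc, hid]
  choose n hn using hn
  have hdv : ∀ i k, n i k ∣ Module.finrank ℂ A := fun i k => by
    obtain ⟨h1, h2⟩ := deg_int (w.mu i k k).2 (hne i k) (hid i k) (hpr i k)
    have h3 : (n i k : ℂ) ≠ 0 := by rw [← hn]; exact mul_ne_zero N_ne h1
    refine dvd_of_int _ _ (by exact_mod_cast h3) ?_
    convert h2 using 1
    rw [← hn]; field_simp [N_ne (A := A)]
  have hs : ∑ i, ∑ k, n i k = Module.finrank ℂ A := by
    have h := congrArg (fun x : RA A => Module.finrank ℂ A * lam A (x : Du A)) w.mu_sum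
    simp only [AddSubmonoidClass.coe_finset_sum, map_sum, Finset.mul_sum, hn] at h
    have h1 : lam A ((1 : RA A) : Du A) = 1 := by
      have := (Lm_int (A := A)).e
      simpa [lam_apply, Du.one_apply] using this
    rw [h1, mul_one] at h
    exact_mod_cast h
  have h0 : ∀ k, n j0 k = 1 := fun k => by
    obtain ⟨c, hc⟩ := hpr j0 k (xi A) chr_comm
    have e1 : (w.mu j0 k k : Du A) 1 = 1 := by rw [hch, w.ch_mt, w.mt_mu]; simp
    rw [mul_xi, e1, one_smul, xi_mul, e1, one_smul] at hc
    have h1 := congrArg (fun f : Du A => f 1) hc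
    simp only [xi_one, Du.smul_apply, e1, mul_one] at h1
    have h2 := congrArg (fun f : Du A => lam A f) hc
    simp only [lam_apply, xi_L (Lm_int (A := A)), Du.smul_apply, ← h1] at h2
    rw [← lam_apply, hn] at h2
    exact_mod_cast h2.symm
  have : ∃ i k, i ≠ j0 ∧ ¬ p ∣ n i k := by
    by_contra hcon
    push Not at hcon
    rw [← hs, ← Finset.add_sum_erase _ _ (Finset.mem_univ j0)] at hpN
    have h1 : ∑ k, n j0 k = 1 := by simp [h0, hj0]
    rw [h1] at hpN
    have h2 : p ∣ ∑ i ∈ Finset.univ.erase j0, ∑ k, n i k := Finset.dvd_sum fun i hi => Finset.dvd_sum fun k _ => hcon i k (Finset.ne_of_mem_erase hi)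
    exact hp.one_lt.ne' (Nat.dvd_one.1 ((Nat.dvd_add_left h2).1 hpN))
  obtain ⟨i, k, hi, hk⟩ := this
  refine ⟨w.mu i k k, (w.mu i k k).2, hid i k, hne i k, ?_, hpr i k, n i k, hn i k, hdv i k, hk⟩
  rw [hch, w.ch_mt, w.mt_mu_ne _ _ _ _ hi.symm]; simp

noncomputable def piK : DD A →ₐ[ℂ] Module.End ℂ (Du A) := dlift ydK
theorem piK_rho (a : A) (z : Du A) (x : A) : piK (rho a) z x = ∑ k ∈ (ℛ ℂ a).index, z (antipode ℂ ((ℛ ℂ a).right k) * (x * (ℛ ℂ a).left k)) := by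
  rw [piK, dlift_rho, hm_repr _ _ _ a (ℛ ℂ a)]
  simp only [LinearMap.sum_apply, Du.sum_apply, Module.End.mul_apply, r0_apply, t0_apply, rmul_apply, lmul_apply]
theorem piK_sig (f z : Du A) : piK (sig f) z = f * z := by rw [piK, dlift_sig, s0_apply]
theorem piK_cl {e : Du A} (he : Cl e) (a : A) : piK (rho a) e = counit (R := ℂ) a • e := by
  ext x
  rw [piK_rho]
  have := congrArg (fun y => e (x * y)) (sum_mul_antipode_eq_smul (ℛ ℂ a))
  simp only [Finset.mul_sum, map_sum, mul_smul_comm, mul_one, map_smul, smul_eq_mul] at this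
  rw [Du.smul_apply, ← this]
  refine Finset.sum_congr rfl fun k _ => ?_
  rw [he, mul_assoc]
theorem piK_e {e : Du A} (he : Cl e) (x : DD A) : piK x e = piK x 1 * e := by
  obtain ⟨z, rfl⟩ := mK_surj x
  induction z with
  | zero => simp
  | add a b ha hb => simp only [map_add, LinearMap.add_apply, ha, hb, add_mul]
  | tmul f a =>
    rw [mK_tmul, map_mul, Module.End.mul_apply, Module.End.mul_apply, piK_cl he, piK_cl Cl.one, piK_sig, piK_sig]; simp
theorem piK_mul {e : Du A} (he : Cl e) (x : DD A) (z : Du A) : piK x (z * e) = piK x z * e := by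
  have h : ∀ z, piK x z = piK (x * sig z) 1 := fun z => by rw [map_mul, Module.End.mul_apply, piK_sig, mul_one]
  rw [← piK_sig z e, ← Module.End.mul_apply, ← map_mul, piK_e he, ← h]
noncomputable def tF (τ : DD A →ₗ[ℂ] ℂ) : Du A := Du.of (τ ∘ₗ (rho (A := A)).toLinearMap)
theorem tF_apply (τ : DD A →ₗ[ℂ] ℂ) (a : A) : tF τ a = τ (rho a) := rfl
theorem piK_cc1 (τ : DD A →ₗ[ℂ] ℂ) : piK (cc τ) 1 = tF τ := by
  rw [cc_eq]
  simp only [map_sum, LinearMap.sum_apply, map_smul, LinearMap.smul_apply, map_mul, Module.End.mul_apply, piK_cl Cl.one, piK_sig, mul_smul_comm, mul_one]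
  conv_rhs => rw [← exD (tF τ)]
  refine Finset.sum_congr rfl fun i _ => ?_
  have e1 : ∑ i, (counit (R := ℂ) (bs A i)) • sig (cb A i) = (1 : DD A) := by
    rw [← map_one (sig (A := A))]; exact exD' (sig (A := A)).toLinearMap 1
  have e2 := congrArg (fun y => τ (rho (bs A i) * y)) e1
  simp only [Finset.mul_sum, map_sum, mul_smul_comm, map_smul, smul_eq_mul, mul_one] at e2
  rw [tF_apply, ← e2, Finset.sum_smul]
  simp only [smul_smul, mul_comm]
theorem piK_cc (τ : DD A →ₗ[ℂ] ℂ) (h : ∀ x y, τ (x * y) = τ (y * x)) (z : Du A) : piK (cc τ) z = z * tF τ := by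
  have : piK (cc τ) z = piK (cc τ * sig z) 1 := by rw [map_mul, Module.End.mul_apply, piK_sig, mul_one]
  rw [this, cc_comm _ h, map_mul, Module.End.mul_apply, piK_cc1, piK_sig]
theorem tF_comm (τ : DD A →ₗ[ℂ] ℂ) (h : ∀ x y, τ (x * y) = τ (y * x)) {e : Du A} (he : Cl e) : tF τ * e = e * tF τ := by
  rw [← piK_cc τ h, piK_e he, piK_cc1]
theorem tF_cl (τ : DD A →ₗ[ℂ] ℂ) (h : ∀ x y, τ (x * y) = τ (y * x)) : Cl (tF τ) := fun a b => by
  rw [tF_apply, tF_apply, map_mul rho, map_mul rho, h]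
end
end HB
set_option linter.all false
namespace HB
open TensorProduct Coalgebra WithConv HopfAlgebra
section
variable {A : Type*} [Ring A] [HopfAlgebra ℂ A] [FiniteDimensional ℂ A] [IsSemisimpleRing A]
theorem lam_ne (w : Wd A) {e : Du A} (he : Cl e) (h0 : e ≠ 0) : ∃ l, lam A (ich w l * e) ≠ 0 := by
  by_contra hcon
  push Not at hcon
  refine h0 ?_
  rw [cl_exp' w he]
  exact Finset.sum_eq_zero fun i _ => by rw [lam_comm, hcon, zero_smul]
theorem om_int (v : Wd (DD A)) (j) {e : Du A} (he : Cl e) (h0 : e ≠ 0) {ω : ℂ} (h : tF (v.ch j) * e = ω • e) : IsIntegral ℤ ω := by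
  obtain ⟨w⟩ := wd_exists A
  obtain ⟨m, hm⟩ := rep_dec w ((v.rp j).comp rho) 1 (by simp) (by simp)
  have hF : tF (v.ch j) = ∑ i, (m i : ℂ) • ich w i := by
    ext a; rw [tF_apply, v.ch_rp]
    have := hm a
    rw [one_mul, AlgHom.comp_apply] at this
    rw [this]; simp [ich_apply]
  choose N1 h1 using ich_mul w
  obtain ⟨l0, hl0⟩ := lam_ne w he h0
  refine eig_int (fun l l' => ∑ i, m i * N1 l i l') (fun l => lam A (ich w l * e)) l0 hl0 _ fun l => ?_
  have := congrArg (fun y => lam A (ich w l * y)) h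
  simp only [mul_smul_comm, map_smul, smul_eq_mul] at this
  rw [← this, hF]
  simp only [Finset.sum_mul, Finset.mul_sum, smul_mul_assoc, mul_smul_comm, ← mul_assoc, h1, map_sum, map_smul, smul_eq_mul]
  rw [Finset.sum_comm]
  push_cast
  refine Finset.sum_congr rfl fun i _ => ?_
  rw [Finset.sum_mul]
/-- trace functional of the ideal generated by an idempotent -/
noncomputable def ze (e : Du A) : DD A →ₗ[ℂ] ℂ := LinearMap.trace ℂ _ ∘ₗ LinearMap.mulLeft ℂ (LinearMap.mulRight ℂ e) ∘ₗ piK.toLinearMap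
theorem ze_apply (e : Du A) (x : DD A) : ze e x = LinearMap.trace ℂ _ (LinearMap.mulRight ℂ e * piK x) := rfl
theorem re_comm {e : Du A} (he : Cl e) (x : DD A) : LinearMap.mulRight ℂ e * piK x = piK x * LinearMap.mulRight ℂ e := by
  ext1 z; exact (piK_mul he x z).symm
theorem re_idem {e : Du A} (he : e * e = e) : (LinearMap.mulRight ℂ e * LinearMap.mulRight ℂ e : Module.End ℂ (Du A)) = LinearMap.mulRight ℂ e := by
  ext1 z; simp [mul_assoc, he]
theorem ze_cc (v : Wd (DD A)) (j) {e : Du A} {ω : ℂ} (h : tF (v.ch j) * e = ω • e) : ze e (cc (v.ch j)) = ω * (Module.finrank ℂ A * lam A e) := by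
  have : LinearMap.mulRight ℂ e * piK (cc (v.ch j)) = ω • (LinearMap.mulRight ℂ e : Module.End ℂ (Du A)) := by
    ext1 z
    simp only [Module.End.mul_apply, LinearMap.mulRight_apply, LinearMap.smul_apply]
    rw [piK_cc _ (v.ch_comm j), mul_assoc, h, mul_smul_comm]
  rw [ze_apply, this, map_smul, lam_tr, smul_eq_mul]
theorem om_div (v : Wd (DD A)) (j) {e : Du A} (he : Cl e) (hee : e * e = e) {ω : ℂ} (h : tF (v.ch j) * e = ω • e) :
    IsIntegral ℤ (Module.finrank ℂ A * lam A e * (ω / v.d j)) := by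
  obtain ⟨m, hm⟩ := rep_dec v piK (LinearMap.mulRight ℂ e) (re_idem hee) (re_comm he)
  obtain ⟨α, hα, hi⟩ := cc_int v j
  have hz : ze e = ∑ k, (m k : ℂ) • v.ch k := by ext x; rw [ze_apply, hm]; simp
  have ht : ∀ x y, ze e (x * y) = ze e (y * x) := fun x y => by rw [hz]; simp [v.ch_comm]
  have h1 := cc_symm (ze e) (v.ch j) ht (v.ch_comm j)
  have h2 : v.rp j (cc (ze e)) = (∑ k, (m k : ℂ) * α k) • 1 := by
    rw [hz, cc_sum, map_sum, Finset.sum_smul]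
    exact Finset.sum_congr rfl fun k _ => by rw [map_smul, hα, smul_smul]
  rw [ze_cc v j h, v.ch_rp, h2, map_smul, LinearMap.trace_one] at h1
  have hd : (v.d j : ℂ) ≠ 0 := by exact_mod_cast (v.hd j).out
  simp only [Module.finrank_fintype_fun_eq_card, Fintype.card_fin, smul_eq_mul] at h1
  have h3 : Module.finrank ℂ A * lam A e * (ω / v.d j) = ∑ k, (m k : ℂ) * α k := by
    field_simp; linear_combination h1
  rw [h3]
  exact IsIntegral.sum _ fun k _ => (isIntegral_algebraMap (R := ℤ) (x := (m k : ℤ))).mul (hi k)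
theorem om_sum (v : Wd (DD A)) {e : Du A} (h0 : e ≠ 0) (h1 : e 1 = 0) (ω : Fin v.n → ℂ) (h : ∀ j, tF (v.ch j) * e = ω j • e) : ∑ j, v.d j * ω j = 0 := by
  have hx : ∑ j, (v.d j : ℂ) • tF (v.ch j) = (Module.finrank ℂ A : ℂ) • xi A := by
    ext a
    have := chr_Drho a
    rw [chr_apply, v.trace_reg] at this
    simp only [Du.sum_apply, Du.smul_apply, tF_apply, this, xi_apply]
  have h2 := congrArg (· * e) hx
  simp only [Finset.sum_mul, smul_mul_assoc, h, xi_mul, h1, zero_smul, smul_zero, smul_smul, ← Finset.sum_smul] at h2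
  exact (smul_eq_zero.1 h2).resolve_right h0
theorem exj (v : Wd (DD A)) {q : ℕ} (hq : q.Prime) {e : Du A} (he : Cl e) (h0 : e ≠ 0) (h1 : e 1 = 0) (ω : Fin v.n → ℂ) (h : ∀ j, tF (v.ch j) * e = ω j • e) :
    ∃ j, ω j ≠ 0 ∧ ¬ q ∣ v.d j ∧ ∃ x, v.rp j x ≠ epsD A x • 1 := by
  obtain ⟨j0, hj0, hch⟩ := alg_irr v (epsD A)
  by_contra hcon
  have hc : ∀ j, j ≠ j0 → ω j ≠ 0 → q ∣ v.d j := fun j hj hw => by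
    by_contra hd
    refine hcon ⟨j, hw, hd, v.pid j0, fun h3 => ?_⟩
    have := congrArg (LinearMap.trace ℂ _) h3
    rw [← v.ch_rp, v.ch_pid, if_neg hj, map_smul, LinearMap.trace_one, hch, v.ch_pid] at this
    simp at this
    exact (v.hd j).out (by exact_mod_cast this.symm)
  have w0 : ω j0 = 1 := by
    have ht : tF (v.ch j0) = 1 := by
      ext a; rw [tF_apply, ← hch, epsD_rho, Du.one_apply]
    have := h j0
    rw [ht, one_mul] at this
    by_contra hne
    have h5 : (1 - ω j0) • e = 0 := by rw [sub_smul, ← this, one_smul, sub_self]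
    exact (smul_eq_zero.1 h5).elim (fun h => hne (sub_eq_zero.1 h).symm) h0
  have hs := om_sum v h0 h1 ω h
  rw [← Finset.add_sum_erase _ _ (Finset.mem_univ j0), w0, hj0, Nat.cast_one, mul_one] at hs
  have hq0 : (q : ℂ) ≠ 0 := by exact_mod_cast hq.ne_zero
  have hI : IsIntegral ℤ (∑ j ∈ Finset.univ.erase j0, v.d j * ω j / (q : ℂ)) := by
    refine IsIntegral.sum _ fun j hj => ?_
    by_cases hw : ω j = 0
    · rw [hw]; simpa using isIntegral_zero
    · obtain ⟨k, hk⟩ := hc j (Finset.ne_of_mem_erase hj) hw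
      have : (v.d j : ℂ) * ω j / q = ((k : ℤ) : ℂ) * ω j := by rw [hk]; push_cast; field_simp
      rw [this]
      exact (isIntegral_algebraMap (R := ℤ) (x := (k : ℤ))).mul (om_int v j he h0 (h j))
  rw [← Finset.sum_div] at hI
  have h6 : ((1 : ℕ) : ℂ) / q = -((∑ j ∈ Finset.univ.erase j0, v.d j * ω j) / (q : ℂ)) := by
    rw [← neg_div, Nat.cast_one]; congr 1; linear_combination hs
  have := dvd_of_int 1 q hq.ne_zero (by rw [h6]; exact hI.neg)
  exact hq.one_lt.ne' (Nat.dvd_one.1 this)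
theorem mono_eig (v : Wd (DD A)) (j) {e : Du A} (he : Cl e) (hee : e * e = e) {ω : ℂ} (h : tF (v.ch j) * e = ω • e) (hi : IsIntegral ℤ (ω / v.d j)) (hω : ω ≠ 0) (b : A) :
    v.rp j (rho (rf e b)) = (ω / v.d j * e b) • 1 := by
  have hd : (v.d j : ℂ) ≠ 0 := by exact_mod_cast (v.hd j).out
  let P : DD A ⊗[ℂ] DD A →ₐ[ℂ] Module.End ℂ (Du A ⊗[ℂ] (Fin (v.d j) → ℂ)) := Module.endTensorEndAlgHom.comp (Algebra.TensorProduct.map piK (v.rp j))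
  have hP : ∀ x y, P (x ⊗ₜ y) = TensorProduct.map (piK x) (v.rp j y) := fun x y => by
    simp only [P, AlgHom.comp_apply, Algebra.TensorProduct.map_tmul]; exact Module.endTensorEndAlgHom_apply _ _
  let Q : Module.End ℂ (Du A ⊗[ℂ] (Fin (v.d j) → ℂ)) := TensorProduct.map (LinearMap.mulRight ℂ e) 1
  have hQ : Q * Q = Q := by
    refine (TensorProduct.map_mul _ _ _ _).symm.trans ?_
    exact congrArg₂ TensorProduct.map (re_idem hee) (one_mul _)
  have hPQ : ∀ x y, P (x ⊗ₜ y) * Q = TensorProduct.map (LinearMap.mulRight ℂ e * piK x) (v.rp j y) := fun x y => by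
    rw [hP, re_comm he]
    exact (TensorProduct.map_mul _ _ _ _).symm
  have hQP : ∀ x y, Q * P (x ⊗ₜ y) = TensorProduct.map (LinearMap.mulRight ℂ e * piK x) (v.rp j y) := fun x y => by
    rw [hP]
    exact (TensorProduct.map_mul _ _ _ _).symm
  have hc : ∀ z, P z * Q = Q * P z := fun z => by
    induction z with
    | zero => simp
    | add a b ha hb => rw [map_add, add_mul, mul_add, ha, hb]
    | tmul x y => rw [hPQ, hQP]
  have htr : ∀ z, LinearMap.trace ℂ _ (P z * Q) = ze e (pt (v.ch j) z) := fun z => by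
    induction z with
    | zero => simp
    | add a b ha hb => rw [map_add, add_mul, map_add, map_add, map_add, ha, hb]
    | tmul x y => rw [hPQ, LinearMap.trace_tensorProduct', pt_tmul, map_smul, ze_apply, v.ch_rp, smul_eq_mul, mul_comm]
  obtain ⟨m, hm, hM⟩ := M_fin (A := A)
  have hav := avg (P (MM A)) Q hQ (hc _) m hm (by rw [← map_pow, hM, map_one]) _ hi (div_ne_zero hω hd) (by
    rw [htr]
    have : LinearMap.trace ℂ _ Q = Module.finrank ℂ A * lam A e * v.d j := by
      rw [LinearMap.trace_tensorProduct', lam_tr, LinearMap.trace_one]; simp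
    rw [this]
    refine (ze_cc v j h).trans ?_
    field_simp)
  ext1 i
  refine LinearMap.ext fun y => ?_
  let x : Fin (v.d j) → ℂ := LinearMap.single ℂ (fun _ => ℂ) i y
  have h1 := congrArg (fun U : Module.End ℂ _ => TensorProduct.lid ℂ _ (LinearMap.rTensor _ (ev b) (U ((1 : Du A) ⊗ₜ[ℂ] x)))) hav
  have h2 : Q ((1 : Du A) ⊗ₜ[ℂ] x) = e ⊗ₜ x := by
    show TensorProduct.map _ _ _ = _
    rw [TensorProduct.map_tmul]; simp
  have h3 : P (MM A) (e ⊗ₜ[ℂ] x) = ∑ i, (cb A i * e) ⊗ₜ v.rp j (rho (bs A i)) x := by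
    rw [MM_eq]
    simp only [map_sum, hP, LinearMap.sum_apply, TensorProduct.map_tmul, map_mul, Module.End.mul_apply, piK_cl he, piK_sig, mul_smul_comm, TensorProduct.smul_tmul]
    refine Finset.sum_congr rfl fun i _ => ?_
    rw [← TensorProduct.tmul_sum]
    congr 1
    simp only [← map_smul, ← map_sum]
    congr 1
    have e1 : ∑ i, (counit (R := ℂ) (bs A i)) • sig (cb A i) = (1 : DD A) := by
      rw [← map_one (sig (A := A))]; exact exD' (sig (A := A)).toLinearMap 1
    have := congrArg (fun T => v.rp j T x) e1
    simpa [map_sum, LinearMap.sum_apply] using this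
  simp only [Module.End.mul_apply, LinearMap.smul_apply, h2, h3, map_sum, map_smul, LinearMap.rTensor_tmul, TensorProduct.lid_tmul] at h1
  have h4 : ∑ i, (cb A i * e) b • v.rp j (rho (bs A i)) x = v.rp j (rho (rf e b)) x := by
    have := exK (LinearMap.applyₗ x ∘ₗ (v.rp j).toLinearMap ∘ₗ (rho (A := A)).toLinearMap) (rf e b)
    simp only [ev_rf] at this
    exact this
  have h5 := h4.symm.trans h1
  simp only [LinearMap.comp_apply, LinearMap.smul_apply, Module.End.one_apply, mul_smul]
  exact h5
/-- the prime power argument -/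
theorem part5a {p q : ℕ} (hp : p.Prime) (hq : q.Prime) (hpN : p ∣ Module.finrank ℂ A) (hN : ∀ l : ℕ, l.Prime → l ∣ Module.finrank ℂ A → l = p ∨ l = q) :
    ∃ (v : Wd (DD A)) (j : Fin v.n) (e : Du A) (β : ℂ), e ≠ 0 ∧ e 1 = 0 ∧ β ≠ 0 ∧ (∃ x, v.rp j x ≠ epsD A x • 1) ∧ ∀ b, v.rp j (rho (rf e b)) = (β * e b) • 1 := by
  obtain ⟨e, he, hee, h0, h1, hpr, n, hn, hnN, hpn⟩ := part4 hp hpN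
  obtain ⟨v⟩ := wd_exists (DD A)
  choose ω hω using fun j => hpr _ (tF_cl (v.ch j) (v.ch_comm j))
  replace hω : ∀ j, tF (v.ch j) * e = ω j • e := fun j => by
    rw [← hω, ← tF_comm _ (v.ch_comm j) he, mul_assoc, hee]
  obtain ⟨j, hj, hqd, hx⟩ := exj v hq he h0 h1 ω hω
  have hd : (v.d j : ℂ) ≠ 0 := by exact_mod_cast (v.hd j).out
  refine ⟨v, j, e, ω j / v.d j, h0, h1, div_ne_zero hj hd, hx, mono_eig v j he hee (hω j) ?_ hj⟩
  have hcop : Nat.Coprime n (v.d j) := Nat.Coprime.symm (Nat.Coprime.symm (Nat.coprime_of_dvd fun l hl h3 h4 => by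
    rcases hN l hl (h3.trans hnN) with rfl | rfl
    · exact hpn h3
    · exact hqd h4))
  have hb := Nat.gcd_eq_gcd_ab n (v.d j)
  rw [hcop.gcd_eq_one] at hb
  have hb' : (1 : ℂ) = n * (n.gcdA (v.d j) : ℤ) + v.d j * (n.gcdB (v.d j) : ℤ) := by exact_mod_cast hb
  have h5 := om_div v j he hee (hω j)
  rw [hn] at h5
  have : ω j / v.d j = ((n.gcdA (v.d j) : ℤ) : ℂ) * (n * (ω j / v.d j)) + ((n.gcdB (v.d j) : ℤ) : ℂ) * ω j := by
    calc ω j / v.d j = 1 * (ω j / v.d j) := (one_mul _).symm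
      _ = _ := by rw [hb']; field_simp
  rw [this]
  exact ((isIntegral_algebraMap (R := ℤ)).mul h5).add ((isIntegral_algebraMap (R := ℤ)).mul (om_int v j he h0 (hω j)))
end
end HB
set_option linter.all false
namespace HB
open TensorProduct Coalgebra WithConv HopfAlgebra
section
variable {A : Type*} [Ring A] [HopfAlgebra ℂ A] [FiniteDimensional ℂ A]
/-- left coideal -/
def LC (N : Submodule ℂ A) : Prop := ∀ a ∈ N, comul (R := ℂ) a ∈ LinearMap.range (LinearMap.lTensor A N.subtype)
theorem LC.map {N : Submodule ℂ A} (hN : LC N) {E F : Type*} [AddCommGroup E] [Module ℂ E] [AddCommGroup F] [Module ℂ F] (g : A →ₗ[ℂ] E) (f : A →ₗ[ℂ] F)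
    (x : F) (h : ∀ a ∈ N, f a = counit (R := ℂ) a • x) {a : A} (ha : a ∈ N) : TensorProduct.map g f (comul a) = g a ⊗ₜ x := by
  obtain ⟨z, hz⟩ := hN a ha
  have h1 : ∀ z : A ⊗[ℂ] N, TensorProduct.map g f (LinearMap.lTensor A N.subtype z) =
      TensorProduct.map g (LinearMap.toSpanSingleton ℂ F x) (LinearMap.lTensor A (counit (R := ℂ)) (LinearMap.lTensor A N.subtype z)) := fun z => by
    induction z with
    | zero => simp
    | add a b ha hb => simp only [map_add, ha, hb]
    | tmul a b => simp [h b.1 b.2]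
  rw [← hz, h1, hz, lTensor_counit_comul]; simp
/-- the ideal attached to a left coideal -/
noncomputable def IN (N : Submodule ℂ A) : Ideal A := (TwoSidedIdeal.span {x : A | ∃ a ∈ N, x = a - counit (R := ℂ) a • 1}).asIdeal
instance (N : Submodule ℂ A) : (IN N).IsTwoSided := inferInstanceAs (TwoSidedIdeal.asIdeal _).IsTwoSided
theorem IN_le (N : Submodule ℂ A) {E : Type*} [Ring E] [Algebra ℂ E] (Φ : A →ₐ[ℂ] E) (h : ∀ a ∈ N, Φ a = counit (R := ℂ) a • 1) {x : A} (hx : x ∈ IN N) : Φ x = 0 := by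
  have : TwoSidedIdeal.span {x : A | ∃ a ∈ N, x = a - counit (R := ℂ) a • 1} ≤ TwoSidedIdeal.ker Φ := by
    rw [TwoSidedIdeal.span_le]
    rintro _ ⟨a, ha, rfl⟩
    show _ ∈ TwoSidedIdeal.ker Φ
    rw [TwoSidedIdeal.mem_ker, map_sub, map_smul, map_one, h a ha, sub_self]
  exact (TwoSidedIdeal.mem_ker Φ).1 (this hx)
theorem IN_mem {N : Submodule ℂ A} {a : A} (ha : a ∈ N) : a - counit (R := ℂ) a • 1 ∈ IN N :=
  TwoSidedIdeal.subset_span (R := A) ⟨a, ha, rfl⟩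
theorem IN_mk {N : Submodule ℂ A} {a : A} (ha : a ∈ N) : Ideal.Quotient.mkₐ ℂ (IN N) a = counit (R := ℂ) a • 1 := by
  have := (Ideal.Quotient.eq_zero_iff_mem (I := IN N)).2 (IN_mem ha)
  rw [← sub_eq_zero, ← map_one (Ideal.Quotient.mkₐ ℂ (IN N)), ← map_smul, ← map_sub]; exact this
variable (A) in
/-- antipode as a homomorphism -/
noncomputable def aop : A →ₐ[ℂ] Aᵐᵒᵖ := AlgHom.ofLinearMap ((MulOpposite.opLinearEquiv ℂ).toLinearMap ∘ₗ antipode ℂ) (by simp)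
  (fun x y => by simp [antipode_mul_antidistrib])
theorem aop_apply (a : A) : aop A a = MulOpposite.op (antipode ℂ a) := rfl
theorem LC.S {N : Submodule ℂ A} (hN : LC N) {E : Type*} [Ring E] [Algebra ℂ E] (Φ : A →ₐ[ℂ] E) {β : ℂ} (hb : β ≠ 0) (h : ∀ a ∈ N, Φ a = counit (R := ℂ) a • β • 1)
    {a : A} (ha : a ∈ N) : Φ (antipode ℂ a) = counit (R := ℂ) a • β⁻¹ • 1 := by
  have h1 := congrArg (LinearMap.mul' ℂ E) (hN.map (Φ.toLinearMap ∘ₗ antipode ℂ) Φ.toLinearMap _ h ha)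
  have h2 : ∀ z : A ⊗[ℂ] A, LinearMap.mul' ℂ E (TensorProduct.map (Φ.toLinearMap ∘ₗ antipode ℂ) Φ.toLinearMap z) = Φ (LinearMap.mul' ℂ A (LinearMap.rTensor A (antipode ℂ) z)) := fun z => by
    induction z with
    | zero => simp
    | add a b ha hb => simp only [map_add, ha, hb]
    | tmul a b => simp
  rw [h2, mul_antipode_rTensor_comul_apply, AlgHom.commutes, Algebra.algebraMap_eq_smul_one, LinearMap.mul'_apply, mul_smul_comm, mul_one] at h1
  rw [smul_comm, h1, smul_smul, inv_mul_cancel₀ hb, one_smul]; rfl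
theorem IN_hopf {N : Submodule ℂ A} (hN : LC N) : (IN N).IsHopfIdeal ℂ where
  counit_eq_zero x hx := IN_le N (Bialgebra.counitAlgHom ℂ A) (fun a _ => by simp) hx
  map_mkQ_comul_eq_zero x hx := IN_le N ((Algebra.TensorProduct.map (Ideal.Quotient.mkₐ ℂ (IN N)) (Ideal.Quotient.mkₐ ℂ (IN N))).comp (dl A)) (fun a ha => by
    refine (hN.map (Ideal.Quotient.mkₐ ℂ (IN N)).toLinearMap (Ideal.Quotient.mkₐ ℂ (IN N)).toLinearMap 1 (fun a ha => IN_mk ha) ha).trans ?_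
    rw [AlgHom.toLinearMap_apply, IN_mk ha]; rfl) hx
  antipode_mem x hx := by
    have := IN_le N ((AlgHom.op (Ideal.Quotient.mkₐ ℂ (IN N))).comp (aop A)) (fun a ha => by
      rw [AlgHom.comp_apply, aop_apply, AlgHom.op_apply_apply, MulOpposite.unop_op, hN.S _ one_ne_zero (fun a ha => by rw [IN_mk ha, one_smul]) ha]
      simp) hx
    exact (Ideal.Quotient.eq_zero_iff_mem (I := IN N)).1 (MulOpposite.op_injective this)
end
section
universe u
variable {A : Type u} [Ring A] [HopfAlgebra ℂ A] [FiniteDimensional ℂ A] [IsSemisimpleRing A] {B : Type u} [Ring B] [HopfAlgebra ℂ B] [FiniteDimensional ℂ B] [IsSemisimpleRing B]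
theorem dim_dvd (f : A →ₐc[ℂ] B) (hf : Function.Surjective f) : Module.finrank ℂ B ∣ Module.finrank ℂ A := by
  have hB := N_ne (A := B)
  have hL : f (Lm A) = Lm B := by
    have h1 : f (Lm A) * Lm B = Lm B := by
      rw [(Lm_int (A := B)).l, CoalgHomClass.counit_comp_apply, (Lm_int (A := A)).e, one_smul]
    have h2 : f (Lm A) * Lm B = f (Lm A) := by
      obtain ⟨y, hy⟩ := hf (Lm B)
      rw [← hy, ← map_mul, (Lm_int (A := A)).r, map_smul, ← CoalgHomClass.counit_comp_apply f, hy, (Lm_int (A := B)).e, one_smul]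
    rw [← h1, h2]
  let e : Du A := (Module.finrank ℂ B : ℂ)⁻¹ • Du.of (Du.lin (xi B) ∘ₗ (f : A →ₗ[ℂ] B))
  have hm : ∀ a, e a = (Module.finrank ℂ B : ℂ)⁻¹ * xi B (f a) := fun a => rfl
  have hee : e * e = e := by
    ext a
    have h2 : (xi B * xi B) (f a) = Module.finrank ℂ B * xi B (f a) := by rw [xi_xi, Du.smul_apply]
    have h3 : comul (R := ℂ) (f a) = TensorProduct.map (f : A →ₗ[ℂ] B) (f : A →ₗ[ℂ] B) (comul a) := (CoalgHomClass.map_comp_comul_apply f a).symm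
    rw [Du.mul_apply, h3] at h2
    rw [Du.mul_apply, hm, ← mul_right_inj' hB, ← mul_right_inj' hB, mul_inv_cancel_left₀ hB, ← h2]
    generalize (comul a : A ⊗[ℂ] A) = z
    induction z with
    | zero => simp
    | add a b ha hb => simp only [map_add, mul_add, ha, hb]
    | tmul a b =>
      simp [hm]; field_simp
  obtain ⟨n, hn⟩ := trace_idem_nat (re_idem hee)
  rw [lam_tr, lam_apply, hm, hL, xi_L Lm_int, mul_one, ← div_eq_mul_inv] at hn
  exact dvd_of_int _ _ (by exact_mod_cast hB) (by rw [hn]; exact isIntegral_algebraMap (R := ℤ) (x := (n : ℤ)))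
/-- induction hypothesis -/
def IHyp (A : Type u) [Ring A] [HopfAlgebra ℂ A] : Prop := ∀ (B : Type u) [Ring B] [HopfAlgebra ℂ B] [FiniteDimensional ℂ B] [IsSemisimpleRing B],
  Module.finrank ℂ B < Module.finrank ℂ A → Module.finrank ℂ B ∣ Module.finrank ℂ A → 1 < Module.finrank ℂ B → ∃ φ : B →ₐ[ℂ] ℂ, φ ≠ Bialgebra.counitAlgHom ℂ B
theorem lemQ (hno : ∀ φ : A →ₐ[ℂ] ℂ, φ = Bialgebra.counitAlgHom ℂ A) (IH : IHyp A) {N : Submodule ℂ A} (hN : LC N) {a0 : A} (ha : a0 ∈ N) (h0 : a0 ≠ counit (R := ℂ) a0 • 1)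
    {E : Type*} [Ring E] [Algebra ℂ E] (Φ : A →ₐ[ℂ] E) (h : ∀ a ∈ N, Φ a = counit (R := ℂ) a • 1) (x : A) : Φ x = counit (R := ℂ) x • 1 := by
  haveI := IN_hopf hN
  have hss : IsSemisimpleRing (A ⧸ IN N) := (Ideal.Quotient.mk (IN N)).isSemisimpleRing_of_surjective Ideal.Quotient.mk_surjective
  haveI : FiniteDimensional ℂ (A ⧸ IN N) := Module.Finite.of_surjective (Ideal.Quotient.mkₐ ℂ (IN N)).toLinearMap Ideal.Quotient.mk_surjective
  have hdvd := dim_dvd (Bialgebra.Quotient.mkBialgHom (R := ℂ) (IN N)) Ideal.Quotient.mk_surjective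
  have hlt : Module.finrank ℂ (A ⧸ IN N) < Module.finrank ℂ A := by
    have h1 := LinearMap.finrank_range_add_finrank_ker (Ideal.Quotient.mkₐ ℂ (IN N)).toLinearMap
    rw [LinearMap.range_eq_top.2 Ideal.Quotient.mk_surjective, finrank_top] at h1
    have : 0 < Module.finrank ℂ (LinearMap.ker (Ideal.Quotient.mkₐ ℂ (IN N)).toLinearMap) := by
      haveI : Nontrivial (LinearMap.ker (Ideal.Quotient.mkₐ ℂ (IN N)).toLinearMap) :=
        ⟨⟨⟨_, Ideal.Quotient.eq_zero_iff_mem.2 (IN_mem ha)⟩, 0, fun h => h0 (sub_eq_zero.1 (congrArg Subtype.val h))⟩⟩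
      exact Module.finrank_pos
    omega
  have hle : ¬ 1 < Module.finrank ℂ (A ⧸ IN N) := fun hgt => by
    obtain ⟨φ, hφ⟩ := IH _ hlt hdvd hgt
    refine hφ (AlgHom.ext fun y => ?_)
    obtain ⟨y, rfl⟩ := Ideal.Quotient.mk_surjective y
    exact AlgHom.congr_fun (hno (φ.comp (Ideal.Quotient.mkₐ ℂ (IN N)))) y
  have h1 : (1 : A ⧸ IN N) ≠ 0 := fun h => by
    have := congrArg (counit (R := ℂ)) h
    rw [Bialgebra.counit_one, map_zero] at this
    exact one_ne_zero this
  haveI : Nontrivial (A ⧸ IN N) := ⟨_, _, h1⟩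
  have h2 : Module.finrank ℂ (A ⧸ IN N) = 1 := le_antisymm (not_lt.1 hle) Module.finrank_pos
  obtain ⟨c, hc⟩ := (finrank_eq_one_iff_of_nonzero' _ h1).1 h2 (Ideal.Quotient.mk _ x)
  have h3 : c = counit (R := ℂ) x := by
    have := congrArg (counit (R := ℂ)) hc
    rw [map_smul, Bialgebra.counit_one, smul_eq_mul, mul_one] at this
    exact this
  have h4 : x - c • 1 ∈ IN N := by
    rw [← Ideal.Quotient.eq_zero_iff_mem]
    have : Ideal.Quotient.mkₐ ℂ (IN N) (x - c • 1) = 0 := by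
      rw [map_sub, map_smul, map_one, hc]; exact sub_self _
    exact this
  have := IN_le N Φ h h4
  rw [map_sub, map_smul, map_one, h3] at this
  exact sub_eq_zero.1 this
end
end HB
set_option linter.all false
namespace HB
open TensorProduct Coalgebra WithConv HopfAlgebra
section
variable {A : Type*} [Ring A] [HopfAlgebra ℂ A] [FiniteDimensional ℂ A]
/-- adjoint action -/
noncomputable def adK {E : Type*} [Ring E] [Algebra ℂ E] (κ : A →ₐ[ℂ] E) : A →ₐ[ℂ] Module.End ℂ E :=
  (AlgHom.mulLeftRight ℂ E).comp ((Algebra.TensorProduct.map κ ((AlgHom.op κ).comp (aop A))).comp (dl A))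
variable {E : Type*} [Ring E] [Algebra ℂ E] (κ : A →ₐ[ℂ] E)
theorem adK_apply (a : A) (T : E) {ι : Type*} (r : Coalgebra.Repr ℂ a ι) : adK κ a T = ∑ i ∈ r.index, κ (r.left i) * T * κ (antipode ℂ (r.right i)) := by
  have e : dl A a = ∑ k ∈ r.index, r.left k ⊗ₜ r.right k := r.eq.symm
  simp only [adK, AlgHom.comp_apply, e, map_sum, LinearMap.sum_apply, Algebra.TensorProduct.map_tmul, AlgHom.mulLeftRight_apply]
  rfl
theorem adK_comm (h : ∀ x T, adK κ x T = counit (R := ℂ) x • T) (x : A) (T : E) : κ x * T = T * κ x := by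
  let G : W A E := toConv (LinearMap.mulRight ℂ T ∘ₗ κ.toLinearMap)
  let S : W A E := toConv (κ.toLinearMap ∘ₗ antipode ℂ)
  let k : W A E := toConv κ.toLinearMap
  have h1 : ∀ y, (G * S : W A E) y = counit (R := ℂ) y • T := fun y => by
    rw [(ℛ ℂ y).convMul_apply, ← h, adK_apply κ y T (ℛ ℂ y)]; rfl
  have h2 : S * k = 1 := by
    apply W.ext; intro y
    rw [(ℛ ℂ y).convMul_apply]
    have := congrArg κ (sum_antipode_mul_eq_smul (R := ℂ) (ℛ ℂ y))
    rw [map_sum, map_smul, map_one] at this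
    simp only [map_mul] at this
    refine this.trans ?_
    rw [← Algebra.algebraMap_eq_smul_one]; rfl
  have h3 : (G * S * k : W A E) x = T * κ x := by
    rw [(ℛ ℂ x).convMul_apply]
    simp only [h1]
    have := congrArg (fun z => T * κ z) (sum_counit_smul (R := ℂ) (ℛ ℂ x))
    simp only [map_sum, Finset.mul_sum, map_smul, mul_smul_comm] at this
    simp only [smul_mul_assoc]
    exact this
  rw [mul_assoc, h2, mul_one] at h3
  exact h3
end
section
universe u
variable {A : Type u} [Ring A] [HopfAlgebra ℂ A] [FiniteDimensional ℂ A] [IsSemisimpleRing A]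
theorem char_sc (hno : ∀ φ : A →ₐ[ℂ] ℂ, φ = Bialgebra.counitAlgHom ℂ A) {d : ℕ} (hd : d ≠ 0) (κ : A →ₐ[ℂ] Module.End ℂ (Fin d → ℂ)) (hs : ∀ x, ∃ c : ℂ, κ x = c • 1) (x : A) : κ x = counit (R := ℂ) x • 1 := by
  haveI : NeZero d := ⟨hd⟩
  choose c hc using hs
  have hinj : ∀ a b : ℂ, a • (1 : Module.End ℂ (Fin d → ℂ)) = b • 1 → a = b := fun a b hab => smul_left_injective ℂ (one_ne_zero (α := Module.End ℂ (Fin d → ℂ))) hab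
  let φ : A →ₐ[ℂ] ℂ := AlgHom.ofLinearMap ⟨⟨c, fun a b => hinj _ _ (by rw [← hc, map_add, hc, hc, add_smul])⟩, fun r a => hinj _ _ (by
    rw [← hc, map_smul, hc, smul_smul]; rfl)⟩ (hinj _ _ (by
      refine (hc 1).symm.trans ?_; rw [map_one, one_smul])) (fun a b => hinj _ _ (by
      refine (hc (a * b)).symm.trans ?_; rw [map_mul, hc, hc, smul_mul_smul_comm, one_mul]; rfl))
  have := AlgHom.congr_fun (hno φ) x
  rw [hc]; exact congrArg (· • _) this
theorem case1 (hno : ∀ φ : A →ₐ[ℂ] ℂ, φ = Bialgebra.counitAlgHom ℂ A) (IH : IHyp A) {d : ℕ} (hd : d ≠ 0) (κ : A →ₐ[ℂ] Module.End ℂ (Fin d → ℂ)) (e : Du A) (β : ℂ)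
    (h0 : e ≠ 0) (h1 : e 1 = 0) (hb : β ≠ 0) (h : ∀ b, κ (rf e b) = (β * e b) • 1) (x : A) : κ x = counit (R := ℂ) x • 1 := by
  have hN : LC (LinearMap.range (rf e)) := by
    rintro _ ⟨b, rfl⟩
    refine ⟨LinearMap.lTensor A (rf e).rangeRestrict (comul b), ?_⟩
    rw [comul_rf, ← LinearMap.lTensor_comp_apply]; rfl
  obtain ⟨b, hbb⟩ : ∃ b, rf e b ≠ counit (R := ℂ) (rf e b) • 1 := by
    by_contra hcon
    push Not at hcon
    refine h0 ?_
    have h2 : xi A * e = (Module.finrank ℂ A : ℂ) • e := by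
      ext b
      have := congrArg (xi A) (hcon b)
      rw [ev_rf, counit_rf, map_smul, xi_one] at this
      rw [this, Du.smul_apply, smul_eq_mul, mul_comm]
    rw [xi_mul, h1, zero_smul] at h2
    exact (smul_eq_zero.1 h2.symm).resolve_left N_ne
  have hk : ∀ a ∈ LinearMap.range (rf e), κ a = counit (R := ℂ) a • β • 1 := by
    rintro _ ⟨b, rfl⟩
    rw [h, counit_rf, smul_smul, mul_comm]
  have had := lemQ hno IH hN ⟨b, rfl⟩ hbb (E := Module.End ℂ (Module.End ℂ (Fin d → ℂ))) (adK κ) (fun a ha => by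
    have := hN.map κ.toLinearMap ((AlgHom.op κ).comp (aop A)).toLinearMap (β⁻¹ • 1) (fun a ha => by
      rw [AlgHom.toLinearMap_apply, AlgHom.comp_apply, aop_apply, AlgHom.op_apply_apply, MulOpposite.unop_op, hN.S κ hb hk ha]; rfl) ha
    refine (congrArg (AlgHom.mulLeftRight ℂ _) this).trans ?_
    refine LinearMap.ext fun T => ?_
    rw [AlgHom.mulLeftRight_apply, AlgHom.toLinearMap_apply, hk a ha, MulOpposite.unop_smul, MulOpposite.unop_one, smul_mul_assoc, smul_mul_assoc, smul_mul_assoc, smul_mul_assoc, one_mul, mul_smul_comm, mul_one, smul_smul β, mul_inv_cancel₀ hb, one_smul]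
    rfl)
  have hcm := adK_comm κ (fun x T => by rw [had x]; rfl)
  have hs : ∀ x, ∃ c : ℂ, κ x = c • 1 := fun x => by
    obtain ⟨c, hc⟩ := (Algebra.IsCentral.mem_center_iff ℂ).1 (Subalgebra.mem_center_iff.2 fun T => (hcm x T).symm)
    exact ⟨c, by rw [hc, Algebra.algebraMap_eq_smul_one]⟩
  exact char_sc hno hd κ hs x
theorem case2 (hno : ∀ φ : A →ₐ[ℂ] ℂ, φ = Bialgebra.counitAlgHom ℂ A) (IH : IHyp A) {d : ℕ} (κ : A →ₐ[ℂ] Module.End ℂ (Fin d → ℂ)) (σ : Du A →ₐ[ℂ] Module.End ℂ (Fin d → ℂ))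
    (hyd : YD κ σ) (hk : ∀ x, κ x = counit (R := ℂ) x • 1) (f0 : Du A) (h0 : σ f0 ≠ f0 1 • 1) (x T : A) : x * T = T * x := by
  have hcen : ∀ (a : A) (f : Du A), σ (rmul a f) = σ (lmul a f) := fun a f => by
    have h1 := congrArg (fun G : W (A ⊗[ℂ] Du A) _ => G (a ⊗ₜ f)) hyd
    simp only [ydl_apply _ _ a f (ℛ ℂ a), ydr_apply _ _ a f (ℛ ℂ a), hc_apply, hk, mul_smul_comm, mul_one, smul_mul_assoc, one_mul] at h1
    let L1 : A →ₗ[ℂ] Module.End ℂ (Fin d → ℂ) := ⟨⟨fun a => σ (rmul a f), fun a b => by rw [← map_add]; congr 1; ext; simp [mul_add]⟩, fun c a => by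
      refine (congrArg σ (show rmul (c • a) f = c • rmul a f by ext; simp)).trans (map_smul σ c _)⟩
    let L2 : A →ₗ[ℂ] Module.End ℂ (Fin d → ℂ) := ⟨⟨fun a => σ (lmul a f), fun a b => by rw [← map_add]; congr 1; ext; simp [add_mul]⟩, fun c a => by
      refine (congrArg σ (show lmul (c • a) f = c • lmul a f by ext; simp)).trans (map_smul σ c _)⟩
    have e1 := congrArg L1 (sum_counit_smul' (ℛ ℂ a))
    have e2 := congrArg L2 (sum_counit_smul (R := ℂ) (ℛ ℂ a))
    rw [map_sum] at e1 e2
    simp only [map_smul] at e1 e2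
    exact e1.symm.trans (h1.trans e2)
  let l : Fin d → Fin d → A := fun k m => ∑ i, (σ (cb A i) (Pi.single m 1) k) • bs A i
  have hl : ∀ (f : Du A) k m, f (l k m) = σ f (Pi.single m 1) k := fun f k m => by
    conv_rhs => rw [← exD f]
    simp [l, map_sum, map_smul, LinearMap.sum_apply, Finset.sum_apply, mul_comm]
  have hlc : ∀ k m a, a * l k m = l k m * a := fun k m a => sepA fun f => by
    have h1 := hl (lmul a f) k m
    rw [← hcen, ← hl] at h1
    simpa using h1
  have hep : ∀ k m, counit (R := ℂ) (l k m) = if k = m then 1 else 0 := fun k m => by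
    have := hl 1 k m
    rw [Du.one_apply, map_one] at this
    rw [this, Module.End.one_apply, Pi.single_apply]
  have hcom : ∀ k m, comul (R := ℂ) (l k m) = ∑ n, l k n ⊗ₜ l n m := fun k m => sepAA fun f g => by
    have h1 := hl (f * g) k m
    rw [Du.mul_apply] at h1
    refine h1.trans ?_
    simp only [map_sum, TensorProduct.map_tmul, LinearMap.mul'_apply, Du.lin_apply, hl, map_mul, Module.End.mul_apply]
    have h2 : σ g (Pi.single m 1) = ∑ n, σ g (Pi.single m 1) n • Pi.single n (1 : ℂ) := by
      ext j; simp [Finset.sum_apply, Pi.single_apply]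
    conv_lhs => rw [h2]
    simp [map_sum, Finset.sum_apply, mul_comm]
  let N : Submodule ℂ A := Submodule.span ℂ (Set.range fun i : Fin d × Fin d => l i.1 i.2)
  have hm : ∀ k m, l k m ∈ N := fun k m => Submodule.subset_span ⟨(k, m), rfl⟩
  have hN : LC N := by
    have : N ≤ (LinearMap.range (LinearMap.lTensor A N.subtype)).comap (comul (R := ℂ)) := by
      refine Submodule.span_le.2 ?_
      rintro _ ⟨⟨k, m⟩, rfl⟩
      refine ⟨∑ n, l k n ⊗ₜ ⟨l n m, hm n m⟩, ?_⟩
      simp [hcom]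
    exact this
  obtain ⟨k, m, hkm⟩ : ∃ k m, l k m ≠ counit (R := ℂ) (l k m) • 1 := by
    by_contra hcon
    push Not at hcon
    refine h0 ?_
    refine LinearMap.pi_ext' fun m => LinearMap.ext_ring (funext fun k => ?_)
    have := congrArg f0 (hcon k m)
    rw [hl, map_smul, hep] at this
    refine this.trans ?_
    simp [Pi.single_apply]
  have had : ∀ a ∈ N, adK (AlgHom.id ℂ A) a = counit (R := ℂ) a • 1 := by
    have : N ≤ LinearMap.eqLocus (adK (AlgHom.id ℂ A)).toLinearMap ((counit (R := ℂ)).smulRight 1) := by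
      refine Submodule.span_le.2 ?_
      rintro _ ⟨⟨k, m⟩, rfl⟩
      refine LinearMap.ext fun T => ?_
      have h1 := sum_mul_antipode_eq_smul (R := ℂ) (⟨Finset.univ, fun n => l k n, fun n => l n m, (hcom k m).symm⟩ : Coalgebra.Repr ℂ (l k m) (Fin d))
      have h2 := adK_apply (AlgHom.id ℂ A) (l k m) T ⟨Finset.univ, fun n => l k n, fun n => l n m, (hcom k m).symm⟩
      refine h2.trans ?_
      rw [show ((counit (R := ℂ) (A := A)).smulRight (1 : Module.End ℂ A) (l k m)) T = counit (R := ℂ) (l k m) • T from rfl]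
      refine Eq.trans ?_ ((congrArg (T * ·) h1).trans (by rw [mul_smul_comm, mul_one]))
      simp only [Finset.mul_sum]
      exact Finset.sum_congr rfl fun n _ => by rw [AlgHom.id_apply, AlgHom.id_apply, ← hlc, mul_assoc]
    exact this
  exact adK_comm (AlgHom.id ℂ A) (fun x T => by rw [lemQ hno IH hN (hm k m) hkm _ had x]; rfl) x T
end
end HB
set_option linter.all false
namespace HB
open TensorProduct Coalgebra WithConv HopfAlgebra
universe u
theorem comm_char {A : Type u} [Ring A] [HopfAlgebra ℂ A] [FiniteDimensional ℂ A] [IsSemisimpleRing A] (hcm : ∀ x y : A, x * y = y * x)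
    (hno : ∀ φ : A →ₐ[ℂ] ℂ, φ = Bialgebra.counitAlgHom ℂ A) : Module.finrank ℂ A ≤ 1 := by
  obtain ⟨w⟩ := wd_exists A
  have hs : ∀ i x, w.rp i x = counit (R := ℂ) x • 1 := fun i => char_sc hno (w.hd i).out (w.rp i) fun x => w.central_scalar x (hcm x) i
  have h1 : ∀ x : A, x = counit (R := ℂ) x • 1 := fun x => w.ext_rp fun i => by rw [hs, map_smul, map_one]
  exact finrank_le_one 1 fun x => ⟨_, (h1 x).symm⟩
theorem main {p q : ℕ} (hp : p.Prime) (hq : q.Prime) : ∀ (n : ℕ) (A : Type u) [Ring A] [HopfAlgebra ℂ A] [FiniteDimensional ℂ A] [IsSemisimpleRing A],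
    Module.finrank ℂ A = n → 1 < n → (∀ l : ℕ, l.Prime → l ∣ n → l = p ∨ l = q) → ∃ φ : A →ₐ[ℂ] ℂ, φ ≠ Bialgebra.counitAlgHom ℂ A := by
  intro n
  induction n using Nat.strong_induction_on with
  | _ n ih =>
  intro A _ _ _ _ hA h1 hl
  subst hA
  by_contra hcon
  push Not at hcon
  have IH : IHyp A := fun B _ _ _ _ hlt hd hgt => ih _ hlt B rfl hgt fun l h h' => hl l h (h'.trans hd)
  obtain ⟨v, j, e, β, h0, he1, hb, ⟨x, hx⟩, h⟩ : ∃ (v : Wd (DD A)) (j : Fin v.n) (e : Du A) (β : ℂ), e ≠ 0 ∧ e 1 = 0 ∧ β ≠ 0 ∧ (∃ x, v.rp j x ≠ epsD A x • 1) ∧ ∀ b, v.rp j (rho (rf e b)) = (β * e b) • 1 := by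
    obtain ⟨l, hlp, hld⟩ := Nat.exists_prime_and_dvd h1.ne'
    rcases hl l hlp hld with rfl | rfl
    · exact part5a hp hq hld hl
    · exact part5a hq hp hld fun l h h' => (hl l h h').symm
  have hk := case1 hcon IH (v.hd j).out ((v.rp j).comp rho) e β h0 he1 hb h
  obtain ⟨f0, hf0⟩ : ∃ f0 : Du A, (v.rp j).comp sig f0 ≠ f0 1 • 1 := by
    by_contra hc2
    push Not at hc2
    refine hx ?_
    have := DD.hom_ext (f := v.rp j) (g := (Algebra.ofId ℂ _).comp (epsD A)) (fun a => by
      rw [AlgHom.comp_apply, epsD_rho, Algebra.ofId_apply, Algebra.algebraMap_eq_smul_one]; exact hk a) (fun k => by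
      rw [AlgHom.comp_apply, epsD_sig, Algebra.ofId_apply, Algebra.algebraMap_eq_smul_one]; exact hc2 k)
    rw [← Algebra.algebraMap_eq_smul_one]
    exact AlgHom.congr_fun this x
  have hcm := case2 hcon IH ((v.rp j).comp rho) ((v.rp j).comp sig) (ydD.map (v.rp j)) hk f0 hf0
  exact absurd (comm_char hcm hcon) (not_le.2 h1)
end HB
open TensorProduct in
/-- Every semisimple Hopf algebra over ℂ of dimension `p^r * q^s > 1` (with `p, q` prime)
contains a nontrivial group-like element. -/
theorem semisimple_hopf_dim_prime_power_product_has_nontrivial_grouplike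
    (p q r s : ℕ) (hp : p.Prime) (hq : q.Prime) (hgt : 1 < p ^ r * q ^ s)
    (H : Type*) [Ring H] [HopfAlgebra ℂ H]
    [FiniteDimensional ℂ H] [IsSemisimpleRing H]
    (hdim : Module.finrank ℂ H = p ^ r * q ^ s) :
    ∃ g : H, g ≠ 1 ∧ Coalgebra.comul (R := ℂ) g = g ⊗ₜ[ℂ] g ∧
      Coalgebra.counit (R := ℂ) g = 1 := by
  obtain ⟨φ, hφ⟩ := HB.main hp hq _ (HB.Du H) (HB.finrank_Du.trans hdim) hgt fun l hl h => by
    rcases (Nat.Prime.dvd_mul hl).1 h with h | h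
    · exact .inl ((Nat.prime_dvd_prime_iff_eq hl hp).1 (hl.dvd_of_dvd_pow h))
    · exact .inr ((Nat.prime_dvd_prime_iff_eq hl hq).1 (hl.dvd_of_dvd_pow h))
  let g : H := ∑ i, φ (HB.cb H i) • HB.bs H i
  have hg : ∀ f : HB.Du H, f g = φ f := fun f => by
    have := HB.exD' φ.toLinearMap f
    refine Eq.trans ?_ this
    simp [g, mul_comm]
  refine ⟨g, fun h => hφ (AlgHom.ext fun f => ?_), HB.sepAA fun f k => ?_, ?_⟩
  · rw [← hg, h]; rfl
  · refine (hg (f * k)).trans ?_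
    rw [map_mul, ← hg, ← hg]; simp
  · have := hg 1
    rwa [HB.Du.one_apply, map_one] at this
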